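/- The set of proper gradient homotopy classes of proper gradient maps of Brouwer degree 1 on ℝ² has exactly two elements, namely the class of id_{ℝ²} and the class of −id_{ℝ²}: every proper gradient map ℝ² → ℝ² of degree 1 is proper gradient homotopic to id_{ℝ²} or to −id_{ℝ²}, and id_{ℝ²} and −id_{ℝ²} are not proper gradient homotopic to each other. -/

import Mathlib

open Set Metric Filter

noncomputable section

/-- Euclidean space `ℝⁿ`. -/
abbrev Euc (n : ℕ) := EuclideanSpace ℝ (Fin n)

/-- A map `f : ℝⁿ → ℝⁿ` is gradient if it is the gradient of a `C¹` function `φ : ℝⁿ → ℝ`. -/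
def IsGradient {n : ℕ} (f : Euc n → Euc n) : Prop :=
  ∃ φ : Euc n → ℝ, ContDiff ℝ 1 φ ∧ ∀ x, gradient φ x = f x

/-- A map is proper if preimages of compact sets are compact (our maps are continuous anyway). -/
def IsProper {n : ℕ} (f : Euc n → Euc n) : Prop :=
  ∀ K : Set (Euc n), IsCompact K → IsCompact (f ⁻¹' K)

/-- `h : [0,1] × ℝⁿ → ℝⁿ` is a gradient homotopy: it is continuous, each `h t` is a
gradient map, and the zero set `h⁻¹(0)` (within `[0,1] × ℝⁿ`) is compact. -/
def IsGradientHomotopy {n : ℕ} (h : ℝ → Euc n → Euc n) : Prop :=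
  ContinuousOn (fun p : ℝ × Euc n => h p.1 p.2) (Icc 0 1 ×ˢ univ) ∧
  (∀ t ∈ Icc (0:ℝ) 1, IsGradient (h t)) ∧
  IsCompact {p : ℝ × Euc n | p.1 ∈ Icc (0:ℝ) 1 ∧ h p.1 p.2 = 0}

/-- Two maps are gradient homotopic if some gradient homotopy connects them. -/
def GradientHomotopic {n : ℕ} (f g : Euc n → Euc n) : Prop :=
  ∃ h : ℝ → Euc n → Euc n, IsGradientHomotopy h ∧ h 0 = f ∧ h 1 = g

/-- `h : [0,1] × ℝⁿ → ℝⁿ` is a proper gradient homotopy: it is continuous, each `h t` is a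
gradient map, and `h` is proper as a map on `[0,1] × ℝⁿ`. -/
def IsProperGradientHomotopy {n : ℕ} (h : ℝ → Euc n → Euc n) : Prop :=
  ContinuousOn (fun p : ℝ × Euc n => h p.1 p.2) (Icc 0 1 ×ˢ univ) ∧
  (∀ t ∈ Icc (0:ℝ) 1, IsGradient (h t)) ∧
  (∀ K : Set (Euc n), IsCompact K →
    IsCompact {p : ℝ × Euc n | p.1 ∈ Icc (0:ℝ) 1 ∧ h p.1 p.2 ∈ K})

/-- Two maps are proper gradient homotopic if some proper gradient homotopy connects them. -/
def ProperGradientHomotopic {n : ℕ} (f g : Euc n → Euc n) : Prop :=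
  ∃ h : ℝ → Euc n → Euc n, IsProperGradientHomotopy h ∧ h 0 = f ∧ h 1 = g
/-- A Brouwer degree theory on `ℝⁿ`: an integer-valued function `deg f Ω`, defined for
continuous maps nonvanishing on `∂Ω`, satisfying the classical axioms of normalization,
additivity and homotopy invariance, which determine it uniquely. -/
structure DegreeTheory (n : ℕ) where
  deg : (Euc n → Euc n) → Set (Euc n) → ℤ
  normalized : ∀ Ω : Set (Euc n), IsOpen Ω → Bornology.IsBounded Ω → (0 : Euc n) ∈ Ω →
    deg id Ω = 1
  additive : ∀ (f : Euc n → Euc n) (Ω Ω₁ Ω₂ : Set (Euc n)),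
    IsOpen Ω → Bornology.IsBounded Ω → IsOpen Ω₁ → IsOpen Ω₂ →
    Ω₁ ⊆ Ω → Ω₂ ⊆ Ω → Disjoint Ω₁ Ω₂ →
    ContinuousOn f (closure Ω) →
    (∀ x ∈ closure Ω \ (Ω₁ ∪ Ω₂), f x ≠ 0) →
    deg f Ω = deg f Ω₁ + deg f Ω₂
  homotopyInv : ∀ (h : ℝ → Euc n → Euc n) (Ω : Set (Euc n)),
    IsOpen Ω → Bornology.IsBounded Ω →
    ContinuousOn (fun p : ℝ × Euc n => h p.1 p.2) (Icc 0 1 ×ˢ closure Ω) →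
    (∀ t ∈ Icc (0:ℝ) 1, ∀ x ∈ frontier Ω, h t x ≠ 0) →
    deg (h 0) Ω = deg (h 1) Ω

/-- `f` has Brouwer degree `k`: `deg f` computed on any ball containing `f⁻¹(0)` equals `k`. -/
def HasDeg {n : ℕ} (D : DegreeTheory n) (f : Euc n → Euc n) (k : ℤ) : Prop :=
  ∀ R : ℝ, 0 < R → f ⁻¹' {0} ⊆ ball 0 R → D.deg f (ball 0 R) = k

/-! ### Degree theory transported to the complex plane -/

/-- A degree theory on the complex plane. -/
structure CDeg where
  deg : (ℂ → ℂ) → Set ℂ → ℤ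
  normalized : ∀ Ω : Set ℂ, IsOpen Ω → Bornology.IsBounded Ω → (0 : ℂ) ∈ Ω →
    deg id Ω = 1
  additive : ∀ (f : ℂ → ℂ) (Ω Ω₁ Ω₂ : Set ℂ),
    IsOpen Ω → Bornology.IsBounded Ω → IsOpen Ω₁ → IsOpen Ω₂ →
    Ω₁ ⊆ Ω → Ω₂ ⊆ Ω → Disjoint Ω₁ Ω₂ →
    ContinuousOn f (closure Ω) →
    (∀ x ∈ closure Ω \ (Ω₁ ∪ Ω₂), f x ≠ 0) →
    deg f Ω = deg f Ω₁ + deg f Ω₂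
  homotopyInv : ∀ (h : ℝ → ℂ → ℂ) (Ω : Set ℂ),
    IsOpen Ω → Bornology.IsBounded Ω →
    ContinuousOn (fun p : ℝ × ℂ => h p.1 p.2) (Icc 0 1 ×ˢ closure Ω) →
    (∀ t ∈ Icc (0:ℝ) 1, ∀ x ∈ frontier Ω, h t x ≠ 0) →
    deg (h 0) Ω = deg (h 1) Ω

/-- The identification of the complex plane with the Euclidean plane. -/
def iotaC : ℂ ≃ₗᵢ[ℝ] Euc 2 := Complex.orthonormalBasisOneI.repr

/-- transport of maps -/
def toE (F : ℂ → ℂ) : Euc 2 → Euc 2 := fun x => iotaC (F (iotaC.symm x))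

/-- The transported degree theory. -/
def CDeg.ofD (D : DegreeTheory 2) : CDeg where
  deg F Ω := D.deg (toE F) (iotaC.symm ⁻¹' Ω)
  normalized := by
    intro Ω ho hb h0
    have : toE id = id := by ext x; simp [toE]
    rw [this]
    refine D.normalized _ (ho.preimage iotaC.symm.continuous) ?_ (by simpa using h0)
    exact iotaC.symm.antilipschitz.isBounded_preimage hb
  additive := by
    intro f Ω Ω₁ Ω₂ ho hb ho1 ho2 h1 h2 hd hc hz
    have hcl : ∀ S : Set ℂ, closure (iotaC.symm ⁻¹' S) = iotaC.symm ⁻¹' closure S := fun S =>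
      (iotaC.symm.toHomeomorph.preimage_closure S).symm
    refine D.additive _ _ _ _ (ho.preimage iotaC.symm.continuous)
      (iotaC.symm.antilipschitz.isBounded_preimage hb)
      (ho1.preimage iotaC.symm.continuous) (ho2.preimage iotaC.symm.continuous)
      (preimage_mono h1) (preimage_mono h2) (hd.preimage _) ?_ ?_
    · rw [hcl]
      exact iotaC.continuous.comp_continuousOn
        (hc.comp iotaC.symm.continuous.continuousOn (fun x hx => hx))
    · rw [hcl]
      intro x hx
      have := hz (iotaC.symm x) ⟨hx.1, fun h => hx.2 h⟩
      simpa [toE] using this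
  homotopyInv := by
    intro h Ω ho hb hc hz
    have hcl : ∀ S : Set ℂ, closure (iotaC.symm ⁻¹' S) = iotaC.symm ⁻¹' closure S := fun S =>
      (iotaC.symm.toHomeomorph.preimage_closure S).symm
    have hfr : ∀ S : Set ℂ, frontier (iotaC.symm ⁻¹' S) = iotaC.symm ⁻¹' frontier S := fun S =>
      (iotaC.symm.toHomeomorph.preimage_frontier S).symm
    refine D.homotopyInv (fun t => toE (h t)) _ (ho.preimage iotaC.symm.continuous)
      (iotaC.symm.antilipschitz.isBounded_preimage hb) ?_ ?_
    · rw [hcl]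
      have h1 : Continuous (fun p : ℝ × Euc 2 => (p.1, iotaC.symm p.2)) := by
        have := iotaC.symm.continuous
        fun_prop
      exact iotaC.continuous.comp_continuousOn
        (hc.comp h1.continuousOn (fun x hx => ⟨hx.1, hx.2⟩))
    · rw [hfr]
      intro t ht x hx
      have := hz t ht (iotaC.symm x) hx
      simpa [toE] using this

namespace CDeg
variable (D : CDeg)

theorem deg_empty (f : ℂ → ℂ) : D.deg f ∅ = 0 := by
  have := D.additive f ∅ ∅ ∅ isOpen_empty Bornology.isBounded_empty isOpen_empty isOpen_empty
    subset_rfl subset_rfl (by simp) (by simp) (by simp)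
  linarith

theorem deg_eq_zero {f : ℂ → ℂ} {Ω : Set ℂ} (ho : IsOpen Ω) (hb : Bornology.IsBounded Ω)
    (hc : ContinuousOn f (closure Ω)) (hz : ∀ x ∈ closure Ω, f x ≠ 0) : D.deg f Ω = 0 := by
  have := D.additive f Ω ∅ ∅ ho hb isOpen_empty isOpen_empty
    (empty_subset _) (empty_subset _) (by simp) hc (fun x hx => hz x hx.1)
  rw [this, deg_empty]; rfl

theorem excision {f : ℂ → ℂ} {Ω Ω₁ : Set ℂ} (ho : IsOpen Ω) (hb : Bornology.IsBounded Ω)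
    (ho1 : IsOpen Ω₁) (h1 : Ω₁ ⊆ Ω)
    (hc : ContinuousOn f (closure Ω)) (hz : ∀ x ∈ closure Ω, x ∉ Ω₁ → f x ≠ 0) :
    D.deg f Ω = D.deg f Ω₁ := by
  have := D.additive f Ω Ω₁ ∅ ho hb ho1 isOpen_empty
    h1 (empty_subset _) (by simp) hc (fun x hx => hz x hx.1 (fun h => hx.2 (Or.inl h)))
  rw [this, deg_empty, add_zero]

theorem linear {F G : ℂ → ℂ} {Ω : Set ℂ} (ho : IsOpen Ω) (hb : Bornology.IsBounded Ω)
    (hF : ContinuousOn F (closure Ω)) (hG : ContinuousOn G (closure Ω))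
    (hz : ∀ s ∈ Icc (0:ℝ) 1, ∀ x ∈ frontier Ω, (1 - s : ℝ) * F x + (s : ℝ) * G x ≠ 0) :
    D.deg F Ω = D.deg G Ω := by
  have h2 : ContinuousOn (fun p : ℝ × ℂ => p.2) (Icc 0 1 ×ˢ closure Ω) :=
    continuous_snd.continuousOn
  have := D.homotopyInv (fun s x => (1 - s : ℝ) * F x + (s : ℝ) * G x) Ω ho hb (by
    have hF' : ContinuousOn (fun p : ℝ × ℂ => F p.2) (Icc 0 1 ×ˢ closure Ω) :=
      hF.comp h2 (fun p hp => hp.2)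
    have hG' : ContinuousOn (fun p : ℝ × ℂ => G p.2) (Icc 0 1 ×ˢ closure Ω) :=
      hG.comp h2 (fun p hp => hp.2)
    have c1 : Continuous (fun p : ℝ × ℂ => ((1 - p.1 : ℝ) : ℂ)) := by fun_prop
    have c2 : Continuous (fun p : ℝ × ℂ => (p.1 : ℂ)) := by fun_prop
    exact (c1.continuousOn.mul hF').add (c2.continuousOn.mul hG')) hz
  simpa using this

theorem congr {F G : ℂ → ℂ} {Ω : Set ℂ} (ho : IsOpen Ω) (hb : Bornology.IsBounded Ω)
    (hF : ContinuousOn F (closure Ω)) (hFG : ∀ x ∈ closure Ω, F x = G x)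
    (hz : ∀ x ∈ frontier Ω, F x ≠ 0) : D.deg F Ω = D.deg G Ω := by
  refine D.linear ho hb hF (hF.congr fun x hx => (hFG x hx).symm) ?_
  intro s hs x hx
  rw [← hFG x (frontier_subset_closure hx), ← add_mul]
  simpa using hz x hx

theorem of_inner_pos {F G : ℂ → ℂ} {Ω : Set ℂ} (ho : IsOpen Ω) (hb : Bornology.IsBounded Ω)
    (hF : ContinuousOn F (closure Ω)) (hG : ContinuousOn G (closure Ω))
    (hz : ∀ x ∈ frontier Ω, 0 < (F x).re * (G x).re + (F x).im * (G x).im) :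
    D.deg F Ω = D.deg G Ω := by
  refine D.linear ho hb hF hG ?_
  intro s hs x hx h0
  have h := hz x hx
  have hre := congrArg Complex.re h0
  have him := congrArg Complex.im h0
  simp at hre him
  have e : (1 - s) * ((F x).re * (G x).re + (F x).im * (G x).im) +
    s * ((G x).re ^ 2 + (G x).im ^ 2) = 0 := by linear_combination (G x).re * hre + (G x).im * him
  have e2 : (1 - s) * ((F x).re ^ 2 + (F x).im ^ 2) +
    s * ((F x).re * (G x).re + (F x).im * (G x).im) = 0 := by
      linear_combination (F x).re * hre + (F x).im * him
  rcases le_or_gt s (1/2) with h' | h'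
  · nlinarith [mul_nonneg hs.1 (add_nonneg (sq_nonneg (G x).re) (sq_nonneg (G x).im)), mul_pos (show 0 < 1 - s by linarith) h]
  · nlinarith [mul_nonneg (show 0 ≤ 1 - s by linarith [hs.2]) (add_nonneg (sq_nonneg (F x).re) (sq_nonneg (F x).im)), mul_pos (show 0 < s by linarith) h]

theorem rouche {F G : ℂ → ℂ} {Ω : Set ℂ} (ho : IsOpen Ω) (hb : Bornology.IsBounded Ω)
    (hF : ContinuousOn F (closure Ω)) (hG : ContinuousOn G (closure Ω))
    (hz : ∀ x ∈ frontier Ω, ‖F x - G x‖ < ‖G x‖) :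
    D.deg F Ω = D.deg G Ω := by
  refine D.linear ho hb hF hG ?_
  intro s hs x hx h0
  have h := hz x hx
  have e : G x = -((1 - s : ℝ) * (F x - G x)) := by
    push_cast at h0 ⊢
    linear_combination h0
  have : ‖G x‖ = (1 - s) * ‖F x - G x‖ := by
    conv_lhs => rw [e]
    rw [norm_neg, norm_mul, Complex.norm_real, Real.norm_of_nonneg (by linarith [hs.2])]
  nlinarith [hs.1, norm_nonneg (F x - G x)]

theorem deg_const_mul {F : ℂ → ℂ} {Ω : Set ℂ} (ho : IsOpen Ω) (hb : Bornology.IsBounded Ω)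
    (hF : ContinuousOn F (closure Ω)) (hz : ∀ x ∈ frontier Ω, F x ≠ 0) {c : ℂ} (hc : c ≠ 0) :
    D.deg (fun x => c * F x) Ω = D.deg F Ω := by
  have h2 : ContinuousOn (fun p : ℝ × ℂ => p.2) (Icc 0 1 ×ˢ closure Ω) :=
    continuous_snd.continuousOn
  have := D.homotopyInv (fun s x => Complex.exp (s * Complex.log c) * F x) Ω ho hb (by
    have hF' : ContinuousOn (fun p : ℝ × ℂ => F p.2) (Icc 0 1 ×ˢ closure Ω) :=
      hF.comp h2 (fun p hp => hp.2)
    have c1 : Continuous (fun p : ℝ × ℂ => Complex.exp (p.1 * Complex.log c)) := by fun_prop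
    exact c1.continuousOn.mul hF') (fun s _ x hx => mul_ne_zero (Complex.exp_ne_zero _) (hz x hx))
  simpa [Complex.exp_log hc] using this.symm

theorem deg_neg {F : ℂ → ℂ} {Ω : Set ℂ} (ho : IsOpen Ω) (hb : Bornology.IsBounded Ω)
    (hF : ContinuousOn F (closure Ω)) (hz : ∀ x ∈ frontier Ω, F x ≠ 0) :
    D.deg (fun x => - F x) Ω = D.deg F Ω := by
  have := D.deg_const_mul ho hb hF hz (c := -1) (by simp)
  simpa using this

theorem deg_translate {G : ℂ → ℂ} (hG : Continuous G) (h0 : ∀ z, G z = 0 → z = 0)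
    (a b : ℂ) {ε δ : ℝ} (hε : 0 < ε) (hδ : 0 < δ) :
    D.deg (fun z => G (z - a)) (ball a ε) = D.deg (fun z => G (z - b)) (ball b δ) := by
  set R := ‖a‖ + ‖b‖ + ε + δ + 1 with hR
  have na := norm_nonneg a
  have nb := norm_nonneg b
  have e1 : D.deg (fun z => G (z - a)) (ball 0 R) = D.deg (fun z => G (z - a)) (ball a ε) := by
    refine D.excision isOpen_ball isBounded_ball isOpen_ball ?_ (by fun_prop) ?_
    · refine ball_subset_ball' ?_
      simp [hR]; linarith
    · intro x _ hx h
      apply hx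
      have := h0 _ h
      rw [sub_eq_zero] at this
      simp [this, hε]
  have e2 : D.deg (fun z => G (z - b)) (ball 0 R) = D.deg (fun z => G (z - b)) (ball b δ) := by
    refine D.excision isOpen_ball isBounded_ball isOpen_ball ?_ (by fun_prop) ?_
    · refine ball_subset_ball' ?_
      simp [hR]; linarith
    · intro x _ hx h
      apply hx
      have := h0 _ h
      rw [sub_eq_zero] at this
      simp [this, hδ]
  have e3 := D.homotopyInv (fun s z => G (z - ((1 - s : ℝ) * a + (s : ℝ) * b))) (ball 0 R)
    isOpen_ball isBounded_ball (by fun_prop) (by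
      intro s hs x hx h
      have := sub_eq_zero.1 (h0 _ h)
      rw [frontier_ball _ (by positivity)] at hx
      have h1 : ‖x‖ = R := by simpa using hx
      have h2 : ‖x‖ ≤ ‖a‖ + ‖b‖ := by
        rw [this]
        refine (norm_add_le _ _).trans ?_
        rw [norm_mul, norm_mul, Complex.norm_real, Complex.norm_real,
          Real.norm_of_nonneg (by linarith [hs.2]), Real.norm_of_nonneg hs.1]
        nlinarith [hs.1, hs.2]
      linarith)
  rw [← e1, ← e2]
  simpa using e3

theorem deg_sub (a : ℂ) {ε : ℝ} (hε : 0 < ε) : D.deg (fun z => z - a) (ball a ε) = 1 := by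
  have := D.deg_translate continuous_id (by simp) a 0 hε one_pos
  simp at this
  rw [this]
  exact D.normalized _ isOpen_ball isBounded_ball (by simp)

theorem deg_sum (S : Finset ℂ) : ∀ (f : ℂ → ℂ) (Ω : Set ℂ), IsOpen Ω → Bornology.IsBounded Ω →
    ContinuousOn f (closure Ω) → (S : Set ℂ) ⊆ Ω → (∀ x ∈ closure Ω, f x = 0 → x ∈ S) →
    ∀ d : ℂ → ℤ, (∀ a ∈ S, ∃ ε₀ > 0, ∀ ε, 0 < ε → ε < ε₀ → D.deg f (ball a ε) = d a) →
    D.deg f Ω = ∑ a ∈ S, d a := by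
  classical
  induction S using Finset.induction_on with
  | empty =>
    intro f Ω ho hb hc _ hz d _
    rw [D.deg_eq_zero ho hb hc (fun x hx h => by simpa using hz x hx h)]
    simp
  | insert a S haS ih =>
    intro f Ω ho hb hc hS hz d hd
    obtain ⟨ε₀, hε₀, h1⟩ := hd a (by simp)
    have haΩ : a ∈ Ω := hS (by simp)
    obtain ⟨ε₁, hε₁, h2⟩ := Metric.isOpen_iff.1 ho a haΩ
    obtain ⟨ε₂, hε₂, h3⟩ := Metric.isOpen_iff.1 (S.finite_toSet.isClosed.isOpen_compl) a
      (by simpa using haS)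
    obtain ⟨ε, hε, hε'⟩ : ∃ ε, 0 < ε ∧ ε < min ε₀ (min ε₁ ε₂) :=
      exists_between (by positivity)
    simp only [lt_min_iff] at hε'
    have hcb : closedBall a ε ⊆ ball a ε₁ := closedBall_subset_ball hε'.2.1
    have hcl : closure (Ω \ closedBall a ε) ⊆ closure Ω := closure_mono sdiff_subset
    have hcl2 : closure (Ω \ closedBall a ε) ⊆ (ball a ε)ᶜ := by
      refine closure_minimal ?_ isOpen_ball.isClosed_compl
      intro x hx hx'
      exact hx.2 (ball_subset_closedBall hx')
    rw [Finset.sum_insert haS, D.additive f Ω (ball a ε) (Ω \ closedBall a ε) ho hb isOpen_ball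
      (ho.sdiff isClosed_closedBall) ((ball_subset_closedBall.trans hcb).trans h2) sdiff_subset
      (Set.disjoint_left.2 fun x hx hx' => hx'.2 (ball_subset_closedBall hx)) hc ?_,
      h1 ε hε hε'.1, ih f (Ω \ closedBall a ε) (ho.sdiff isClosed_closedBall) (hb.subset sdiff_subset)
      (hc.mono hcl) ?_ ?_ d (fun b hb => hd b (by simp [hb]))]
    · intro x hx
      refine ⟨hS (by simp [show x ∈ S from hx]), fun h => ?_⟩
      exact h3 (closedBall_subset_ball hε'.2.2 h) hx
    · intro x hx hfx
      rcases Finset.mem_insert.1 (hz x (hcl hx) hfx) with h | h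
      · exact absurd (mem_ball_self hε) (h ▸ hcl2 hx)
      · exact h
    · intro x hx hfx
      rcases Finset.mem_insert.1 (hz x hx.1 hfx) with h | h
      · exact hx.2 (Or.inl (h ▸ mem_ball_self hε))
      · refine hx.2 (Or.inr ⟨hS (by simp [h]), fun h' => ?_⟩)
        exact h3 (closedBall_subset_ball hε'.2.2 h') h

/-- local degree when a continuous factor is frozen -/
theorem deg_local {k G : ℂ → ℂ} {a : ℂ} (hk : ContinuousAt k a) (hka : k a ≠ 0)
    (hG : Continuous G) (hG0 : ∀ z, G z = 0 → z = a) {n : ℤ}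
    (hn : ∀ ε > 0, D.deg G (ball a ε) = n) {s : Set ℂ} (hs : s ∈ nhds a) (hks : ContinuousOn k s) :
    ∃ ε₀ > 0, ∀ ε, 0 < ε → ε < ε₀ → D.deg (fun z => k z * G z) (ball a ε) = n := by
  obtain ⟨ε₁, hε₁, h1⟩ := Metric.continuousAt_iff.1 hk ‖k a‖ (by positivity)
  obtain ⟨ε₂, hε₂, h2⟩ := Metric.mem_nhds_iff.1 hs
  refine ⟨min ε₁ ε₂, by positivity, fun ε hε hε' => ?_⟩
  simp only [lt_min_iff] at hε'
  have hcl : closure (ball a ε) = closedBall a ε := closure_ball a hε.ne'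
  have hfr : ∀ x ∈ frontier (ball a ε), G x ≠ 0 := by
    intro x hx h
    rw [frontier_ball _ hε.ne'] at hx
    have := hG0 x h
    simp [this] at hx
    exact hε.ne' hx.symm
  rw [← hn ε hε, ← D.deg_const_mul isOpen_ball isBounded_ball hG.continuousOn hfr hka]
  refine D.rouche isOpen_ball isBounded_ball ?_ (by fun_prop) ?_
  · refine ContinuousOn.mul (hks.mono ?_) hG.continuousOn
    rw [hcl]
    exact (closedBall_subset_ball hε'.2).trans h2
  · intro x hx
    have hx' := hfr x hx
    rw [frontier_ball _ hε.ne'] at hx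
    have := h1 (x := x) (by rw [mem_sphere.1 hx]; exact hε'.1)
    rw [← sub_mul, norm_mul, norm_mul]
    rw [dist_eq_norm] at this
    exact mul_lt_mul_of_pos_right this (by positivity)

theorem deg_conj (a : ℂ) {ε : ℝ} (hε : 0 < ε) :
    D.deg (fun z => (starRingEnd ℂ) (z - a)) (ball a ε) = -1 := by
  rw [D.deg_translate (G := fun z => (starRingEnd ℂ) z) Complex.continuous_conj (by simp) a (-1)
    hε one_pos]
  set F : ℝ → ℂ → ℂ := fun s z => ((z.re ^ 2 - s : ℝ) : ℂ) + (z.im : ℂ) * Complex.I with hFd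
  have hre : ∀ s z, (F s z).re = z.re ^ 2 - s := by intro s z; simp [F, ← Complex.ofReal_pow]
  have him : ∀ s z, (F s z).im = z.im := by intro s z; simp [F, ← Complex.ofReal_pow]
  have hFc : Continuous (fun p : ℝ × ℂ => F p.1 p.2) := by
    have h1 : Continuous (fun p : ℝ × ℂ => p.2.re) := Complex.continuous_re.comp continuous_snd
    have h2 : Continuous (fun p : ℝ × ℂ => p.2.im) := Complex.continuous_im.comp continuous_snd
    simp only [hFd]
    fun_prop
  have hFc' : ∀ s, Continuous (F s) := fun s => hFc.comp (by fun_prop : Continuous fun z : ℂ => (s, z))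
  have h1 : D.deg (F (-1)) (ball 0 2) = D.deg (F 1) (ball 0 2) := by
    have := D.homotopyInv (fun s => F (2 * s - 1)) (ball 0 2) isOpen_ball isBounded_ball
      (by
        have : Continuous (fun p : ℝ × ℂ => ((2 * p.1 - 1, p.2) : ℝ × ℂ)) := by fun_prop
        exact (hFc.comp this).continuousOn) (by
        intro s hs x hx h
        have a1 := hre (2 * s - 1) x
        have a2 := him (2 * s - 1) x
        rw [h] at a1 a2
        rw [frontier_ball _ (by norm_num)] at hx
        have h3 : ‖x‖ ^ 2 = 4 := by
          have : ‖x‖ = 2 := by simpa using hx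
          rw [this]; norm_num
        rw [Complex.sq_norm, Complex.normSq_apply] at h3
        simp at a1 a2
        rw [← a2] at h3
        nlinarith [hs.2])
    norm_num at this
    exact this
  have h2 : D.deg (F (-1)) (ball 0 2) = 0 := by
    refine D.deg_eq_zero isOpen_ball isBounded_ball (hFc' _).continuousOn ?_
    intro x _ h
    have a1 := hre (-1) x
    rw [h] at a1
    simp at a1
    nlinarith [sq_nonneg x.re]
  have key1 : D.deg (F 1) (ball 1 1) = 1 := by
    rw [← D.deg_sub 1 one_pos]
    refine D.of_inner_pos isOpen_ball isBounded_ball (hFc' _).continuousOn (by fun_prop) ?_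
    intro x hx
    rw [frontier_ball _ (by norm_num)] at hx
    have h3 : ‖x - 1‖ ^ 2 = 1 := by
      have : ‖x - 1‖ = 1 := by simpa [dist_eq_norm] using hx
      rw [this]; norm_num
    rw [Complex.sq_norm, Complex.normSq_apply] at h3
    rw [hre, him]
    simp at h3 ⊢
    have : 0 ≤ x.re := by nlinarith [sq_nonneg x.im]
    nlinarith [mul_nonneg this (sq_nonneg (x.re - 1))]
  have key2 : D.deg (F 1) (ball (-1) 1) = D.deg (fun z => (starRingEnd ℂ) (z - (-1))) (ball (-1) 1) := by
    rw [← D.deg_neg isOpen_ball isBounded_ball (F := fun z => (starRingEnd ℂ) (z - (-1)))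
      (by fun_prop)]
    · refine D.of_inner_pos isOpen_ball isBounded_ball (hFc' _).continuousOn (by fun_prop) ?_
      intro x hx
      rw [frontier_ball _ (by norm_num)] at hx
      have h3 : ‖x + 1‖ ^ 2 = 1 := by
        have : ‖x + 1‖ = 1 := by simpa [dist_eq_norm] using hx
        rw [this]; norm_num
      rw [Complex.sq_norm, Complex.normSq_apply] at h3
      rw [hre, him]
      simp at h3 ⊢
      have : 0 ≤ -x.re := by nlinarith [sq_nonneg x.im]
      nlinarith [mul_nonneg this (sq_nonneg (x.re + 1))]
    · intro x hx h
      rw [frontier_ball _ (by norm_num)] at hx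
      have : x - (-1) = 0 := (map_eq_zero (starRingEnd ℂ)).1 h
      rw [sub_eq_zero] at this
      simp [this] at hx
  have h3 : D.deg (F 1) (ball 0 2) = D.deg (F 1) (ball 1 1) + D.deg (F 1) (ball (-1) 1) := by
    refine D.additive _ _ _ _ isOpen_ball isBounded_ball isOpen_ball isOpen_ball ?_ ?_ ?_
      (hFc' _).continuousOn ?_
    · exact ball_subset_ball' (by simp; norm_num)
    · exact ball_subset_ball' (by simp; norm_num)
    · exact ball_disjoint_ball (by rw [dist_eq_norm]; norm_num)
    · intro x hx h
      have a1 := hre 1 x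
      have a2 := him 1 x
      rw [h] at a1 a2
      simp at a1 a2
      apply hx.2
      have : (x.re - 1) * (x.re + 1) = 0 := by linarith
      rcases mul_eq_zero.1 this with h' | h'
      · left
        have : x = 1 := Complex.ext (by simp; linarith) (by simp [← a2])
        simp [this]
      · right
        have : x = -1 := Complex.ext (by simp; linarith) (by simp [← a2])
        simp [this]
  have : D.deg (fun z => (starRingEnd ℂ) (z - (-1))) (ball (-1) 1) = -1 := by
    rw [← key2]; linarith
  exact this

theorem deg_conj_pow (m : ℕ) : ∀ (a : ℂ) (ε : ℝ), 0 < ε →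
    D.deg (fun z => (starRingEnd ℂ) ((z - a) ^ m)) (ball a ε) = -m := by
  classical
  induction m with
  | zero =>
    intro a ε hε
    rw [D.deg_eq_zero isOpen_ball isBounded_ball (by fun_prop) (by simp)]
    simp
  | succ m ih =>
    intro a ε hε
    set b := a + (ε / 2 : ℝ) with hb
    have hab : a ≠ b := by simp [hb, hε.ne']
    have hdab : dist b a = ε / 2 := by
      simp [hb, dist_eq_norm, abs_of_pos hε]
    have e1 := D.homotopyInv (fun s z => (starRingEnd ℂ) ((z - a) ^ m) *
      (starRingEnd ℂ) (z - (a + (s * (ε / 2) : ℝ)))) (ball a ε) isOpen_ball isBounded_ball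
      (by fun_prop) (by
        intro s hs x hx h
        rw [frontier_ball _ hε.ne', mem_sphere, dist_eq_norm] at hx
        rcases mul_eq_zero.1 h with h | h
        · rw [map_eq_zero] at h
          have h' : x - a = 0 := by
            by_contra hne
            exact pow_ne_zero m hne h
          simp [h'] at hx
          linarith
        · rw [map_eq_zero, sub_eq_zero] at h
          rw [h] at hx
          simp [abs_of_pos hε] at hx
          rw [abs_of_nonneg hs.1] at hx
          nlinarith [hs.2])
    have e2 := D.deg_sum {a, b} (fun z => (starRingEnd ℂ) ((z - a) ^ m) *
      (starRingEnd ℂ) (z - b)) (ball a ε) isOpen_ball isBounded_ball (by fun_prop)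
      (by
        intro x hx
        rcases (by simpa using hx : x = a ∨ x = b) with h | h
        · simp [h, hε]
        · rw [h, mem_ball, hdab]; linarith) (by
        intro x _ h
        rcases mul_eq_zero.1 h with h | h
        · rw [map_eq_zero] at h
          have h' : x - a = 0 := by
            by_contra hne
            exact pow_ne_zero m hne h
          simp [sub_eq_zero.1 h']
        · rw [map_eq_zero, sub_eq_zero] at h
          simp [h]) (fun z => if z = a then -m else -1) (by
        intro z hz
        rcases (by simpa using hz : z = a ∨ z = b) with h | h
        · subst h
          simp only [if_true]
          rcases Nat.eq_zero_or_pos m with hm | hm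
          · subst hm
            refine ⟨ε / 2, by positivity, fun δ hδ hδ' => ?_⟩
            rw [D.deg_eq_zero isOpen_ball isBounded_ball (by fun_prop)]
            · simp
            · intro x hx h
              rw [closure_ball _ hδ.ne', mem_closedBall] at hx
              have : x = b := sub_eq_zero.1 ((map_eq_zero (starRingEnd ℂ)).1 (by simpa using h))
              rw [this, hdab] at hx
              linarith
          obtain ⟨ε₀, h0, h1⟩ := D.deg_local (k := fun x => (starRingEnd ℂ) (x - b))
            (G := fun x => (starRingEnd ℂ) ((x - z) ^ m)) (a := z) (n := -m) (by fun_prop)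
            (by rw [Ne, map_eq_zero]; exact sub_ne_zero.2 hab) (by fun_prop)
            (by
              intro w hw
              rw [map_eq_zero] at hw
              exact sub_eq_zero.1 (eq_zero_of_pow_eq_zero hw)) (ih z) univ_mem (by fun_prop)
          refine ⟨ε₀, h0, fun δ hδ hδ' => ?_⟩
          rw [← h1 δ hδ hδ']
          congr 1
          ext x
          ring
        · subst h
          rw [if_neg (Ne.symm hab)]
          exact D.deg_local (k := fun x => (starRingEnd ℂ) ((x - a) ^ m))
            (G := fun x => (starRingEnd ℂ) (x - b)) (a := b) (n := -1) (by fun_prop)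
            (by
              rw [Ne, map_eq_zero]
              exact pow_ne_zero _ (sub_ne_zero.2 (Ne.symm hab))) (by fun_prop)
            (by
              intro w hw
              rw [map_eq_zero] at hw
              exact sub_eq_zero.1 hw) (fun ε hε => D.deg_conj b hε) univ_mem (by fun_prop))
    rw [Finset.sum_pair hab, if_pos rfl, if_neg (Ne.symm hab)] at e2
    have e3 : (fun z => (starRingEnd ℂ) ((z - a) ^ (m + 1))) = (fun z => (starRingEnd ℂ) ((z - a) ^ m) *
      (starRingEnd ℂ) (z - (a + ((0:ℝ) * (ε / 2) : ℝ)))) := by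
      ext z
      simp [pow_succ]
    rw [e3, e1]
    simp only [one_mul]
    rw [e2]
    push_cast; ring

end CDeg

/-! ### Global flows of bounded locally Lipschitz fields -/

/-- bounded field, Lipschitz on balls -/
structure GoodField (Y : ℂ → ℂ) : Prop where
  bdd : ∀ x, ‖Y x‖ ≤ 1
  lip : ∀ R : ℝ, ∃ K : NNReal, LipschitzOnWith K Y (closedBall 0 R)

theorem GoodField.neg {Y : ℂ → ℂ} (h : GoodField Y) : GoodField (fun x => - Y x) := by
  refine ⟨fun x => by simpa using h.bdd x, fun R => ?_⟩
  obtain ⟨K, hK⟩ := h.lip R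
  refine ⟨K, fun x hx y hy => ?_⟩
  rw [edist_neg_neg]
  exact hK hx hy

theorem GoodField.sol_bound {Y : ℂ → ℂ} (h : GoodField Y) {γ : ℝ → ℂ} {a : ℝ}
    (hγ : ∀ t ∈ Ioo (-a) a, HasDerivAt γ (Y (γ t)) t) {s t : ℝ} (hs : s ∈ Ioo (-a) a)
    (ht : t ∈ Ioo (-a) a) :
    ‖γ t - γ s‖ ≤ |t - s| := by
  have := (convex_Ioo (-a) a).norm_image_sub_le_of_norm_hasDerivWithin_le (C := 1)
    (fun t ht => (hγ t ht).hasDerivWithinAt) (fun t _ => h.bdd (γ t)) hs ht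
  simpa using this

theorem GoodField.sol_mem {Y : ℂ → ℂ} (h : GoodField Y) {γ : ℝ → ℂ} {a : ℝ}
    (hγ : ∀ t ∈ Ioo (-a) a, HasDerivAt γ (Y (γ t)) t) {t : ℝ} (ht : t ∈ Ioo (-a) a) :
    γ t ∈ closedBall 0 (‖γ 0‖ + a) := by
  have h0 : (0:ℝ) ∈ Ioo (-a) a := by
    have := ht.1.trans ht.2
    constructor <;> linarith
  have := h.sol_bound hγ h0 ht
  rw [sub_zero] at this
  have h2 : ‖γ t‖ ≤ ‖γ 0‖ + ‖γ t - γ 0‖ := by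
    have := norm_add_le (γ 0) (γ t - γ 0)
    simpa using this
  have h3 : |t| < a := abs_lt.2 ht
  simp
  linarith

theorem GoodField.unique {Y : ℂ → ℂ} (h : GoodField Y) {γ η : ℝ → ℂ} {a : ℝ}
    (hγ : ∀ t ∈ Ioo (-a) a, HasDerivAt γ (Y (γ t)) t)
    (hη : ∀ t ∈ Ioo (-a) a, HasDerivAt η (Y (η t)) t) (h0 : γ 0 = η 0) :
    EqOn γ η (Ioo (-a) a) := by
  intro t ht
  have hz : (0:ℝ) ∈ Ioo (-a) a := by
    have := ht.1.trans ht.2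
    constructor <;> linarith
  obtain ⟨K, hK⟩ := h.lip (‖γ 0‖ + a)
  exact ODE_solution_unique_of_mem_Ioo (v := fun _ => Y) (s := fun _ => closedBall 0 (‖γ 0‖ + a))
    (fun _ _ => hK) hz (fun t ht => ⟨hγ t ht, h.sol_mem hγ ht⟩)
    (fun t ht => ⟨hη t ht, h0 ▸ h.sol_mem hη ht⟩) h0 ht

theorem GoodField.exists_local {Y : ℂ → ℂ} (h : GoodField Y) (x : ℂ) {a : ℝ} (ha : 0 < a) :
    ∃ γ : ℝ → ℂ, γ 0 = x ∧ ∀ t ∈ Ioo (-a) a, HasDerivAt γ (Y (γ t)) t := by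
  obtain ⟨K, hK⟩ := h.lip (‖x‖ + a)
  have hsub : closedBall x a ⊆ closedBall 0 (‖x‖ + a) := by
    refine closedBall_subset_closedBall' ?_
    simp [add_comm]
  have hP : IsPicardLindelof (fun _ => Y) (tmin := -a) (tmax := a) ⟨0, by constructor <;> linarith⟩ x
      (⟨a, ha.le⟩ : NNReal) 0 1 K := by
    refine ⟨fun t _ => hK.mono hsub, fun y _ => continuousOn_const, fun t _ y _ => by simpa using h.bdd y,
      by simp; exact le_rfl⟩
  obtain ⟨γ, h0, h1⟩ := hP.exists_eq_forall_mem_Icc_hasDerivWithinAt₀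
  refine ⟨γ, h0, fun t ht => ?_⟩
  exact (h1 t (Ioo_subset_Icc_self ht)).hasDerivAt (Icc_mem_nhds ht.1 ht.2)

theorem GoodField.exists_global {Y : ℂ → ℂ} (h : GoodField Y) (x : ℂ) :
    ∃ γ : ℝ → ℂ, γ 0 = x ∧ ∀ t, HasDerivAt γ (Y (γ t)) t := by
  have hex := fun n : ℝ => h.exists_local x (a := |n| + 1) (by positivity)
  choose γ h0 hγ using hex
  refine ⟨fun t => γ t t, h0 0, fun t => ?_⟩
  have hmem : t ∈ Ioo (-(|t| + 1)) (|t| + 1) := by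
    rw [mem_Ioo, ← abs_lt]; linarith
  refine (hγ t t hmem).congr_of_eventuallyEq ?_
  filter_upwards [Ioo_mem_nhds hmem.1 hmem.2] with s hs
  have hs' : s ∈ Ioo (-(|s| + 1)) (|s| + 1) := by
    rw [mem_Ioo, ← abs_lt]; linarith
  set m := min (|s| + 1) (|t| + 1) with hm
  have m1 : Ioo (-m) m ⊆ Ioo (-(|s| + 1)) (|s| + 1) :=
    Ioo_subset_Ioo (neg_le_neg (min_le_left _ _)) (min_le_left _ _)
  have m2 : Ioo (-m) m ⊆ Ioo (-(|t| + 1)) (|t| + 1) :=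
    Ioo_subset_Ioo (neg_le_neg (min_le_right _ _)) (min_le_right _ _)
  refine h.unique (a := m) (fun u hu => hγ s u (m1 hu)) (fun u hu => hγ t u (m2 hu))
    ((h0 s).trans (h0 t).symm) ?_
  rw [mem_Ioo, ← abs_lt, hm, lt_min_iff]
  exact ⟨by linarith, abs_lt.2 hs⟩

/-- the global flow -/
def GoodField.flow {Y : ℂ → ℂ} (h : GoodField Y) (t : ℝ) (x : ℂ) : ℂ :=
  (h.exists_global x).choose t

namespace GoodField
variable {Y : ℂ → ℂ} (h : GoodField Y)

theorem flow_zero (x : ℂ) : h.flow 0 x = x := (h.exists_global x).choose_spec.1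

theorem hasDerivAt_flow (x : ℂ) (t : ℝ) :
    HasDerivAt (fun t => h.flow t x) (Y (h.flow t x)) t := (h.exists_global x).choose_spec.2 t

theorem unique_global {Y : ℂ → ℂ} (h : GoodField Y) {γ η : ℝ → ℂ} (hγ : ∀ t, HasDerivAt γ (Y (γ t)) t)
    (hη : ∀ t, HasDerivAt η (Y (η t)) t) (h0 : γ 0 = η 0) : γ = η := by
  ext t
  refine h.unique (a := |t| + 1) (fun t _ => hγ t) (fun t _ => hη t) h0 ?_
  rw [mem_Ioo, ← abs_lt]; linarith

theorem flow_add (s t : ℝ) (x : ℂ) : h.flow (s + t) x = h.flow s (h.flow t x) := by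
  refine congrFun (h.unique_global (γ := fun s => h.flow (s + t) x)
    (η := fun s => h.flow s (h.flow t x)) ?_ ?_ ?_) s
  · intro s
    exact (h.hasDerivAt_flow x (s + t)).comp_add_const s t
  · intro s
    exact h.hasDerivAt_flow _ _
  · simp [h.flow_zero]

theorem norm_flow_sub (s t : ℝ) (x : ℂ) : ‖h.flow t x - h.flow s x‖ ≤ |t - s| := by
  refine h.sol_bound (a := |t| + |s| + 1) (fun t _ => h.hasDerivAt_flow x t) ?_ ?_
  · rw [mem_Ioo, ← abs_lt]; linarith [abs_nonneg t]
  · rw [mem_Ioo, ← abs_lt]; linarith [abs_nonneg s]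

theorem flow_lip {Y : ℂ → ℂ} (h : GoodField Y) (R T : ℝ) : ∃ C : ℝ, 0 ≤ C ∧ ∀ x ∈ closedBall (0:ℂ) R, ∀ y ∈ closedBall (0:ℂ) R,
    ∀ t ∈ Icc 0 T, dist (h.flow t x) (h.flow t y) ≤ dist x y * C := by
  obtain ⟨K, hK⟩ := h.lip (R + T)
  refine ⟨Real.exp (K * T), by positivity, fun x hx y hy t ht => ?_⟩
  have hmem : ∀ z ∈ closedBall (0:ℂ) R, ∀ s ∈ Ico 0 T, h.flow s z ∈ closedBall (0:ℂ) (R + T) := by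
    intro z hz s hs
    have h1 := h.norm_flow_sub 0 s z
    rw [h.flow_zero, sub_zero, abs_of_nonneg hs.1] at h1
    have h2 : ‖h.flow s z‖ ≤ ‖z‖ + ‖h.flow s z - z‖ := by
      have := norm_add_le z (h.flow s z - z)
      simpa using this
    simp at hz ⊢
    linarith [hs.2]
  have hcont : ∀ z, ContinuousOn (fun t => h.flow t z) (Icc 0 T) := fun z t _ =>
    (h.hasDerivAt_flow z t).continuousAt.continuousWithinAt
  have := dist_le_of_trajectories_ODE_of_mem (v := fun _ => Y) (δ := dist x y)
    (s := fun _ => closedBall (0:ℂ) (R + T)) (f := fun t => h.flow t x) (g := fun t => h.flow t y)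
    (a := 0) (b := T) (K := K) (fun _ _ => hK) (hcont x)
    (fun t _ => (h.hasDerivAt_flow x t).hasDerivWithinAt) (hmem x hx) (hcont y)
    (fun t _ => (h.hasDerivAt_flow y t).hasDerivWithinAt) (hmem y hy) (by simp [h.flow_zero]) t ht
  refine this.trans ?_
  gcongr
  linarith [ht.2]

theorem flow_neg (t : ℝ) (x : ℂ) : h.neg.flow t x = h.flow (-t) x := by
  refine congrFun (h.neg.unique_global (γ := fun t => h.neg.flow t x) (η := fun t => h.flow (-t) x)
    (fun t => h.neg.hasDerivAt_flow x t) ?_ ?_) t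
  · intro t
    have := (h.hasDerivAt_flow x (-t)).scomp t (hasDerivAt_neg t)
    simpa [Function.comp_def] using this
  · simp [h.flow_zero, h.neg.flow_zero]

theorem continuous_flow : Continuous (fun p : ℝ × ℂ => h.flow p.1 p.2) := by
  rw [continuous_iff_continuousAt]
  rintro ⟨t, x⟩
  obtain ⟨C, hC0, hC⟩ := h.flow_lip (‖x‖ + 1) (|t| + 1)
  obtain ⟨C', hC0', hC'⟩ := h.neg.flow_lip (‖x‖ + 1) (|t| + 1)
  have key : ∀ᶠ p in nhds ((t, x) : ℝ × ℂ), ‖h.flow p.1 p.2 - h.flow t x‖ ≤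
      ‖p.2 - x‖ * (C + C') + |p.1 - t| := by
    have h1 : ∀ᶠ p in nhds ((t, x) : ℝ × ℂ), dist p (t, x) < 1 := Metric.ball_mem_nhds _ one_pos
    filter_upwards [h1] with p hp
    have hp1 : |p.1 - t| < 1 := lt_of_le_of_lt (le_max_left _ _) hp
    have hp2 : ‖p.2 - x‖ < 1 := by
      rw [← dist_eq_norm]
      exact lt_of_le_of_lt (le_max_right _ _) hp
    have hx : x ∈ closedBall (0:ℂ) (‖x‖ + 1) := by simp
    have hpx : p.2 ∈ closedBall (0:ℂ) (‖x‖ + 1) := by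
      have := norm_add_le x (p.2 - x)
      simp at this ⊢
      linarith
    have ht1 : |p.1| ≤ |t| + 1 := by
      have := abs_add_le t (p.1 - t)
      simp at this
      linarith
    have a1 : ‖h.flow p.1 p.2 - h.flow p.1 x‖ ≤ ‖p.2 - x‖ * (C + C') := by
      rw [← dist_eq_norm, ← dist_eq_norm]
      rcases le_total 0 p.1 with h0 | h0
      · refine (hC _ hpx _ hx p.1 ⟨h0, (le_abs_self _).trans ht1⟩).trans ?_
        gcongr
        linarith
      · have := hC' _ hpx _ hx (-p.1) ⟨by linarith, (neg_le_abs _).trans ht1⟩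
        rw [h.flow_neg, h.flow_neg, neg_neg] at this
        refine this.trans ?_
        gcongr
        linarith
    have a2 := h.norm_flow_sub t p.1 x
    calc ‖h.flow p.1 p.2 - h.flow t x‖ = ‖(h.flow p.1 p.2 - h.flow p.1 x) +
        (h.flow p.1 x - h.flow t x)‖ := by congr 1; ring
      _ ≤ _ := (norm_add_le _ _).trans (add_le_add a1 a2)
  refine tendsto_iff_norm_sub_tendsto_zero.2 ?_
  refine squeeze_zero' (Eventually.of_forall fun _ => norm_nonneg _) key ?_
  have : Continuous (fun p : ℝ × ℂ => ‖p.2 - x‖ * (C + C') + |p.1 - t|) := by fun_prop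
  have := this.tendsto (t, x)
  simpa using this

theorem continuous_flow_t (x : ℂ) : Continuous (fun t => h.flow t x) :=
  h.continuous_flow.comp (by fun_prop : Continuous fun t : ℝ => (t, x))

theorem continuous_flow_x (t : ℝ) : Continuous (h.flow t) :=
  h.continuous_flow.comp (by fun_prop : Continuous fun x : ℂ => (t, x))

theorem flow_neg_cancel (t : ℝ) (x : ℂ) : h.flow (-t) (h.flow t x) = x := by
  rw [← h.flow_add]; simp [h.flow_zero]

theorem flow_cancel_neg (t : ℝ) (x : ℂ) : h.flow t (h.flow (-t) x) = x := by
  rw [← h.flow_add]; simp [h.flow_zero]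

end GoodField

/-! ### Gradients on the complex plane -/

/-- real inner product on the plane -/
def dot (a b : ℂ) : ℝ := a.re * b.re + a.im * b.im

theorem inner_eq_dot (a b : ℂ) : inner ℝ a b = dot a b := by
  rw [Complex.inner]; simp [dot]; ring

theorem dot_self (a : ℂ) : dot a a = ‖a‖ ^ 2 := by
  rw [Complex.sq_norm, Complex.normSq_apply]; rfl

theorem dot_smul_left (r : ℝ) (a b : ℂ) : dot (r * a) b = r * dot a b := by
  simp [dot]; ring

theorem dot_smul_right (r : ℝ) (a b : ℂ) : dot a (r * b) = r * dot a b := by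
  simp [dot]; ring

theorem dot_comm (a b : ℂ) : dot a b = dot b a := by simp [dot]; ring

theorem dot_add_right (a b c : ℂ) : dot a (b + c) = dot a b + dot a c := by simp [dot]; ring

theorem dot_sub_right (a b c : ℂ) : dot a (b - c) = dot a b - dot a c := by simp [dot]; ring

theorem dot_sub_left (a b c : ℂ) : dot (a - b) c = dot a c - dot b c := by simp [dot]; ring

theorem dot_add_left (a b c : ℂ) : dot (a + b) c = dot a c + dot b c := by simp [dot]; ring

theorem dot_I (a : ℂ) : dot a (Complex.I * a) = 0 := by simp [dot]; ring

theorem continuous_dot : Continuous (fun p : ℂ × ℂ => dot p.1 p.2) := by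
  unfold dot
  have h1 := Complex.continuous_re
  have h2 := Complex.continuous_im
  fun_prop

theorem abs_dot_le (a b : ℂ) : |dot a b| ≤ ‖a‖ * ‖b‖ := by
  rw [← inner_eq_dot]; exact abs_real_inner_le_norm a b

/-- φ has gradient field f -/
def HasGrad (φ : ℂ → ℝ) (f : ℂ → ℂ) : Prop := ∀ x, HasGradientAt φ (f x) x

theorem HasGrad.comp {φ : ℂ → ℝ} {f : ℂ → ℂ} (h : HasGrad φ f) {γ : ℝ → ℂ} {γ' : ℂ} {t : ℝ}
    (hγ : HasDerivAt γ γ' t) : HasDerivAt (fun s => φ (γ s)) (dot (f (γ t)) γ') t := by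
  have := (h (γ t)).hasFDerivAt.comp_hasDerivAt t hγ
  rw [← inner_eq_dot]
  simpa [Function.comp_def] using this

theorem HasGrad.continuous {φ : ℂ → ℝ} {f : ℂ → ℂ} (h : HasGrad φ f) : Continuous φ :=
  continuous_iff_continuousAt.2 fun x => (h x).hasFDerivAt.continuousAt

theorem hasDerivAt_dot_left (v : ℂ) {γ : ℝ → ℂ} {γ' : ℂ} {t : ℝ} (hγ : HasDerivAt γ γ' t) :
    HasDerivAt (fun s => dot v (γ s)) (dot v γ') t := by
  have := ((innerSL ℝ v).hasFDerivAt (x := γ t)).comp_hasDerivAt t hγ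
  simp only [← inner_eq_dot]
  simpa [Function.comp_def] using this

theorem hasDerivAt_line (a b : ℂ) (t : ℝ) :
    HasDerivAt (fun s : ℝ => a + (s : ℂ) * b) b t := by
  have h1 : HasDerivAt (fun s : ℝ => (s : ℂ)) 1 t := Complex.ofRealCLM.hasDerivAt
  simpa using (h1.mul_const b).const_add a

/-- mean value theorem along a segment -/
theorem HasGrad.mvt {φ : ℂ → ℝ} {f : ℂ → ℂ} (h : HasGrad φ f) (a b : ℂ) :
    ∃ s ∈ Ioo (0:ℝ) 1, φ b - φ a = dot (f (a + s * (b - a))) (b - a) := by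
  have hd : ∀ s : ℝ, HasDerivAt (fun s : ℝ => φ (a + s * (b - a))) (dot (f (a + s * (b - a))) (b - a)) s :=
    fun s => h.comp (hasDerivAt_line a (b - a) s)
  obtain ⟨s, hs, h1⟩ := exists_hasDerivAt_eq_slope (fun s : ℝ => φ (a + s * (b - a)))
    (fun s : ℝ => dot (f (a + s * (b - a))) (b - a)) one_pos
    (fun s _ => (hd s).continuousAt.continuousWithinAt) (fun s _ => hd s)
  refine ⟨s, hs, ?_⟩
  rw [h1]
  simp

theorem isPreconnected_outside (r : ℝ) : IsPreconnected {x : ℂ | r < ‖x‖} := by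
  rcases lt_or_ge r 0 with hr | hr
  · have : {x : ℂ | r < ‖x‖} = univ := by
      ext x; simp; linarith [norm_nonneg x]
    rw [this]; exact isPreconnected_univ
  have h1 : IsPreconnected (sphere (0:ℂ) 1) := by
    refine isPreconnected_sphere ?_ _ _
    rw [Complex.rank_real_complex]; norm_num
  have h2 : IsPreconnected (Ioi r ×ˢ sphere (0:ℂ) 1) := isPreconnected_Ioi.prod h1
  have h3 := h2.image (fun p : ℝ × ℂ => (p.1 : ℂ) * p.2) (by fun_prop)
  convert h3 using 1
  ext x
  simp only [mem_ofPred_eq, mem_image, mem_prod, mem_Ioi, mem_sphere_iff_norm, sub_zero, Prod.exists]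
  constructor
  · intro hx
    have hx0 : (‖x‖ : ℂ) ≠ 0 := by
      rw [Ne, Complex.ofReal_eq_zero]; linarith
    refine ⟨‖x‖, x / ‖x‖, ⟨hx, ?_⟩, by field_simp⟩
    rw [norm_div, Complex.norm_real, norm_norm, div_self]
    linarith
  · rintro ⟨s, y, ⟨hs, hy⟩, rfl⟩
    rw [norm_mul, Complex.norm_real, hy, mul_one, Real.norm_of_nonneg (by linarith)]
    exact hs

/-! ### The setup for the dichotomy -/

/-- Data for the dichotomy. -/
structure Setup (φ : ℂ → ℝ) (f Y : ℂ → ℂ) (c : ℂ → ℝ) (R M : ℝ) : Prop where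
  hR : 0 < R
  hφ : HasGrad φ f
  hf : Continuous f
  hc : ∀ x, 0 < c x
  hY : ∀ x, Y x = c x * f x
  hle : ∀ x, c x * ‖f x‖ ^ 2 ≤ 1
  hout : ∀ x, R ≤ ‖x‖ → c x * ‖f x‖ ^ 2 = 1
  good : GoodField Y
  goodI : GoodField (fun x => Complex.I * Y x)
  hM : ∀ x, ‖x‖ ≤ R → |φ x| < M

namespace Setup
variable {φ : ℂ → ℝ} {f Y : ℂ → ℂ} {c : ℂ → ℝ} {R M : ℝ} (S : Setup φ f Y c R M)

/-- gradient flow -/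
def Phi (S : Setup φ f Y c R M) : ℝ → ℂ → ℂ := S.good.flow
/-- level flow -/
def X (S : Setup φ f Y c R M) : ℝ → ℂ → ℂ := S.goodI.flow

theorem f_ne (S : Setup φ f Y c R M) {x : ℂ} (hx : R ≤ ‖x‖) : f x ≠ 0 := by
  intro h
  have := S.hout x hx
  simp [h] at this

theorem far (S : Setup φ f Y c R M) {x : ℂ} (hx : M ≤ φ x) : R < ‖x‖ := by
  by_contra! h
  have := S.hM x h
  linarith [le_abs_self (φ x)]

theorem deriv_Phi (x : ℂ) (t : ℝ) : HasDerivAt (fun t => φ (S.Phi t x))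
    (c (S.Phi t x) * ‖f (S.Phi t x)‖ ^ 2) t := by
  have := S.hφ.comp (S.good.hasDerivAt_flow x t)
  rw [S.hY, dot_smul_right, dot_self] at this
  exact this

theorem X_inv (x : ℂ) (t : ℝ) : φ (S.X t x) = φ x := by
  have h : ∀ t, HasDerivAt (fun t => φ (S.X t x)) 0 t := by
    intro t
    have := S.hφ.comp (S.goodI.hasDerivAt_flow x t)
    rw [S.hY, mul_left_comm, dot_smul_right, dot_I, mul_zero] at this
    exact this
  have := is_const_of_deriv_eq_zero (fun t => (h t).differentiableAt) (fun t => (h t).deriv) t 0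
  simpa [X, S.goodI.flow_zero] using this

theorem mono (x : ℂ) : Monotone (fun t => φ (S.Phi t x)) :=
  monotone_of_deriv_nonneg (fun t => (S.deriv_Phi x t).differentiableAt) (fun t => by
    rw [(S.deriv_Phi x t).deriv]
    have := S.hc (S.Phi t x)
    positivity)

theorem speed (x : ℂ) {s t : ℝ} (hst : s ≤ t) : φ (S.Phi t x) - φ (S.Phi s x) ≤ t - s := by
  have h : ∀ t, HasDerivAt (fun t => t - φ (S.Phi t x))
      (1 - c (S.Phi t x) * ‖f (S.Phi t x)‖ ^ 2) t := fun t => (hasDerivAt_id t).sub (S.deriv_Phi x t)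
  have : Monotone (fun t => t - φ (S.Phi t x)) :=
    monotone_of_deriv_nonneg (fun t => (h t).differentiableAt) (fun t => by
      rw [(h t).deriv]
      have := S.hle (S.Phi t x)
      linarith)
  have := this hst
  simp only at this
  linarith

/-- outside the ball φ increases with unit speed -/
theorem unit_speed (x : ℂ) {s t : ℝ} (hst : s ≤ t) (h : ∀ τ ∈ Ioo s t, R ≤ ‖S.Phi τ x‖) :
    φ (S.Phi t x) - φ (S.Phi s x) = t - s := by
  rcases hst.eq_or_lt with rfl | hst
  · simp
  obtain ⟨u, hu, h1⟩ := exists_hasDerivAt_eq_slope (fun t => φ (S.Phi t x)) _ hst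
    (fun u _ => (S.deriv_Phi x u).continuousAt.continuousWithinAt) (fun u _ => S.deriv_Phi x u)
  rw [S.hout _ (h u hu), eq_div_iff (by linarith)] at h1
  linarith

theorem Phi_zero (x : ℂ) : S.Phi 0 x = x := S.good.flow_zero x
theorem X_zero (x : ℂ) : S.X 0 x = x := S.goodI.flow_zero x
theorem Phi_add (s t : ℝ) (x : ℂ) : S.Phi (s + t) x = S.Phi s (S.Phi t x) := S.good.flow_add s t x
theorem X_add (s t : ℝ) (x : ℂ) : S.X (s + t) x = S.X s (S.X t x) := S.goodI.flow_add s t x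
theorem Phi_cont : Continuous (fun p : ℝ × ℂ => S.Phi p.1 p.2) := S.good.continuous_flow
theorem X_cont : Continuous (fun p : ℝ × ℂ => S.X p.1 p.2) := S.goodI.continuous_flow

theorem phi_Phi {x : ℂ} {t : ℝ} (h1 : M ≤ φ x) (h2 : M ≤ φ x + t) : φ (S.Phi t x) = φ x + t := by
  rcases le_total 0 t with ht | ht
  · have := S.unit_speed x ht (fun τ hτ => (S.far (by
      have := S.mono x hτ.1.le
      simp only [S.Phi_zero] at this
      linarith)).le)
    rw [S.Phi_zero] at this
    linarith
  · have := S.unit_speed x ht (fun τ hτ => (S.far (by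
      have := S.speed x hτ.2.le
      simp only [S.Phi_zero] at this
      linarith [hτ.1])).le)
    rw [S.Phi_zero] at this
    linarith

/-- reference level -/
def p (S : Setup φ f Y c R M) (x : ℂ) : ℂ := S.Phi (M + 1 - φ x) x

theorem p_cont : Continuous S.p := by
  have := S.hφ.continuous
  exact S.Phi_cont.comp (by fun_prop : Continuous fun x => ((M + 1 - φ x, x) : ℝ × ℂ))

theorem phi_p {x : ℂ} (hx : M ≤ φ x) : φ (S.p x) = M + 1 := by
  rw [p, S.phi_Phi hx (by linarith)]; ring

theorem p_Phi {x : ℂ} {t : ℝ} (h1 : M ≤ φ x) (h2 : M ≤ φ x + t) : S.p (S.Phi t x) = S.p x := by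
  rw [p, S.phi_Phi h1 h2, ← S.Phi_add, p]
  congr 1
  ring

theorem p_of_eq {x : ℂ} (hx : φ x = M + 1) : S.p x = x := by
  rw [p, hx, sub_self, S.Phi_zero]

theorem Phi_p (x : ℂ) : S.Phi (φ x - (M + 1)) (S.p x) = x := by
  rw [p, ← S.Phi_add]
  convert S.Phi_zero x using 2
  ring

/-- local structure of the level set -/
theorem level_local (y : ℂ) (hy : φ y = M + 1) {ε : ℝ} (hε : 0 < ε) :
    ∃ δ > 0, ∀ z, φ z = M + 1 → ‖z - y‖ < δ → ∃ t, |t| < ε ∧ S.X t y = z := by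
  have hfy : f y ≠ 0 := S.f_ne (S.far (by linarith)).le
  set v := Complex.I * Y y with hv
  have hvv : v = (c y : ℂ) * (Complex.I * f y) := by rw [hv, S.hY]; ring
  have hv0 : v ≠ 0 := by
    rw [hvv]
    have := (S.hc y).ne'
    simp [hfy, this]
  -- f stays in a half plane
  obtain ⟨δ₀, hδ₀, h1⟩ : ∃ δ₀ > 0, ∀ z ∈ ball y δ₀, 0 < dot (f z) (f y) := by
    have hc : Continuous (fun z => dot (f z) (f y)) :=
      continuous_dot.comp (S.hf.prodMk continuous_const)
    have hpos : 0 < dot (f y) (f y) := by rw [dot_self]; positivity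
    have := (hc.continuousAt (x := y)).eventually (lt_mem_nhds hpos)
    exact Metric.mem_nhds_iff.1 this
  have inj : ∀ z ∈ ball y δ₀, ∀ z' ∈ ball y δ₀, φ z = φ z' → dot v z = dot v z' → z = z' := by
    intro z hz z' hz' hφz hvz
    obtain ⟨s, hs, hm⟩ := S.hφ.mvt z z'
    have hw : z + s * (z' - z) ∈ ball y δ₀ := by
      have := (convex_ball y δ₀).add_smul_sub_mem hz hz' ⟨hs.1.le, hs.2.le⟩
      simpa using this
    rw [hφz, sub_self] at hm
    set w := z' - z with hwd
    have hvw : dot v w = 0 := by rw [hwd, dot_sub_right]; linarith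
    rw [hvv, dot_smul_left] at hvw
    have hIw : dot (Complex.I * f y) w = 0 := by
      rcases mul_eq_zero.1 hvw with h | h
      · exact absurd h (S.hc y).ne'
      · exact h
    -- w is a real multiple of f y
    have hfw : (‖f y‖ ^ 2 : ℝ) * w = (dot (f y) w : ℝ) * f y := by
      rw [Complex.sq_norm, Complex.normSq_apply]
      simp [dot] at hIw
      apply Complex.ext
      · simp [dot]
        linear_combination - (f y).im * hIw
      · simp [dot]
        linear_combination (f y).re * hIw
    have h2 : dot (f (z + s * w)) ((‖f y‖ ^ 2 : ℝ) * w) = 0 := by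
      rw [dot_smul_right, ← hm, mul_zero]
    rw [hfw, dot_smul_right] at h2
    have h3 : dot (f y) w = 0 := by
      rcases mul_eq_zero.1 h2 with h | h
      · exact h
      · exact absurd h (h1 _ hw).ne'
    rw [h3] at hfw
    have : w = 0 := by
      have h0 : ((‖f y‖ ^ 2 : ℝ) : ℂ) ≠ 0 := by
        rw [Ne, Complex.ofReal_eq_zero]; positivity
      have : ((‖f y‖ ^ 2 : ℝ) : ℂ) * w = 0 := by rw [hfw]; simp
      exact (mul_eq_zero.1 this).resolve_left h0
    rw [hwd, sub_eq_zero] at this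
    exact this.symm
  -- coordinate along the curve
  have hd : HasDerivAt (fun t => dot v (S.X t y)) (dot v v) 0 := by
    have := hasDerivAt_dot_left v (S.goodI.hasDerivAt_flow y 0)
    rw [S.goodI.flow_zero] at this
    exact this
  have hpos : 0 < dot v v := by rw [dot_self]; positivity
  have hXc : Continuous (fun t => S.X t y) := S.goodI.continuous_flow_t y
  have hball : ∀ᶠ t in nhds (0:ℝ), S.X t y ∈ ball y δ₀ := by
    refine hXc.continuousAt.eventually (isOpen_ball.mem_nhds ?_)
    simp [S.X_zero, hδ₀]
  obtain ⟨η, hη, hηb⟩ := Metric.mem_nhds_iff.1 hball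
  have hslope := hasDerivAt_iff_tendsto_slope.1 hd
  have hsl : ∀ᶠ t in nhdsWithin (0:ℝ) {0}ᶜ, 0 < slope (fun t => dot v (S.X t y)) 0 t :=
    hslope.eventually (lt_mem_nhds hpos)
  obtain ⟨η', hη', hs'⟩ := Metric.mem_nhdsWithin_iff.1 hsl
  set e := min (min η η') ε / 2 with he
  have hm : 0 < min (min η η') ε := by positivity
  have he0 : 0 < e := by positivity
  have he1 : e < η := by
    have : min (min η η') ε ≤ η := (min_le_left _ _).trans (min_le_left _ _)
    linarith
  have he2 : e < η' := by
    have : min (min η η') ε ≤ η' := (min_le_left _ _).trans (min_le_right _ _)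
    linarith
  have he3 : e < ε := by
    have : min (min η η') ε ≤ ε := min_le_right _ _
    linarith
  have up : dot v y < dot v (S.X e y) := by
    have := hs' (show e ∈ ball (0:ℝ) η' ∩ {0}ᶜ from ⟨by simpa [abs_of_pos he0] using he2, by simpa using he0.ne'⟩)
    simp only [mem_ofPred_eq, slope_def_field, S.X_zero, sub_zero] at this
    have := (div_pos_iff_of_pos_right he0).1 this
    linarith
  have dn : dot v (S.X (-e) y) < dot v y := by
    have := hs' (show -e ∈ ball (0:ℝ) η' ∩ {0}ᶜ from ⟨by simpa [abs_of_pos he0] using he2, by simpa using he0.ne'⟩)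
    simp only [mem_ofPred_eq, slope_def_field, S.X_zero, sub_zero] at this
    have := (div_pos_iff.1 this).resolve_left (fun h => by linarith [h.2])
    linarith [this.1]
  have hvc : Continuous (fun z => dot v z) := continuous_dot.comp (continuous_const.prodMk continuous_id)
  have hnear : ∀ᶠ z in nhds y, dot v (S.X (-e) y) < dot v z ∧ dot v z < dot v (S.X e y) ∧ z ∈ ball y δ₀ :=
    (hvc.continuousAt.eventually (lt_mem_nhds dn)).and
      ((hvc.continuousAt.eventually (gt_mem_nhds up)).and (ball_mem_nhds y hδ₀))
  obtain ⟨δ, hδ, hδb⟩ := Metric.mem_nhds_iff.1 hnear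
  refine ⟨δ, hδ, fun z hz hzy => ?_⟩
  obtain ⟨g1, g2, g3⟩ := hδb (show z ∈ ball y δ by simpa [dist_eq_norm] using hzy)
  obtain ⟨t, ht, hteq⟩ := intermediate_value_Icc (show -e ≤ e by linarith)
    (hvc.comp hXc).continuousOn ⟨g1.le, g2.le⟩
  have hta : |t| ≤ e := abs_le.2 ht
  refine ⟨t, by linarith, ?_⟩
  refine inj _ (hηb (show t ∈ ball (0:ℝ) η by simp; linarith)) _ g3 ?_ hteq
  rw [S.X_inv, hy, hz]

end Setup

namespace Setup
variable {φ : ℂ → ℝ} {f Y : ℂ → ℂ} {c : ℂ → ℝ} {R M : ℝ} (S : Setup φ f Y c R M)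

/-- orbit of the level flow -/
def orb (S : Setup φ f Y c R M) (y : ℂ) : Set ℂ := range (fun t => S.X t y)

theorem mem_orb_self (y : ℂ) : y ∈ S.orb y := ⟨0, S.X_zero y⟩

theorem orb_eq {y z : ℂ} (h : z ∈ S.orb y) : S.orb z = S.orb y := by
  obtain ⟨t, rfl⟩ := h
  ext w
  constructor
  · rintro ⟨s, rfl⟩
    exact ⟨s + t, S.X_add s t y⟩
  · rintro ⟨s, rfl⟩
    refine ⟨s - t, ?_⟩
    simp only
    rw [← S.X_add]
    congr 1; ring

theorem orb_phi {y z : ℂ} (h : z ∈ S.orb y) : φ z = φ y := by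
  obtain ⟨t, rfl⟩ := h
  exact S.X_inv y t

theorem orb_nhds (y : ℂ) (hy : φ y = M + 1) :
    ∃ δ > 0, ∀ z, φ z = M + 1 → ‖z - y‖ < δ → z ∈ S.orb y := by
  obtain ⟨δ, hδ, h⟩ := S.level_local y hy one_pos
  refine ⟨δ, hδ, fun z hz hzy => ?_⟩
  obtain ⟨t, _, ht⟩ := h z hz hzy
  exact ⟨t, ht⟩

theorem orb_closed (y : ℂ) (hy : φ y = M + 1) : IsClosed (S.orb y) := by
  refine isClosed_of_closure_subset fun z hz => ?_
  have hzφ : φ z = M + 1 := by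
    have hcl : IsClosed {z | φ z = M + 1} := isClosed_eq S.hφ.continuous continuous_const
    exact closure_minimal (fun w hw => (S.orb_phi hw).trans hy) hcl hz
  obtain ⟨δ, hδ, h⟩ := S.orb_nhds z hzφ
  obtain ⟨w, hw, hwz⟩ := Metric.mem_closure_iff.1 hz δ hδ
  have h1 := h w ((S.orb_phi hw).trans hy) (by rw [← dist_eq_norm, dist_comm]; exact hwz)
  rw [← S.orb_eq hw, S.orb_eq h1]
  exact S.mem_orb_self z

/-- points flowing to the orbit form an open set -/
theorem p_orb_nhds {x y : ℂ} (hx : M < φ x) (hxy : S.p x ∈ S.orb y) (hy : φ y = M + 1) :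
    ∀ᶠ x' in nhds x, M < φ x' ∧ S.p x' ∈ S.orb y := by
  obtain ⟨δ, hδ, h⟩ := S.orb_nhds (S.p x) (S.phi_p hx.le)
  have h1 : ∀ᶠ x' in nhds x, M < φ x' := S.hφ.continuous.continuousAt.eventually (lt_mem_nhds hx)
  have h2 : ∀ᶠ x' in nhds x, S.p x' ∈ ball (S.p x) δ :=
    S.p_cont.continuousAt.eventually (ball_mem_nhds _ hδ)
  filter_upwards [h1, h2] with x' g1 g2
  refine ⟨g1, ?_⟩
  have := h _ (S.phi_p g1.le) (by simpa [dist_eq_norm] using g2)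
  rwa [S.orb_eq hxy] at this

theorem periodic_case {y : ℂ} (hy : φ y = M + 1) {T : ℝ} (hT : 0 < T) (hper : S.X T y = y) :
    BddBelow (range φ) := by
  have hcont : Continuous (fun t => S.X t y) := S.goodI.continuous_flow_t y
  have hperiod : Function.Periodic (fun t => S.X t y) T := by
    intro t
    simp only
    rw [S.X_add, hper]
  have hcomp : IsCompact (S.orb y) := by
    have : S.orb y = (fun t => S.X t y) '' Icc 0 (0 + T) := (hperiod.image_Icc hT 0).symm
    rw [this]
    exact isCompact_Icc.image hcont
  obtain ⟨r, hr⟩ := hcomp.isBounded.subset_closedBall 0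
  set U : Set ℂ := {x | M + 1 < φ x ∧ S.p x ∈ S.orb y} with hU
  have hφc := S.hφ.continuous
  have hUo : IsOpen U := by
    rw [isOpen_iff_mem_nhds]
    rintro x ⟨h1, h2⟩
    filter_upwards [S.p_orb_nhds (by linarith) h2 hy, hφc.continuousAt.eventually (lt_mem_nhds h1)]
      with x' g1 g2
    exact ⟨g2, g1.2⟩
  set V : Set ℂ := {x | M + 1 ≤ φ x ∧ S.p x ∈ S.orb y}ᶜ with hV
  have hVo : IsOpen V := by
    rw [hV, isOpen_compl_iff]
    exact (isClosed_le continuous_const hφc).inter ((S.orb_closed y hy).preimage S.p_cont)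
  have hcover : {x : ℂ | r < ‖x‖} ⊆ U ∪ V := by
    intro x hx
    by_cases hxV : x ∈ V
    · exact Or.inr hxV
    · left
      have hxV' : M + 1 ≤ φ x ∧ S.p x ∈ S.orb y := by simpa [hV] using hxV
      refine ⟨lt_of_le_of_ne hxV'.1 fun heq => ?_, hxV'.2⟩
      have h2 := hxV'.2
      rw [S.p_of_eq heq.symm] at h2
      have := hr h2
      simp at this hx
      linarith
  have hUne : ({x : ℂ | r < ‖x‖} ∩ U).Nonempty := by
    obtain ⟨C, hC⟩ := (isCompact_closedBall (0:ℂ) r).exists_bound_of_continuousOn hφc.continuousOn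
    set t := |C| + |M| + 1 with ht
    have e1 : φ (S.Phi t y) = M + 1 + t := by
      rw [S.phi_Phi (by linarith) (by rw [hy, ht]; linarith [abs_nonneg C, abs_nonneg M]), hy]
    refine ⟨S.Phi t y, ?_, ?_, ?_⟩
    · by_contra hn
      simp at hn
      have := hC _ (by simpa using hn)
      rw [e1, Real.norm_eq_abs] at this
      have h3 := le_abs_self (M + 1 + t)
      linarith [le_abs_self C, neg_abs_le M]
    · rw [e1]; linarith [abs_nonneg C, abs_nonneg M]
    · rw [S.p_Phi (by linarith) (by rw [hy, ht]; linarith [abs_nonneg C, abs_nonneg M]), S.p_of_eq hy]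
      exact S.mem_orb_self y
  have hsub : {x : ℂ | r < ‖x‖} ⊆ U := by
    refine (isPreconnected_outside r).subset_left_of_subset_union hUo hVo ?_ hcover hUne
    rw [Set.disjoint_left]
    intro x hx hx'
    exact hx' ⟨hx.1.le, hx.2⟩
  obtain ⟨C, hC⟩ := (isCompact_closedBall (0:ℂ) r).exists_bound_of_continuousOn hφc.continuousOn
  refine ⟨min (-C) (M + 1), ?_⟩
  rintro _ ⟨x, rfl⟩
  rcases lt_or_ge r ‖x‖ with h | h
  · exact (min_le_right _ _).trans (hsub h).1.le
  · have := hC x (by simpa using h)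
    rw [Real.norm_eq_abs] at this
    exact (min_le_left _ _).trans (by linarith [neg_abs_le (φ x)])

/-- last visit estimate -/
theorem last_visit {w : ℂ} (hw : ‖w‖ ≤ R) {t : ℝ} (ht : 0 ≤ t) :
    ‖S.Phi t w‖ ≤ R + φ (S.Phi t w) + M := by
  have hcont : Continuous (fun t => S.Phi t w) := S.good.continuous_flow_t w
  set A : Set ℝ := Icc 0 t ∩ {τ | ‖S.Phi τ w‖ ≤ R} with hA
  have hAc : IsCompact A := isCompact_Icc.inter_right (isClosed_le hcont.norm continuous_const)
  have hAne : A.Nonempty := ⟨0, ⟨le_rfl, ht⟩, by simpa [S.Phi_zero] using hw⟩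
  obtain ⟨s, hs, hmax⟩ := hAc.exists_isGreatest hAne
  have h1 := S.unit_speed w hs.1.2 (fun τ hτ => by
    by_contra! h
    have := hmax (show τ ∈ A from ⟨⟨hs.1.1.trans hτ.1.le, hτ.2.le⟩, h.le⟩)
    linarith [hτ.1])
  have h2 := S.good.norm_flow_sub s t w
  rw [abs_of_nonneg (by linarith [hs.1.2])] at h2
  have h3 : ‖S.Phi t w‖ ≤ ‖S.Phi s w‖ + ‖S.Phi t w - S.Phi s w‖ := by
    have := norm_add_le (S.Phi s w) (S.Phi t w - S.Phi s w)
    simpa using this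
  have h4 := S.hM _ hs.2
  have h5 := neg_abs_le (φ (S.Phi s w))
  have h6 : ‖S.Phi s w‖ ≤ R := hs.2
  have h7 : ‖S.Phi t w - S.Phi s w‖ ≤ t - s := h2
  linarith

/-- every orbit contains a point in a fixed ball -/
theorem exists_rep {y : ℂ} (hy : φ y = M + 1) : ∃ z ∈ S.orb y, ‖z‖ ≤ R + (M + 1) + M := by
  by_contra! hcon
  have hnot : ∀ z ∈ S.orb y, ∀ s, R < ‖S.Phi s z‖ := by
    intro z hz s
    have hzφ : φ z = M + 1 := (S.orb_phi hz).trans hy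
    rcases le_total 0 s with hs | hs
    · apply S.far
      rw [S.phi_Phi (by linarith) (by linarith)]
      linarith
    · by_contra! hle
      have := S.last_visit hle (t := -s) (by linarith)
      rw [← S.Phi_add, neg_add_cancel, S.Phi_zero, hzφ] at this
      linarith [hcon z hz]
  have hlin : ∀ z ∈ S.orb y, ∀ s, φ (S.Phi s z) = M + 1 + s := by
    intro z hz s
    have hzφ : φ z = M + 1 := (S.orb_phi hz).trans hy
    rcases le_total 0 s with hs | hs
    · rw [S.phi_Phi (by linarith) (by linarith), hzφ]
    · have := S.unit_speed z hs (fun τ _ => (hnot z hz τ).le)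
      rw [S.Phi_zero, hzφ] at this
      linarith
  have hmem : ∀ x, S.p x ∈ S.orb y ↔ ∃ s, ∃ z ∈ S.orb y, S.Phi s z = x := by
    intro x
    constructor
    · intro h
      exact ⟨_, _, h, S.Phi_p x⟩
    · rintro ⟨s, z, hz, rfl⟩
      have : S.p (S.Phi s z) = z := by
        rw [p, hlin z hz s, ← S.Phi_add]
        convert S.Phi_zero z using 2
        ring
      rwa [this]
  set W := S.p ⁻¹' (S.orb y) with hW
  have hWc : IsClosed W := (S.orb_closed y hy).preimage S.p_cont
  have hWo : IsOpen W := by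
    rw [isOpen_iff_mem_nhds]
    intro x hx
    obtain ⟨s, z, hz, hzx⟩ := (hmem x).1 hx
    have hzφ : φ z = M + 1 := (S.orb_phi hz).trans hy
    have h1 := S.p_orb_nhds (x := z) (by linarith) (by rwa [S.p_of_eq hzφ]) hy
    have h2 : S.Phi (-s) x = z := by rw [← hzx]; exact S.good.flow_neg_cancel s z
    rw [← h2] at h1
    have h3 := (S.good.continuous_flow_x (-s)).continuousAt.eventually h1
    filter_upwards [h3] with x' hx'
    obtain ⟨s', z', hz', hh⟩ := (hmem _).1 hx'.2
    refine (hmem x').2 ⟨s + s', z', hz', ?_⟩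
    rw [S.Phi_add, hh]
    exact S.good.flow_cancel_neg s x'
  have huniv : W = univ := IsClopen.eq_univ ⟨hWc, hWo⟩ ⟨y, by
    change S.p y ∈ S.orb y
    rw [S.p_of_eq hy]; exact S.mem_orb_self y⟩
  have h0 : (0:ℂ) ∈ W := by rw [huniv]; trivial
  obtain ⟨s, z, hz, h⟩ := (hmem 0).1 h0
  have := hnot z hz s
  rw [h, norm_zero] at this
  linarith [S.hR]

open Classical in
/-- representative of an orbit -/
def rep (S : Setup φ f Y c R M) (O : Set ℂ) : ℂ :=
  if h : ∃ z ∈ O, ‖z‖ ≤ R + (M + 1) + M then h.choose else 0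

theorem rep_mem {y : ℂ} (hy : φ y = M + 1) : S.rep (S.orb y) ∈ S.orb y := by
  have h := S.exists_rep hy
  rw [rep, dif_pos h]
  exact h.choose_spec.1

theorem rep_norm {y : ℂ} (hy : φ y = M + 1) : ‖S.rep (S.orb y)‖ ≤ R + (M + 1) + M := by
  have h := S.exists_rep hy
  rw [rep, dif_pos h]
  exact h.choose_spec.2

/-- all representatives -/
def Reps (S : Setup φ f Y c R M) : Set ℂ := {z | ∃ y, φ y = M + 1 ∧ z = S.rep (S.orb y)}

theorem Reps_phi {z : ℂ} (hz : z ∈ S.Reps) : φ z = M + 1 := by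
  obtain ⟨y, hy, rfl⟩ := hz
  exact (S.orb_phi (S.rep_mem hy)).trans hy

theorem Reps_norm {z : ℂ} (hz : z ∈ S.Reps) : ‖z‖ ≤ R + (M + 1) + M := by
  obtain ⟨y, hy, rfl⟩ := hz
  exact S.rep_norm hy

theorem Reps_rep {z : ℂ} (hz : z ∈ S.Reps) : S.rep (S.orb z) = z := by
  obtain ⟨y, hy, rfl⟩ := hz
  rw [S.orb_eq (S.rep_mem hy)]

theorem Reps_finite : S.Reps.Finite := by
  set K := closedBall (0:ℂ) (R + (M + 1) + M) ∩ {z | φ z = M + 1} with hK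
  have hKc : IsCompact K := (isCompact_closedBall _ _).inter_right
    (isClosed_eq S.hφ.continuous continuous_const)
  have hex : ∀ z : ℂ, ∃ δ > 0, φ z = M + 1 → ∀ w, φ w = M + 1 → ‖w - z‖ < δ → w ∈ S.orb z := by
    intro z
    by_cases hz : φ z = M + 1
    · obtain ⟨δ, hδ, h⟩ := S.orb_nhds z hz
      exact ⟨δ, hδ, fun _ => h⟩
    · exact ⟨1, one_pos, fun h => absurd h hz⟩
  choose δ hδ h using hex
  obtain ⟨t, ht, hcov⟩ := hKc.elim_nhds_subcover (fun z => ball z (δ z)) (fun z _ => ball_mem_nhds z (hδ z))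
  refine (t.finite_toSet.image (fun z => S.rep (S.orb z))).subset ?_
  intro z hz
  have hzK : z ∈ K := ⟨by simpa using S.Reps_norm hz, S.Reps_phi hz⟩
  obtain ⟨w, hw, hzw⟩ := mem_iUnion₂.1 (hcov hzK)
  refine ⟨w, hw, ?_⟩
  have := h w (ht w hw).2 z hzK.2 (by simpa [dist_eq_norm] using hzw)
  simp only
  rw [← S.orb_eq this]
  exact S.Reps_rep hz

open Classical in
/-- time coordinate on the level set -/
def tau (S : Setup φ f Y c R M) (y : ℂ) : ℝ :=
  if h : ∃ t, S.X t (S.rep (S.orb y)) = y then h.choose else 0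

theorem X_tau {y : ℂ} (hy : φ y = M + 1) : S.X (S.tau y) (S.rep (S.orb y)) = y := by
  have h : ∃ t, S.X t (S.rep (S.orb y)) = y := by
    have h1 := S.orb_eq (S.rep_mem hy)
    have h2 : y ∈ S.orb (S.rep (S.orb y)) := by rw [h1]; exact S.mem_orb_self y
    exact h2
  rw [tau, dif_pos h]
  exact h.choose_spec

/-- the cut-off -/
def kap (s : ℝ) : ℝ := max 0 (1 - s)

open Classical in
/-- retraction pushing everything high up to the representatives -/
def E (S : Setup φ f Y c R M) (x : ℂ) : ℂ :=
  if φ x ≤ M + 1 then x else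
    S.X (kap (φ x - (M + 1)) * S.tau (S.p x)) (S.rep (S.orb (S.p x)))

/-- no periodic orbit -/
def NonPer (S : Setup φ f Y c R M) : Prop := ∀ y, φ y = M + 1 → ∀ T > 0, S.X T y ≠ y

theorem NonPer.inj {S : Setup φ f Y c R M} (hS : S.NonPer) {y : ℂ} (hy : φ y = M + 1) {s t : ℝ}
    (h : S.X s y = S.X t y) : s = t := by
  wlog hst : s < t generalizing s t
  · rcases lt_or_eq_of_le (not_lt.1 hst) with h' | h'
    · exact (this h.symm h').symm
    · exact h'.symm
  exfalso
  refine hS (S.X s y) ((S.X_inv y s).trans hy) (t - s) (by linarith) ?_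
  rw [← S.X_add, h]
  congr 1; ring

theorem E_cont (hS : S.NonPer) : Continuous S.E := by
  have hφc := S.hφ.continuous
  refine continuous_if_le hφc continuous_const continuousOn_id ?_ ?_
  · intro x hx
    have hx' : M + 1 ≤ φ x := hx
    have hpx : φ (S.p x) = M + 1 := S.phi_p (by linarith)
    -- local constancy of rep and continuity of tau
    have hrep : ∀ᶠ x' in nhdsWithin x {x | M + 1 ≤ φ x}, S.rep (S.orb (S.p x')) = S.rep (S.orb (S.p x)) := by
      have := S.p_orb_nhds (x := x) (by linarith) (S.mem_orb_self _) hpx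
      filter_upwards [nhdsWithin_le_nhds this] with x' hx'
      rw [S.orb_eq hx'.2]
    have htau : Tendsto (fun x' => S.tau (S.p x')) (nhdsWithin x {x | M + 1 ≤ φ x})
        (nhds (S.tau (S.p x))) := by
      rw [Metric.tendsto_nhds]
      intro ε hε
      obtain ⟨δ, hδ, h⟩ := S.level_local (S.p x) hpx hε
      have h2 : ∀ᶠ x' in nhdsWithin x {x | M + 1 ≤ φ x}, S.p x' ∈ ball (S.p x) δ :=
        nhdsWithin_le_nhds (S.p_cont.continuousAt.eventually (ball_mem_nhds _ hδ))
      filter_upwards [hrep, h2, self_mem_nhdsWithin] with x' g1 g2 g3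
      have hpx' : φ (S.p x') = M + 1 := S.phi_p (by
        have : M + 1 ≤ φ x' := g3
        linarith)
      obtain ⟨s, hs, hs'⟩ := h (S.p x') hpx' (by simpa [dist_eq_norm] using g2)
      have e1 := S.X_tau hpx'
      have e2 := S.X_tau hpx
      rw [g1, ← hs'] at e1
      rw [hs'] at e1
      have e3 : S.X (s + S.tau (S.p x)) (S.rep (S.orb (S.p x))) = S.p x' := by
        rw [S.X_add, e2, hs']
      have := hS.inj (y := S.rep (S.orb (S.p x))) ((S.orb_phi (S.rep_mem hpx)).trans hpx) (e1.trans e3.symm)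
      rw [this, Real.dist_eq]
      simpa using hs
    have hk : Continuous (fun x => kap (φ x - (M + 1))) := by
      unfold kap; fun_prop
    have h1 : Tendsto (fun x' => S.X (kap (φ x' - (M + 1)) * S.tau (S.p x')) (S.rep (S.orb (S.p x))))
        (nhdsWithin x {x | M + 1 ≤ φ x})
        (nhds (S.X (kap (φ x - (M + 1)) * S.tau (S.p x)) (S.rep (S.orb (S.p x))))) := by
      have h3 := (hk.continuousAt (x := x)).tendsto.mono_left (nhdsWithin_le_nhds (s := {x | M + 1 ≤ φ x}))
      exact ((S.goodI.continuous_flow_t _).tendsto _).comp (h3.mul htau)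
    refine h1.congr' ?_
    filter_upwards [hrep] with x' hx'
    rw [hx']
  · intro x hx
    rw [hx, S.p_of_eq hx, kap, sub_self, sub_zero, max_eq_right zero_le_one, one_mul, S.X_tau hx]

theorem E_low {x : ℂ} (hx : φ x ≤ M + 1) : S.E x = x := by
  rw [E, if_pos hx]

theorem E_phi {x : ℂ} (hx : M + 1 < φ x) : φ (S.E x) = M + 1 := by
  rw [E, if_neg (not_le.2 hx), S.X_inv]
  have := S.phi_p (x := x) (by linarith)
  exact (S.orb_phi (S.rep_mem this)).trans this

theorem E_high {x : ℂ} (hx : M + 2 ≤ φ x) : S.E x = S.rep (S.orb (S.p x)) := by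
  rw [E, if_neg (by linarith), kap, max_eq_left (by linarith), zero_mul, S.X_zero]

end Setup

namespace Setup
variable {φ : ℂ → ℝ} {f Y : ℂ → ℂ} {c : ℂ → ℝ} {R M : ℝ} (S : Setup φ f Y c R M)

theorem fix_Phi {T : ℝ} (hT : 0 < T) {x : ℂ} (h : S.Phi T x = x) : f x = 0 := by
  have h' : S.Phi (-T) x = x := by
    have := S.Phi_add (-T) T x
    rw [h, neg_add_cancel, S.Phi_zero] at this
    exact this.symm
  have hev : (fun t => φ (S.Phi t x)) =ᶠ[nhds 0] fun _ => φ x := by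
    filter_upwards [Icc_mem_nhds (neg_lt_zero.2 hT) hT] with t ht
    have h1 := S.mono x ht.1
    have h2 := S.mono x ht.2
    simp only [h, h'] at h1 h2
    exact le_antisymm h2 h1
  have h0 := S.deriv_Phi x 0
  have h1 := ((hasDerivAt_const (0:ℝ) (φ x)).congr_of_eventuallyEq hev)
  have h2 := h0.unique h1
  rw [S.Phi_zero] at h2
  have h3 := S.hc x
  have : ‖f x‖ ^ 2 = 0 := by
    rcases mul_eq_zero.1 h2 with h | h
    · linarith
    · exact h
  simpa using this

theorem fix_g {T : ℝ} (hT : 0 < T) {x : ℂ} (h : S.E (S.Phi T x) = x) : f x = 0 ∨ φ x = M + 1 := by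
  rcases le_or_gt (φ (S.Phi T x)) (M + 1) with h1 | h1
  · rw [S.E_low h1] at h
    exact Or.inl (S.fix_Phi hT h)
  · right
    have := S.E_phi h1
    rwa [h] at this

theorem g_high {T : ℝ} (hT : 2 ≤ T) {x : ℂ} (hx : M ≤ φ x) :
    S.E (S.Phi T x) = S.rep (S.orb (S.p x)) := by
  rw [S.E_high, S.p_Phi hx (by linarith)]
  rw [S.phi_Phi hx (by linarith)]; linarith

theorem fix_rep {T : ℝ} (hT : 2 ≤ T) {x : ℂ} (hx : φ x = M + 1) (h : S.E (S.Phi T x) = x) :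
    x ∈ S.Reps := by
  rw [S.g_high hT (by linarith), S.p_of_eq hx] at h
  exact ⟨x, hx, h.symm⟩

theorem g_near {T : ℝ} (hT : 2 ≤ T) {y : ℂ} (hy : y ∈ S.Reps) :
    ∀ᶠ x in nhds y, S.E (S.Phi T x) = y := by
  have hφ := S.Reps_phi hy
  have h1 : S.p y ∈ S.orb y := by rw [S.p_of_eq hφ]; exact S.mem_orb_self y
  filter_upwards [S.p_orb_nhds (by linarith) h1 hφ] with x hx
  rw [S.g_high hT hx.1.le, S.orb_eq hx.2, S.Reps_rep hy]

theorem g_cont (hS : S.NonPer) : Continuous (fun p : ℝ × ℂ => S.E (S.Phi p.1 p.2)) :=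
  (S.E_cont hS).comp S.Phi_cont

theorem g_cont' (hS : S.NonPer) (T : ℝ) : Continuous (fun x : ℂ => S.E (S.Phi T x)) :=
  (S.g_cont hS).comp (by fun_prop : Continuous fun x : ℂ => ((T, x) : ℝ × ℂ))

theorem exists_small : ∃ t, 0 < t ∧ t ≤ 1 ∧ ∀ x ∈ sphere (0:ℂ) R, 0 < dot (f x) (S.Phi t x - x) := by
  have hev : ∀ᶠ t in nhds (0:ℝ), ∀ x ∈ sphere (0:ℂ) R, 0 < dot (f x) (f (S.Phi t x)) := by
    refine (isCompact_sphere (0:ℂ) R).eventually_forall_of_forall_eventually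
      (P := fun t x => 0 < dot (f x) (f (S.Phi t x))) ?_
    intro y hy
    have hc : Continuous (fun z : ℝ × ℂ => dot (f z.2) (f (S.Phi z.1 z.2))) :=
      continuous_dot.comp ((S.hf.comp continuous_snd).prodMk (S.hf.comp S.Phi_cont))
    refine hc.continuousAt.eventually (lt_mem_nhds ?_)
    simp only [S.Phi_zero, dot_self]
    have : f y ≠ 0 := S.f_ne (by simpa using (mem_sphere_zero_iff_norm.1 hy).ge)
    positivity
  obtain ⟨ε, hε, h⟩ := Metric.eventually_nhds_iff.1 hev
  refine ⟨min 1 (ε / 2), by positivity, min_le_left _ _, fun x hx => ?_⟩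
  set t := min 1 (ε / 2) with ht
  have ht0 : 0 < t := by positivity
  obtain ⟨u, hu, h1⟩ := exists_hasDerivAt_eq_slope (fun t => dot (f x) (S.Phi t x)) _ ht0
    (fun u _ => (hasDerivAt_dot_left (f x) (S.good.hasDerivAt_flow x u)).continuousAt.continuousWithinAt)
    (fun u _ => hasDerivAt_dot_left (f x) (S.good.hasDerivAt_flow x u))
  rw [S.hY, dot_smul_right, S.Phi_zero, ← dot_sub_right, sub_zero, eq_div_iff ht0.ne'] at h1
  rw [← h1]
  have := h (y := u) (by
    rw [Real.dist_eq, sub_zero, abs_of_pos hu.1]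
    have : t ≤ ε / 2 := min_le_right _ _
    linarith [hu.2]) x hx
  have := S.hc (S.good.flow u x)
  exact mul_pos (mul_pos this (by assumption)) ht0

theorem deg_inner (D : CDeg) (hdeg : D.deg f (ball 0 R) = 1) (hS : S.NonPer) {T : ℝ} (hT : 2 ≤ T) :
    D.deg (fun x => x - S.E (S.Phi T x)) (ball 0 R) = 1 := by
  obtain ⟨t, ht0, ht1, ht⟩ := S.exists_small
  have hfr : frontier (ball (0:ℂ) R) = sphere 0 R := frontier_ball _ S.hR.ne'
  have hcl : closure (ball (0:ℂ) R) = closedBall 0 R := closure_ball _ S.hR.ne'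
  have hns : ∀ T > 0, ∀ x ∈ sphere (0:ℂ) R, x - S.E (S.Phi T x) ≠ 0 := by
    intro T hT x hx h
    have hxn : ‖x‖ = R := mem_sphere_zero_iff_norm.1 hx
    rcases S.fix_g hT (sub_eq_zero.1 h).symm with h1 | h1
    · exact S.f_ne hxn.ge h1
    · have := S.hM x hxn.le
      linarith [le_abs_self (φ x)]
  have h1 : D.deg (fun x => x - S.E (S.Phi t x)) (ball 0 R) =
      D.deg (fun x => x - S.E (S.Phi T x)) (ball 0 R) := by
    have := D.homotopyInv (fun s x => x - S.E (S.Phi (t + s * (T - t)) x)) (ball 0 R) isOpen_ball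
      isBounded_ball (by
        have h2 : Continuous (fun p : ℝ × ℂ => ((t + p.1 * (T - t), p.2) : ℝ × ℂ)) := by fun_prop
        have h3 := (S.g_cont hS).comp h2
        exact (continuous_snd.sub h3).continuousOn) (by
        intro s hs x hx
        rw [hfr] at hx
        refine hns _ ?_ x hx
        have : 0 ≤ s * (T - t) := mul_nonneg hs.1 (by linarith)
        linarith)
    simp only [zero_mul, add_zero, one_mul, add_sub_cancel] at this
    exact this
  have hc1 : Continuous (fun x => x - S.E (S.Phi t x)) := continuous_id.sub (S.g_cont' hS t)
  have hc2 : Continuous (fun x => x - S.Phi t x) := continuous_id.sub (S.good.continuous_flow_x t)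
  have h2 : D.deg (fun x => x - S.E (S.Phi t x)) (ball 0 R) =
      D.deg (fun x => x - S.Phi t x) (ball 0 R) := by
    refine D.congr isOpen_ball isBounded_ball hc1.continuousOn ?_ ?_
    · intro x hx
      rw [hcl, mem_closedBall_zero_iff] at hx
      rw [S.E_low]
      have h4 := S.speed x ht0.le
      rw [S.Phi_zero] at h4
      have := S.hM x hx
      linarith [le_abs_self (φ x)]
    · rw [hfr]; exact hns t ht0
  have h3 : D.deg (fun x => x - S.Phi t x) (ball 0 R) = D.deg (fun x => - f x) (ball 0 R) := by
    refine D.of_inner_pos isOpen_ball isBounded_ball hc2.continuousOn S.hf.neg.continuousOn ?_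
    rw [hfr]
    intro x hx
    have := ht x hx
    simp only [dot, Complex.sub_re, Complex.sub_im] at this
    simp only [Complex.sub_re, Complex.sub_im, Complex.neg_re, Complex.neg_im]
    linarith
  have h4 := D.deg_neg isOpen_ball isBounded_ball (F := f) (Ω := ball 0 R) S.hf.continuousOn (by
    rw [hfr]; intro x hx; exact S.f_ne (mem_sphere_zero_iff_norm.1 hx).ge)
  rw [← h1, h2, h3, h4, hdeg]

theorem exists_big (hS : S.NonPer) : ∃ ρ T : ℝ, R < ρ ∧ R + (M + 1) + M < ρ ∧ 2 ≤ T ∧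
    ∀ x ∈ sphere (0:ℂ) ρ, ‖S.E (S.Phi T x)‖ < ρ := by
  obtain ⟨ρ1, hρ1⟩ := ((isCompact_closedBall (0:ℂ) (R + (M + 2) + M)).image
    (S.E_cont hS)).isBounded.exists_norm_le
  set ρ := max (max R (R + (M + 1) + M)) ρ1 + 1 with hρ
  have a1 : R < ρ := by
    have := (le_max_left R (R + (M + 1) + M)).trans (le_max_left _ ρ1)
    linarith
  have a2 : R + (M + 1) + M < ρ := by
    have := (le_max_right R (R + (M + 1) + M)).trans (le_max_left _ ρ1)
    linarith
  have a3 : ρ1 < ρ := by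
    have := le_max_right (max R (R + (M + 1) + M)) ρ1
    linarith
  obtain ⟨m, hm⟩ := ((isCompact_sphere (0:ℂ) ρ).image S.hφ.continuous).isBounded.exists_norm_le
  refine ⟨ρ, max 2 (M + 3 + m), a1, a2, le_max_left _ _, fun x hx => ?_⟩
  set T := max 2 (M + 3 + m) with hT
  have hT2 : 2 ≤ T := le_max_left _ _
  have hT3 : M + 3 + m ≤ T := le_max_right _ _
  have hmx := hm (φ x) ⟨x, hx, rfl⟩
  rw [Real.norm_eq_abs] at hmx
  rcases lt_or_ge (φ (S.Phi T x)) (M + 2) with h | h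
  · have : ∃ τ ∈ Icc 0 T, ‖S.Phi τ x‖ ≤ R := by
      by_contra! hcon
      have := S.unit_speed x (by linarith : 0 ≤ T) (fun τ hτ => (hcon τ ⟨hτ.1.le, hτ.2.le⟩).le)
      rw [S.Phi_zero] at this
      linarith [neg_abs_le (φ x)]
    obtain ⟨τ, hτ, hτR⟩ := this
    have h2 := S.last_visit hτR (sub_nonneg.2 hτ.2)
    rw [← S.Phi_add, sub_add_cancel] at h2
    refine (hρ1 _ ⟨S.Phi T x, ?_, rfl⟩).trans_lt a3
    rw [mem_closedBall_zero_iff]; linarith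
  · rw [S.E_high h]
    exact (S.rep_norm (S.phi_p (by linarith))).trans_lt a2

theorem bddAbove (D : CDeg) (hdeg : D.deg f (ball 0 R) = 1) (hS : S.NonPer) :
    BddAbove (range φ) := by
  obtain ⟨ρ, T, h1, h2, hT, h3⟩ := S.exists_big hS
  have hR := S.hR
  have hρ0 : ρ ≠ 0 := by linarith
  set F : ℂ → ℂ := fun x => x - S.E (S.Phi T x) with hF
  have hFc : Continuous F := continuous_id.sub (S.g_cont' hS T)
  have hzero : ∀ x, R ≤ ‖x‖ → F x = 0 → x ∈ S.Reps := by
    intro x hx h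
    have h := (sub_eq_zero.1 h).symm
    rcases S.fix_g (by linarith) h with h4 | h4
    · exact absurd h4 (S.f_ne hx)
    · exact S.fix_rep hT h4 h
  have d1 : D.deg F (ball 0 ρ) = 1 := by
    rw [D.rouche (G := id) isOpen_ball isBounded_ball hFc.continuousOn continuousOn_id,
      D.normalized _ isOpen_ball isBounded_ball (by simp; linarith)]
    rw [frontier_ball _ hρ0]
    intro x hx
    have := h3 x hx
    rw [mem_sphere_zero_iff_norm] at hx
    simpa [F, hx] using this
  have d2 := S.deg_inner D hdeg hS hT
  have ho2 : IsOpen (ball (0:ℂ) ρ \ closedBall 0 R) := isOpen_ball.sdiff isClosed_closedBall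
  have hcl2 : closure (ball (0:ℂ) ρ \ closedBall 0 R) ⊆ {x | R ≤ ‖x‖} := by
    refine closure_minimal ?_ (isClosed_le continuous_const continuous_norm)
    intro x hx
    have := hx.2
    simp only [mem_closedBall_zero_iff, not_le] at this
    exact this.le
  have hRepsN : ∀ y ∈ S.Reps, R < ‖y‖ := fun y hy => S.far (by rw [S.Reps_phi hy]; linarith)
  have hRin : S.Reps ⊆ ball (0:ℂ) ρ \ closedBall 0 R := by
    intro y hy
    refine ⟨?_, ?_⟩
    · rw [mem_ball_zero_iff]; exact (S.Reps_norm hy).trans_lt h2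
    · simpa using hRepsN y hy
  have d3 : D.deg F (ball (0:ℂ) ρ \ closedBall 0 R) = ∑ a ∈ S.Reps_finite.toFinset, 1 := by
    refine D.deg_sum _ F _ ho2 (isBounded_ball.subset sdiff_subset) hFc.continuousOn
      (by simpa using hRin) ?_ _ ?_
    · intro x hx h
      simpa using hzero x (hcl2 hx) h
    · intro y hy
      have hy : y ∈ S.Reps := by simpa using hy
      obtain ⟨ε₀, hε₀, h⟩ := Metric.eventually_nhds_iff.1 (S.g_near hT hy)
      refine ⟨ε₀, hε₀, fun ε hε hεε => ?_⟩
      have he : ∀ x ∈ closure (ball y ε), F x = x - y := by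
        rw [closure_ball _ hε.ne']
        intro x hx
        simp only [F]
        rw [h (lt_of_le_of_lt hx hεε)]
      rw [D.congr isOpen_ball isBounded_ball hFc.continuousOn he, D.deg_sub y hε]
      intro x hx
      rw [he x (frontier_subset_closure hx)]
      rw [frontier_ball _ hε.ne', mem_sphere, dist_eq_norm] at hx
      intro h0
      rw [h0, norm_zero] at hx
      linarith
  have d4 := D.additive F (ball 0 ρ) (ball 0 R) (ball 0 ρ \ closedBall 0 R) isOpen_ball
    isBounded_ball isOpen_ball ho2 (ball_subset_ball h1.le) sdiff_subset (by
      rw [Set.disjoint_left]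
      intro x hx hx'
      exact hx'.2 (ball_subset_closedBall hx)) hFc.continuousOn (by
      intro x hx h
      have hx2 := hx.2
      simp only [mem_union, not_or] at hx2
      have := hzero x (by simpa using hx2.1) h
      exact hx2.2 (hRin this))
  rw [d1, d2, d3] at d4
  have hcard : S.Reps_finite.toFinset.card = 0 := by
    simp only [Finset.sum_const, nsmul_eq_mul, mul_one] at d4
    have : ((S.Reps_finite.toFinset.card : ℕ) : ℤ) = 0 := by linarith
    exact_mod_cast this
  have hempty : S.Reps = ∅ := by simpa using hcard
  refine ⟨M + 1, ?_⟩
  rintro _ ⟨x, rfl⟩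
  by_contra! hx
  have h00 := S.hM 0 (by simpa using hR.le)
  obtain ⟨y, hy⟩ := mem_range_of_exists_le_of_exists_ge S.hφ.continuous
    ⟨0, (by linarith [le_abs_self (φ 0)] : φ 0 ≤ M + 1)⟩ ⟨x, hx.le⟩
  have : S.rep (S.orb y) ∈ S.Reps := ⟨y, hy, rfl⟩
  rw [hempty] at this
  exact this

theorem dichotomy (S : Setup φ f Y c R M) (D : CDeg) (hdeg : D.deg f (ball 0 R) = 1) :
    BddBelow (range φ) ∨ BddAbove (range φ) := by
  by_cases hS : S.NonPer
  · exact Or.inr (S.bddAbove D hdeg hS)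
  · unfold NonPer at hS
    push Not at hS
    obtain ⟨y, hy, T, hT, h⟩ := hS
    exact Or.inl (S.periodic_case hy hT h)

end Setup

open MeasureTheory in
theorem smooth_compact {g : ℂ → ℝ} (hg : ContDiff ℝ 1 g) (hs : HasCompactSupport g) {e : ℝ}
    (he : 0 < e) : ∃ G : ℂ → ℝ, ContDiff ℝ 2 G ∧ (∀ x, |G x - g x| ≤ e) ∧
      (∀ x, ‖fderiv ℝ G x - fderiv ℝ g x‖ ≤ e) ∧ ∀ x, (∀ y ∈ ball x 1, g y = 0) → G x = 0 := by
  have hg' : Continuous (fderiv ℝ g) := hg.continuous_fderiv (by norm_num)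
  have u1 : UniformContinuous g := hs.uniformContinuous_of_continuous hg.continuous
  have u2 : UniformContinuous (fderiv ℝ g) :=
    (hs.fderiv ℝ).uniformContinuous_of_continuous hg'
  obtain ⟨δ1, hδ1, h1⟩ := Metric.uniformContinuous_iff.1 u1 e he
  obtain ⟨δ2, hδ2, h2⟩ := Metric.uniformContinuous_iff.1 u2 e he
  set δ := min 1 (min δ1 δ2) with hδ
  have hδ0 : 0 < δ := by positivity
  let b : ContDiffBump (0:ℂ) := ⟨δ / 2, δ, by positivity, by linarith⟩
  have hr : b.rOut = δ := rfl
  have hd1 : δ ≤ δ1 := (min_le_right _ _).trans (min_le_left _ _)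
  have hd2 : δ ≤ δ2 := (min_le_right _ _).trans (min_le_right _ _)
  have hd3 : δ ≤ 1 := min_le_left _ _
  refine ⟨convolution (b.normed volume) g (ContinuousLinearMap.lsmul ℝ ℝ) volume, ?_, ?_, ?_, ?_⟩
  · refine HasCompactSupport.contDiff_convolution_left (n := 2) _ b.hasCompactSupport_normed
      (b.contDiff_normed (n := 2)) hg.continuous.locallyIntegrable
  · intro x
    rw [← Real.dist_eq]
    refine b.dist_normed_convolution_le hg.continuous.aestronglyMeasurable ?_
    intro y hy
    exact (h1 (lt_of_lt_of_le hy (hr ▸ hd1))).le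
  · intro x
    have hfd := hs.hasFDerivAt_convolution_right (ContinuousLinearMap.lsmul ℝ ℝ) (μ := volume)
      (f := b.normed volume) b.continuous_normed.locallyIntegrable hg x
    rw [hfd.fderiv, ← dist_eq_norm]
    have : (convolution (b.normed volume) (fderiv ℝ g)
        (ContinuousLinearMap.precompR ℂ (ContinuousLinearMap.lsmul ℝ ℝ)) volume) x =
        (convolution (b.normed volume) (fderiv ℝ g) (ContinuousLinearMap.lsmul ℝ ℝ) volume) x := by
      unfold convolution
      congr 1
    rw [this]
    refine b.dist_normed_convolution_le hg'.aestronglyMeasurable ?_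
    intro y hy
    exact (h2 (lt_of_lt_of_le hy (hr ▸ hd2))).le
  · intro x hx
    have h0 : g x = 0 := hx x (mem_ball_self one_pos)
    rw [b.normed_convolution_eq_right, h0]
    intro y hy
    rw [h0]
    exact hx y (ball_subset_ball (hr ▸ hd3) hy)

/-- cutoffs -/
def etaB (k : ℕ) : ContDiffBump (0:ℂ) := ⟨k + 1, k + 2, by positivity, by linarith⟩

theorem smooth_approx {φ : ℂ → ℝ} (hφ : ContDiff ℝ 1 φ) : ∃ ψ : ℂ → ℝ, ContDiff ℝ 2 ψ ∧
    (∀ x, |ψ x - φ x| ≤ 1) ∧ ∀ x, ‖fderiv ℝ ψ x - fderiv ℝ φ x‖ ≤ 1 := by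
  set χ : ℕ → ℂ → ℝ := fun k => Nat.casesOn k (fun x => etaB 0 x)
    (fun k x => etaB (k + 1) x - etaB k x) with hχ
  have hχd : ∀ k, ContDiff ℝ 1 (χ k) := by
    intro k
    cases k with
    | zero => exact (etaB 0).contDiff
    | succ k => exact (etaB (k + 1)).contDiff.sub (etaB k).contDiff
  have hχs : ∀ k, HasCompactSupport (χ k) := by
    intro k
    cases k with
    | zero => exact (etaB 0).hasCompactSupport
    | succ k => exact (etaB (k + 1)).hasCompactSupport.sub (etaB k).hasCompactSupport
  have hχsum : ∀ n x, ∑ k ∈ Finset.range (n + 1), χ k x = etaB n x := by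
    intro n x
    induction n with
    | zero => simp [χ]
    | succ n ih => rw [Finset.sum_range_succ, ih]; simp [χ]
  have hone : ∀ (k : ℕ) x, ‖x‖ ≤ k + 1 → etaB k x = 1 := fun k x hx =>
    (etaB k).one_of_mem_closedBall (by simpa [etaB] using hx)
  have hχz : ∀ (k : ℕ) (x : ℂ), ‖x‖ ≤ k + 1 → χ (k + 1) x = 0 := by
    intro k x hx
    simp only [χ]
    rw [hone k x hx, hone (k + 1) x (by push_cast; linarith), sub_self]
  have hpos : ∀ k : ℕ, (0:ℝ) < (1 / 2) ^ k / 2 := fun k => by positivity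
  choose G hG1 hG2 hG3 hG4 using fun k => smooth_compact ((hχd k).mul hφ)
    ((hχs k).mul_right (f' := φ)) (hpos k)
  have hsum : ∀ n : ℕ, ∑ k ∈ Finset.range n, ((1:ℝ) / 2) ^ k / 2 ≤ 1 := by
    intro n
    rw [← Finset.sum_div]
    have := sum_geometric_two_le n
    linarith
  have hGz : ∀ (k : ℕ) (x : ℂ), ‖x‖ ≤ k → G (k + 1) x = 0 := by
    intro k x hx
    refine hG4 (k + 1) x fun y hy => ?_
    rw [mem_ball, dist_eq_norm] at hy
    have := norm_sub_norm_le y x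
    rw [hχz k y (by linarith), zero_mul]
  set ψ : ℂ → ℝ := fun x => ∑ k ∈ Finset.range (⌈‖x‖⌉₊ + 1), G k x with hψ
  have hψN : ∀ (N : ℕ) (x : ℂ), ‖x‖ ≤ N → ψ x = ∑ k ∈ Finset.range (N + 1), G k x := by
    intro N x hx
    refine Finset.sum_subset ?_ ?_
    · refine Finset.range_mono ?_
      have := Nat.ceil_le.2 hx
      omega
    · intro k _ hk
      obtain ⟨j, rfl⟩ : ∃ j, k = j + 1 := ⟨k - 1, by simp at hk; omega⟩
      refine hGz j x ?_
      simp only [Finset.mem_range, not_lt] at hk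
      exact Nat.ceil_le.1 (by omega)
  have hφN : ∀ (N : ℕ) (x : ℂ), ‖x‖ ≤ N → φ x = ∑ k ∈ Finset.range (N + 1), (χ k * φ) x := by
    intro N x hx
    simp only [Pi.mul_apply]
    rw [← Finset.sum_mul, hχsum, hone N x (by linarith), one_mul]
  have hN : ∀ x : ℂ, ∃ N : ℕ, ‖x‖ < N := fun x => exists_nat_gt _
  have hev : ∀ (x : ℂ) (N : ℕ), ‖x‖ < N → ∀ᶠ y in nhds x, ‖y‖ ≤ N := fun x N h =>
    (continuous_norm.continuousAt.eventually (gt_mem_nhds h)).mono fun y hy => le_of_lt hy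
  refine ⟨ψ, ?_, ?_, ?_⟩
  · rw [contDiff_iff_contDiffAt]
    intro x
    obtain ⟨N, hx⟩ := hN x
    have h1 : ContDiffAt ℝ 2 (fun x => ∑ k ∈ Finset.range (N + 1), G k x) x :=
      (ContDiff.sum fun k _ => hG1 k).contDiffAt
    exact h1.congr_of_eventuallyEq ((hev x N hx).mono fun y hy => hψN N y hy)
  · intro x
    obtain ⟨N, hx⟩ := hN x
    rw [hψN N x hx.le, hφN N x hx.le, ← Finset.sum_sub_distrib]
    exact (Finset.abs_sum_le_sum_abs _ _).trans
      ((Finset.sum_le_sum fun k _ => hG2 k x).trans (hsum _))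
  · intro x
    obtain ⟨N, hx⟩ := hN x
    have e1 : ψ =ᶠ[nhds x] fun x => ∑ k ∈ Finset.range (N + 1), G k x :=
      (hev x N hx).mono fun y hy => hψN N y hy
    have e2 : φ =ᶠ[nhds x] fun x => ∑ k ∈ Finset.range (N + 1), (χ k * φ) x :=
      (hev x N hx).mono fun y hy => hφN N y hy
    rw [e1.fderiv_eq, e2.fderiv_eq, fderiv_fun_sum, fderiv_fun_sum, ← Finset.sum_sub_distrib]
    · exact (norm_sum_le _ _).trans
        ((Finset.sum_le_sum fun k _ => hG3 k x).trans (hsum _))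
    · intro k _
      exact (((hχd k).mul hφ).differentiable (by norm_num)).differentiableAt
    · intro k _
      exact ((hG1 k).differentiable (by norm_num)).differentiableAt

theorem HasGrad.contDiff {φ : ℂ → ℝ} {f : ℂ → ℂ} (h : HasGrad φ f) (hf : Continuous f) :
    ContDiff ℝ 1 φ := by
  rw [contDiff_one_iff_fderiv]
  refine ⟨fun x => (h x).hasFDerivAt.differentiableAt, ?_⟩
  have : fderiv ℝ φ = fun x => InnerProductSpace.toDual ℝ ℂ (f x) := by
    ext1 x; exact (h x).hasFDerivAt.fderiv
  rw [this]
  fun_prop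

theorem goodField_of_contDiff {Y : ℂ → ℂ} (hY : ContDiff ℝ 1 Y) (hb : ∀ x, ‖Y x‖ ≤ 1) :
    GoodField Y where
  bdd := hb
  lip := fun R => ContDiffOn.exists_lipschitzOnWith (n := 1) hY.contDiffOn (by norm_num)
    (convex_closedBall 0 R) (isCompact_closedBall 0 R)

theorem dichotomy_C2 (D : CDeg) {φ : ℂ → ℝ} {f : ℂ → ℂ} (hφ : HasGrad φ f) (hf : ContDiff ℝ 1 f)
    {r : ℝ} (hr : 0 < r) (hbig : ∀ x, r ≤ ‖x‖ → 1 ≤ ‖f x‖) (hdeg : D.deg f (ball 0 (2 * r)) = 1) :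
    BddBelow (range φ) ∨ BddAbove (range φ) := by
  let χ : ContDiffBump (0:ℂ) := ⟨r, 2 * r, hr, by linarith⟩
  have hχ0 : ∀ x, 0 ≤ χ x := fun x => χ.nonneg
  have hden : ∀ x, 0 < ‖f x‖ ^ 2 + χ x := by
    intro x
    rcases le_total ‖x‖ r with h | h
    · rw [χ.one_of_mem_closedBall (by simpa using h)]; positivity
    · have := hbig x h
      have := hχ0 x
      nlinarith
  have hle : ∀ x, ‖f x‖ ≤ ‖f x‖ ^ 2 + χ x := by
    intro x
    rcases le_total ‖x‖ r with h | h
    · rw [χ.one_of_mem_closedBall (by simpa using h)]; nlinarith [sq_nonneg (‖f x‖ - 1), norm_nonneg (f x)]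
    · have := hbig x h
      have := hχ0 x
      nlinarith
  set c : ℂ → ℝ := fun x => (‖f x‖ ^ 2 + χ x)⁻¹ with hc
  have hcpos : ∀ x, 0 < c x := fun x => inv_pos.2 (hden x)
  have hcd : ContDiff ℝ 1 c := (((hf.norm_sq ℝ).add χ.contDiff).inv fun x => (hden x).ne')
  have hYd : ContDiff ℝ 1 (fun x => (c x : ℂ) * f x) :=
    (Complex.ofRealCLM.contDiff.comp hcd).mul hf
  have hYn : ∀ x, ‖(c x : ℂ) * f x‖ ≤ 1 := by
    intro x
    rw [norm_mul, Complex.norm_real, Real.norm_of_nonneg (hcpos x).le, hc]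
    simp only
    rw [inv_mul_le_iff₀ (hden x), mul_one]
    exact hle x
  obtain ⟨m, hm⟩ := ((isCompact_closedBall (0:ℂ) (2 * r)).image hφ.continuous).isBounded.exists_norm_le
  have S : Setup φ f (fun x => (c x : ℂ) * f x) c (2 * r) (m + 1) :=
    { hR := by linarith
      hφ := hφ
      hf := hf.continuous
      hc := hcpos
      hY := fun x => rfl
      hle := fun x => by
        simp only [hc]
        rw [inv_mul_le_iff₀ (hden x), mul_one]
        linarith [hχ0 x]
      hout := fun x hx => by
        have : χ x = 0 := χ.zero_of_le_dist (by simpa using hx)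
        have h := hden x
        simp only [hc]
        rw [this, add_zero] at h ⊢
        exact inv_mul_cancel₀ h.ne'
      good := goodField_of_contDiff hYd hYn
      goodI := goodField_of_contDiff (contDiff_const.mul hYd) (fun x => by simpa using hYn x)
      hM := fun x hx => by
        have := hm (φ x) ⟨x, by simpa using hx, rfl⟩
        rw [Real.norm_eq_abs] at this
        linarith }
  exact S.dichotomy D hdeg

/-- proper gradient maps of degree one -/
structure PG (D : CDeg) (φ : ℂ → ℝ) (f : ℂ → ℂ) : Prop where
  hφ : HasGrad φ f
  hf : Continuous f
  big : ∀ C : ℝ, ∃ r > 0, ∀ x, r ≤ ‖x‖ → C ≤ ‖f x‖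
  deg : ∀ R > 0, (∀ x, R ≤ ‖x‖ → f x ≠ 0) → D.deg f (ball 0 R) = 1

theorem PG.dichotomy {D : CDeg} {φ : ℂ → ℝ} {f : ℂ → ℂ} (P : PG D φ f) :
    BddBelow (range φ) ∨ BddAbove (range φ) := by
  obtain ⟨ψ, h1, h2, h3⟩ := smooth_approx (P.hφ.contDiff P.hf)
  set g : ℂ → ℂ := fun x => (InnerProductSpace.toDual ℝ ℂ).symm (fderiv ℝ ψ x) with hg
  have hgG : HasGrad ψ g := by
    intro x
    rw [hasGradientAt_iff_hasFDerivAt]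
    simp only [hg, LinearIsometryEquiv.apply_symm_apply]
    exact ((h1.differentiable (by norm_num)) x).hasFDerivAt
  have hgd : ContDiff ℝ 1 g := by
    have := h1.fderiv_right (m := 1) (by norm_num)
    exact (InnerProductSpace.toDual ℝ ℂ).symm.toContinuousLinearEquiv.contDiff.comp this
  have hclose : ∀ x, ‖g x - f x‖ ≤ 1 := by
    intro x
    have := h3 x
    rw [(P.hφ x).hasFDerivAt.fderiv, (hgG x).hasFDerivAt.fderiv, ← map_sub,
      LinearIsometryEquiv.norm_map] at this
    exact this
  obtain ⟨r, hr, hb⟩ := P.big 2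
  have hr2 : (2 * r) ≠ 0 := by positivity
  have key := dichotomy_C2 D hgG hgd hr (fun x hx => by
    have := hb x hx
    have h4 := hclose x
    have := norm_sub_norm_le (f x) (g x)
    rw [norm_sub_rev] at this
    linarith) (by
    rw [D.rouche (G := f) isOpen_ball isBounded_ball hgd.continuous.continuousOn P.hf.continuousOn]
    · refine P.deg _ (by positivity) fun x hx h0 => ?_
      have := hb x (by linarith)
      rw [h0, norm_zero] at this
      linarith
    · rw [frontier_ball _ hr2]
      intro x hx
      rw [mem_sphere_zero_iff_norm] at hx
      have := hb x (by linarith)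
      linarith [hclose x])
  rcases key with ⟨m, hm⟩ | ⟨m, hm⟩
  · left
    refine ⟨m - 1, ?_⟩
    rintro _ ⟨x, rfl⟩
    have := hm ⟨x, rfl⟩
    linarith [abs_le.1 (h2 x)]
  · right
    refine ⟨m + 1, ?_⟩
    rintro _ ⟨x, rfl⟩
    have := hm ⟨x, rfl⟩
    linarith [abs_le.1 (h2 x)]

/-- a local slope bound at a point bounds the gradient -/
theorem HasGrad.norm_le_of_slope {φ : ℂ → ℝ} {f : ℂ → ℂ} (h : HasGrad φ f) {x : ℂ} {C : ℝ}
    (hx : ∀ y, φ x - C * ‖y - x‖ ≤ φ y) : ‖f x‖ ≤ C := by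
  by_contra! hlt
  have hf0 : f x ≠ 0 := by
    intro h0
    rw [h0, norm_zero] at hlt
    have h1 := hx (x + 1)
    have h2 : HasDerivAt (fun s : ℝ => φ (x + (s : ℂ) * 1)) 0 0 := by
      have := h.comp (hasDerivAt_line x 1 0)
      simpa [h0, dot] using this
    have h3 := h2.isLittleO
    rw [Asymptotics.isLittleO_iff] at h3
    have h4 := (h3 (c := -C / 2) (by linarith))
    obtain ⟨ε, hε, h5⟩ := Metric.eventually_nhds_iff.1 h4
    have h6 := h5 (y := ε / 2) (by rw [Real.dist_eq, sub_zero, abs_of_pos (by positivity)]; linarith)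
    simp at h6
    have h7 := hx (x + ((ε / 2 : ℝ) : ℂ))
    simp at h7
    have h8 := neg_abs_le (φ (x + (ε : ℂ) / 2) - φ x)
    have h9 := le_abs_self (φ (x + (ε : ℂ) / 2) - φ x)
    rw [abs_of_pos hε] at h6 h7
    nlinarith
  have hn : 0 < ‖f x‖ := norm_pos_iff.2 hf0
  have h2 : HasDerivAt (fun s : ℝ => φ (x + (s : ℂ) * (- f x))) (- ‖f x‖ ^ 2) 0 := by
    have := h.comp (hasDerivAt_line x (- f x) 0)
    rw [← dot_self]
    simpa [dot, add_comm] using this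
  have h3 := h2.isLittleO
  rw [Asymptotics.isLittleO_iff] at h3
  have h4 := (h3 (c := ‖f x‖ * (‖f x‖ - C) / 2) (by
    have := sub_pos.2 hlt
    positivity))
  obtain ⟨ε, hε, h5⟩ := Metric.eventually_nhds_iff.1 h4
  have h6 := h5 (y := ε / 2) (by rw [Real.dist_eq, sub_zero, abs_of_pos (by positivity)]; linarith)
  have h7 := hx (x + ((ε / 2 : ℝ) : ℂ) * (- f x))
  have e1 : ‖x + ((ε / 2 : ℝ) : ℂ) * (- f x) - x‖ = ε / 2 * ‖f x‖ := by
    rw [add_sub_cancel_left, norm_mul, Complex.norm_real, Real.norm_of_nonneg (by positivity), norm_neg]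
  rw [e1] at h7
  rw [Real.norm_eq_abs, Real.norm_eq_abs] at h6
  simp only [Complex.ofReal_zero, zero_mul, add_zero, sub_zero, smul_eq_mul] at h6
  rw [abs_of_pos (by positivity : 0 < ε / 2)] at h6
  have h8 := (abs_le.1 h6).2
  have : 0 < ε * (‖f x‖ * (‖f x‖ - C)) := by
    have := sub_pos.2 hlt
    positivity
  nlinarith

/-- local extremum -/
theorem HasGrad.zero_of_localMin {φ : ℂ → ℝ} {f : ℂ → ℂ} (h : HasGrad φ f) {x : ℂ}
    (hx : IsLocalMin φ x) : f x = 0 := by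
  have := hx.hasFDerivAt_eq_zero (h x).hasFDerivAt
  simpa using this

theorem HasGrad.zero_of_localMax {φ : ℂ → ℝ} {f : ℂ → ℂ} (h : HasGrad φ f) {x : ℂ}
    (hx : IsLocalMax φ x) : f x = 0 := by
  have := hx.hasFDerivAt_eq_zero (h x).hasFDerivAt
  simpa using this

theorem HasGrad.growth {φ : ℂ → ℝ} {f : ℂ → ℂ} (h : HasGrad φ f) {R : ℝ}
    (hf1 : ∀ x, R ≤ ‖x‖ → 1 ≤ ‖f x‖) (hb : BddBelow (range φ)) {m : ℝ}
    (hm : ∀ x, ‖x‖ ≤ R → m ≤ φ x) (x : ℂ) : m + (‖x‖ - R) / 2 ≤ φ x := by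
  obtain ⟨B, hB⟩ := hb
  have hB' : ∀ y, B ≤ φ y := fun y => hB ⟨y, rfl⟩
  have hcont : Continuous (fun y => φ y + ‖y - x‖ / 2) := by
    have := h.continuous
    fun_prop
  obtain ⟨z, hz⟩ := hcont.exists_forall_le (by
    refine tendsto_atTop.2 fun C => ?_
    have : ∀ᶠ y in cocompact ℂ, 2 * (C - B) + ‖x‖ ≤ ‖y‖ :=
      (tendsto_norm_cocompact_atTop (E := ℂ)).eventually_ge_atTop _
    filter_upwards [this] with y hy
    have := norm_sub_norm_le y x
    linarith [hB' y])
  have hs : ‖f z‖ ≤ 1 / 2 := by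
    refine h.norm_le_of_slope fun y => ?_
    have h1 := hz y
    have h2 : ‖y - x‖ ≤ ‖y - z‖ + ‖z - x‖ := by
      calc ‖y - x‖ = ‖(y - z) + (z - x)‖ := by ring_nf
        _ ≤ _ := norm_add_le _ _
    linarith
  have hzR : ‖z‖ < R := by
    by_contra! hcon
    linarith [hf1 z hcon]
  have h1 := hz x
  have h2 := hm z hzR.le
  have h3 := norm_sub_norm_le x z
  rw [norm_sub_rev] at h3
  simp only [sub_self, norm_zero, zero_div, add_zero] at h1
  linarith

/-- coercive level data -/
structure Lev (φ : ℂ → ℝ) (f : ℂ → ℂ) (b η ρ : ℝ) : Prop where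
  hφ : HasGrad φ f
  hf : Continuous f
  hη : 0 < η
  bdd : ∀ x, φ x ≤ b → ‖x‖ < ρ
  big : ∀ x, b - η ≤ φ x → 1 ≤ ‖f x‖
  zero : φ 0 < b
  pre1 : IsPreconnected {x | φ x < b}
  pre2 : IsPreconnected {x | b < φ x}

theorem Lev.exists {φ : ℂ → ℝ} {f : ℂ → ℂ} (h : HasGrad φ f) (hf : Continuous f) {R : ℝ} (hR : 0 < R)
    (hf1 : ∀ x, R ≤ ‖x‖ → 1 ≤ ‖f x‖) (hb : BddBelow (range φ)) : ∃ b ρ, Lev φ f b 1 ρ := by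
  have hφc := h.continuous
  obtain ⟨m, hm⟩ := ((isCompact_closedBall (0:ℂ) R).image hφc).isBounded.exists_norm_le
  have hm' : ∀ x, ‖x‖ ≤ R → |φ x| ≤ m := fun x hx => by
    have := hm (φ x) ⟨x, by simpa using hx, rfl⟩
    rwa [Real.norm_eq_abs] at this
  have hg := h.growth hf1 hb (m := -m) (fun x hx => (abs_le.1 (hm' x hx)).1)
  set b := m + 2 with hbd
  set ρ := R + 2 * (b + m) + 1 with hρ
  have hbig : ∀ x, b - 1 ≤ φ x → 1 ≤ ‖f x‖ := by
    intro x hx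
    refine hf1 x ?_
    by_contra! hcon
    have := (abs_le.1 (hm' x hcon.le)).2
    linarith
  have hbdd : ∀ x, φ x ≤ b → ‖x‖ < ρ := by
    intro x hx
    have := hg x
    linarith
  have hsub : ball (0:ℂ) R ⊆ {x | φ x < b} := by
    intro x hx
    have := (abs_le.1 (hm' x (by simpa using (mem_ball_zero_iff.1 hx).le))).2
    simp only [mem_ofPred_eq]
    linarith
  have ho1 : IsOpen {x | φ x < b} := isOpen_lt hφc continuous_const
  have ho2 : IsOpen {x | b < φ x} := isOpen_lt continuous_const hφc
  have hKc : IsCompact {x | φ x ≤ b} := by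
    refine Metric.isCompact_of_isClosed_isBounded (isClosed_le hφc continuous_const) ?_
    exact isBounded_ball.subset (fun x hx => mem_ball_zero_iff.2 (hbdd x hx))
  have hpc := (convex_ball (0:ℂ) R).isPreconnected
  refine ⟨b, ρ, h, hf, one_pos, hbdd, hbig, hsub (mem_ball_self hR), ?_, ?_⟩
  · -- every relatively clopen part contains a critical point
    have key : ∀ U V : Set ℂ, IsOpen U → IsOpen V → {x | φ x < b} ⊆ U ∪ V →
        ({x | φ x < b} ∩ U).Nonempty → ¬ ({x | φ x < b} ∩ (U ∩ V)).Nonempty →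
        (ball (0:ℂ) R ∩ U).Nonempty := by
      intro U V hU hV hUV hne hemp
      obtain ⟨x0, hx0⟩ := hne
      have hcl : closure ({x | φ x < b} ∩ U) ⊆ {x | φ x ≤ b} :=
        closure_minimal (fun x hx => le_of_lt (mem_ofPred_eq.mp hx.1)) hKc.isClosed
      obtain ⟨x, hx, hmin⟩ := (hKc.of_isClosed_subset isClosed_closure hcl).exists_isMinOn
        ⟨x0, subset_closure hx0⟩ hφc.continuousOn
      have hxb : φ x < b := (hmin (subset_closure hx0)).trans_lt hx0.1
      have hxV : x ∉ V := by
        intro hxV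
        obtain ⟨y, hy1, hy2⟩ := mem_closure_iff.1 hx V hV hxV
        exact hemp ⟨y, hy2.1, hy2.2, hy1⟩
      have hxU : x ∈ U := (hUV hxb).resolve_right hxV
      have hf0 : f x = 0 := by
        refine h.zero_of_localMin ?_
        filter_upwards [(ho1.inter hU).mem_nhds ⟨hxb, hxU⟩] with y hy
        exact hmin (subset_closure hy)
      refine ⟨x, ?_, hxU⟩
      rw [mem_ball_zero_iff]
      by_contra! hcon
      have := hf1 x hcon
      rw [hf0, norm_zero] at this
      linarith
    intro U V hU hV hUV h1 h2
    by_contra hcon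
    have a1 := key U V hU hV hUV h1 hcon
    have a2 := key V U hV hU (by rwa [union_comm]) h2 (by rwa [inter_comm V U])
    obtain ⟨x, hx⟩ := hpc U V hU hV (hsub.trans hUV) a1 a2
    exact hcon ⟨x, hsub hx.1, hx.2⟩
  · have hpo := isPreconnected_outside ρ
    have hsub2 : {x : ℂ | ρ < ‖x‖} ⊆ {x | b < φ x} := by
      intro x hx
      by_contra hcon
      have := hbdd x (not_lt.1 hcon)
      exact lt_asymm this hx
    have key : ∀ U V : Set ℂ, IsOpen U → IsOpen V → {x | b < φ x} ⊆ U ∪ V →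
        ({x | b < φ x} ∩ U).Nonempty → ¬ ({x | b < φ x} ∩ (U ∩ V)).Nonempty →
        ({x : ℂ | ρ < ‖x‖} ∩ U).Nonempty := by
      intro U V hU hV hUV hne hemp
      by_contra hno
      obtain ⟨x0, hx0⟩ := hne
      have hcl : closure ({x | b < φ x} ∩ U) ⊆ closedBall 0 ρ := by
        refine closure_minimal (fun x hx => ?_) isClosed_closedBall
        rw [mem_closedBall_zero_iff]
        by_contra! h
        exact hno ⟨x, h, hx.2⟩
      obtain ⟨x, hx, hmax⟩ := ((isCompact_closedBall (0:ℂ) ρ).of_isClosed_subset isClosed_closure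
        hcl).exists_isMaxOn ⟨x0, subset_closure hx0⟩ hφc.continuousOn
      have hx0b : b < φ x0 := hx0.1
      have hxb : b < φ x := hx0b.trans_le (hmax (subset_closure hx0))
      have hxV : x ∉ V := by
        intro hxV
        obtain ⟨y, hy1, hy2⟩ := mem_closure_iff.1 hx V hV hxV
        exact hemp ⟨y, hy2.1, hy2.2, hy1⟩
      have hxU : x ∈ U := (hUV hxb).resolve_right hxV
      have hf0 : f x = 0 := by
        refine h.zero_of_localMax ?_
        filter_upwards [(ho2.inter hU).mem_nhds ⟨hxb, hxU⟩] with y hy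
        exact hmax (subset_closure hy)
      have := hbig x (by linarith)
      rw [hf0, norm_zero] at this
      linarith
    intro U V hU hV hUV h1 h2
    by_contra hcon
    have a1 := key U V hU hV hUV h1 hcon
    have a2 := key V U hV hU (by rwa [union_comm]) h2 (by rwa [inter_comm V U])
    obtain ⟨x, hx⟩ := hpo U V hU hV (hsub2.trans hUV) a1 a2
    exact hcon ⟨x, hsub2 hx.1, hx.2⟩

theorem kernel_near {ε a : ℝ} (hε : 0 < ε) (ha : 1 ≤ a) {g v : ℂ} (hg : ‖g - a‖ ≤ 1 / 10)
    (hv : |v.re| ≤ ‖v‖ / 10) :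
    ε / (2 * (ε ^ 2 + ‖v‖ ^ 2)) ≤ (2 * ε * g / (ε ^ 2 - v ^ 2)).re := by
  have hs : ‖v‖ ^ 2 = v.re ^ 2 + v.im ^ 2 := by
    rw [Complex.sq_norm, Complex.normSq_apply]; ring
  have hp : 100 * v.re ^ 2 ≤ v.re ^ 2 + v.im ^ 2 := by
    rw [← hs]
    have := sq_le_sq' (by linarith [abs_nonneg v.re, norm_nonneg v] : -(‖v‖ / 10) ≤ |v.re|) hv
    rw [sq_abs] at this
    nlinarith
  have h1 : |g.re - a| ≤ 1 / 10 := by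
    have := Complex.abs_re_le_norm (g - a)
    simp at this
    linarith
  have h2 : |g.im| ≤ 1 / 10 := by
    have := Complex.abs_im_le_norm (g - a)
    simp at this
    linarith
  obtain ⟨h1l, h1u⟩ := abs_le.1 h1
  set N := ε ^ 2 + (v.re ^ 2 + v.im ^ 2) with hN
  have hN0 : 0 < N := by positivity
  set d : ℂ := ε ^ 2 - v ^ 2 with hd
  have hdre : d.re = ε ^ 2 - v.re ^ 2 + v.im ^ 2 := by
    simp [hd, pow_two]; ring
  have hdim : d.im = - 2 * (v.re * v.im) := by
    simp [hd, pow_two]; ring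
  have hdn : Complex.normSq d ≤ N ^ 2 := by
    rw [Complex.normSq_apply, hdre, hdim, hN]
    nlinarith [mul_nonneg (sq_nonneg ε) (sq_nonneg v.re)]
  have hdpos : 0 < d.re := by
    rw [hdre]; nlinarith [sq_nonneg v.im]
  have hdn0 : 0 < Complex.normSq d := by
    rw [Complex.normSq_pos]; intro h; rw [h] at hdpos; simp at hdpos
  have hpq : |v.re * v.im| ≤ (v.re ^ 2 + v.im ^ 2) / 10 := by
    rw [abs_le]
    constructor <;> nlinarith [sq_nonneg (10 * v.re + v.im), sq_nonneg (10 * v.re - v.im)]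
  have h3 : |g.im * d.im| ≤ 2 / 100 * (v.re ^ 2 + v.im ^ 2) := by
    rw [abs_mul, hdim, abs_mul]
    have := mul_le_mul h2 hpq (abs_nonneg _) (by norm_num)
    rw [show |(-2:ℝ)| = 2 by norm_num]
    linarith
  have h4 : 9 / 10 * d.re ≤ g.re * d.re := mul_le_mul_of_nonneg_right (by linarith) hdpos.le
  have h5 : N / 2 ≤ g.re * d.re + g.im * d.im := by
    have := neg_abs_le (g.im * d.im)
    rw [hdre] at h4 ⊢
    rw [hN]
    nlinarith [sq_nonneg ε]
  have e1 : (2 * ε * g / d).re = 2 * ε * ((g.re * d.re + g.im * d.im) / Complex.normSq d) := by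
    rw [mul_div_assoc, show (2 * (ε : ℂ)) = ((2 * ε : ℝ) : ℂ) by push_cast; ring,
      Complex.re_ofReal_mul, Complex.div_re]
    ring
  rw [e1, hs, ← hN]
  have h6 : N / 2 / N ^ 2 ≤ (g.re * d.re + g.im * d.im) / Complex.normSq d :=
    div_le_div₀ (by linarith) h5 hdn0 hdn
  have h7 : N / 2 / N ^ 2 = 1 / (2 * N) := by field_simp
  rw [h7] at h6
  calc ε / (2 * N) = ε * (1 / (2 * N)) := by ring
    _ ≤ 2 * ε * (1 / (2 * N)) := by
      have : 0 ≤ ε * (1 / (2 * N)) := by positivity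
      linarith
    _ ≤ _ := by gcongr

theorem kernel_far {ε δ A : ℝ} (hε : 0 < ε) (hεδ : ε ≤ δ / 2) {g v : ℂ} (hg : ‖g‖ ≤ A)
    (hv : δ ≤ ‖v‖) :
    ε / (2 * (ε ^ 2 + ‖v‖ ^ 2)) - (1 / δ ^ 2 + 4 * A / δ ^ 2) * ε ≤
      (2 * ε * g / (ε ^ 2 - v ^ 2)).re := by
  have hδ : 0 < δ := by linarith
  have hA : 0 ≤ A := (norm_nonneg _).trans hg
  have h1 : ε / (2 * (ε ^ 2 + ‖v‖ ^ 2)) ≤ 1 / δ ^ 2 * ε := by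
    rw [div_mul_eq_mul_div, one_mul]
    refine div_le_div_of_nonneg_left hε.le (by positivity) ?_
    nlinarith [sq_nonneg ε]
  have h2 : δ ^ 2 / 2 ≤ ‖(ε : ℂ) ^ 2 - v ^ 2‖ := by
    have := norm_sub_norm_le (v ^ 2) ((ε : ℂ) ^ 2)
    rw [norm_sub_rev, norm_pow, norm_pow, Complex.norm_real, Real.norm_of_nonneg hε.le] at this
    nlinarith
  have h3 : ‖2 * ε * g / ((ε : ℂ) ^ 2 - v ^ 2)‖ ≤ 4 * A / δ ^ 2 * ε := by
    rw [norm_div, norm_mul, norm_mul, Complex.norm_real, Real.norm_of_nonneg hε.le]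
    simp only [Complex.norm_ofNat]
    calc 2 * ε * ‖g‖ / ‖(ε : ℂ) ^ 2 - v ^ 2‖ ≤ 2 * ε * A / (δ ^ 2 / 2) := by
          refine div_le_div₀ (by positivity) (by gcongr) (by positivity) h2
      _ = 4 * A / δ ^ 2 * ε := by field_simp; ring
  have h4 := Complex.abs_re_le_norm (2 * ε * g / ((ε : ℂ) ^ 2 - v ^ 2))
  have h5 := neg_abs_le (2 * ε * g / ((ε : ℂ) ^ 2 - v ^ 2)).re
  rw [add_mul]
  linarith

/-- uniform data near the level set -/
structure Unif (φ : ℂ → ℝ) (f : ℂ → ℂ) (b ρ δ : ℝ) : Prop where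
  hδ : 0 < δ
  hδ1 : δ ≤ 1 / 2
  unif : ∀ p q, ‖p‖ ≤ ρ + 1 → ‖q‖ ≤ ρ + 1 → ‖p - q‖ ≤ 2 * δ → ‖f p - f q‖ ≤ 1 / 10

theorem Unif.exists {φ : ℂ → ℝ} {f : ℂ → ℂ} (hf : Continuous f) (b ρ : ℝ) : ∃ δ, Unif φ f b ρ δ := by
  have := (isCompact_closedBall (0:ℂ) (ρ + 1)).uniformContinuousOn_of_continuous hf.continuousOn
  obtain ⟨δ, hδ, h⟩ := Metric.uniformContinuousOn_iff.1 this (1 / 10) (by norm_num)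
  refine ⟨min (1 / 2) (δ / 4), by positivity, min_le_left _ _, fun p q hp hq hpq => ?_⟩
  have h1 : min (1 / 2) (δ / 4) ≤ δ / 4 := min_le_right _ _
  have := h p (by simpa using hp) q (by simpa using hq) (by rw [dist_eq_norm]; linarith)
  rw [dist_eq_norm] at this
  exact this.le

/-- unit vector -/
def nu (u : ℂ) : ℂ := u / (‖u‖ : ℂ)

theorem norm_nu {u : ℂ} (h : 1 ≤ ‖u‖) : ‖nu u‖ = 1 := by
  have : ‖u‖ ≠ 0 := by linarith
  rw [nu, norm_div, Complex.norm_real, norm_norm, div_self this]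

theorem dot_nu {u : ℂ} (h : 1 ≤ ‖u‖) : dot u (nu u) = ‖u‖ := by
  have h0 : ‖u‖ ≠ 0 := by linarith
  have : nu u = ((‖u‖⁻¹ : ℝ) : ℂ) * u := by rw [nu]; push_cast; field_simp
  rw [this, dot_smul_right, dot_self]
  field_simp

/-- slope of φ along nu -/
theorem Unif.slope {φ : ℂ → ℝ} {f : ℂ → ℂ} {b ρ δ : ℝ} (U : Unif φ f b ρ δ) (h : HasGrad φ f)
    {x y : ℂ} (hy : ‖y‖ ≤ ρ + 1 - δ) (hy1 : 1 ≤ ‖f y‖) {t r : ℝ} (ht : 0 < t) (htd : r ≤ δ)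
    (hx : ‖x - y‖ ≤ r) (hx2 : ‖x + t * nu (f y) - y‖ ≤ r) :
    φ x + 9 / 10 * t ≤ φ (x + t * nu (f y)) := by
  obtain ⟨s, hs, e⟩ := h.mvt x (x + t * nu (f y))
  rw [add_sub_cancel_left] at e
  rw [dot_smul_right] at e
  set ξ := x + s * (t * nu (f y)) with hξ
  have hξy : ‖ξ - y‖ ≤ r := by
    have hc := (convex_closedBall y r).add_smul_sub_mem (x := x) (y := x + t * nu (f y))
      (by rwa [mem_closedBall, dist_eq_norm]) (by rwa [mem_closedBall, dist_eq_norm]) (t := s)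
      ⟨hs.1.le, hs.2.le⟩
    rw [add_sub_cancel_left, mem_closedBall, dist_eq_norm] at hc
    simpa [hξ] using hc
  have hξn : ‖ξ‖ ≤ ρ + 1 := by
    have := norm_sub_norm_le ξ y
    linarith
  have h1 := U.unif ξ y hξn (by linarith [U.hδ]) (by linarith [U.hδ])
  have h2 : dot (f ξ) (nu (f y)) = ‖f y‖ + dot (f ξ - f y) (nu (f y)) := by
    rw [dot_sub_left, dot_nu hy1]; ring
  have h3 := abs_dot_le (f ξ - f y) (nu (f y))
  rw [norm_nu hy1, mul_one] at h3
  have h4 := neg_abs_le (dot (f ξ - f y) (nu (f y)))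
  have h5 : 9 / 10 ≤ dot (f ξ) (nu (f y)) := by linarith
  nlinarith

theorem mul_conj_nu_re (u w : ℂ) : (u * (starRingEnd ℂ) w).re = dot w u := by
  simp [dot]; ring

theorem Unif.poisson {φ : ℂ → ℝ} {f : ℂ → ℂ} {b ρ δ A : ℝ} (U : Unif φ f b ρ δ) (h : HasGrad φ f)
    (hbd : ∀ x, φ x ≤ b → ‖x‖ < ρ) (hA : ∀ x, ‖x‖ ≤ ρ + 1 → ‖f x‖ ≤ A)
    {x y z : ℂ} {ε : ℝ} (hx : φ x = b) (hz : φ z = b) (hε : 0 < ε) (hεδ : ε ≤ δ / 2)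
    (hxy : ‖x - y‖ ≤ ε) (hy1 : 1 ≤ ‖f y‖) :
    ε / (2 * (ε ^ 2 + ‖z - x‖ ^ 2)) - (1 / δ ^ 2 + 4 * A / δ ^ 2) * ε ≤
      (f z * ((z - (x - ε * nu (f y)))⁻¹ - (z - (x + ε * nu (f y)))⁻¹)).re := by
  have hδ := U.hδ
  have hδ1 := U.hδ1
  set ν := nu (f y) with hν
  have hν1 : ‖ν‖ = 1 := norm_nu hy1
  have hνc : ν * (starRingEnd ℂ) ν = 1 := by
    rw [Complex.mul_conj, Complex.normSq_eq_norm_sq, hν1]; norm_num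
  have hν0 : ν ≠ 0 := by
    intro h0; rw [h0, norm_zero] at hν1; linarith
  set v := (z - x) * (starRingEnd ℂ) ν with hv
  set g := f z * (starRingEnd ℂ) ν with hg
  have hvn : ‖v‖ = ‖z - x‖ := by rw [hv, norm_mul, RCLike.norm_conj, hν1, mul_one]
  have hgn : ‖g‖ = ‖f z‖ := by rw [hg, norm_mul, RCLike.norm_conj, hν1, mul_one]
  have hzx : z - x = v * ν := by rw [hv, mul_assoc, mul_comm _ ν, hνc, mul_one]
  have hfz : f z = g * ν := by rw [hg, mul_assoc, mul_comm _ ν, hνc, mul_one]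
  have hzn := hbd z hz.le
  have hxn := hbd x hx.le
  have hyn : ‖y‖ ≤ ρ + 1 := by
    have := norm_sub_norm_le y x
    rw [norm_sub_rev] at this
    linarith
  have main : ε / (2 * (ε ^ 2 + ‖v‖ ^ 2)) - (1 / δ ^ 2 + 4 * A / δ ^ 2) * ε ≤
      (2 * ε * g / (ε ^ 2 - v ^ 2)).re ∧ ((ε : ℂ) ^ 2 - v ^ 2 ≠ 0) := by
    rcases le_total δ ‖v‖ with hd | hd
    · refine ⟨kernel_far hε hεδ (by rw [hgn]; exact hA z (by linarith)) hd, ?_⟩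
      intro h0
      have := norm_sub_norm_le (v ^ 2) ((ε : ℂ) ^ 2)
      rw [norm_sub_rev, h0, norm_zero, norm_pow, norm_pow, Complex.norm_real,
        Real.norm_of_nonneg hε.le] at this
      nlinarith
    · have hvre : |v.re| ≤ ‖v‖ / 10 := by
        obtain ⟨s, hs, e⟩ := h.mvt x z
        rw [hz, hx, sub_self] at e
        set ξ := x + s * (z - x) with hξ
        have hξx : ‖ξ - x‖ ≤ δ := by
          rw [hξ, add_sub_cancel_left, norm_mul, Complex.norm_real, Real.norm_of_nonneg hs.1.le, ← hvn]
          nlinarith [hs.2, norm_nonneg v, hs.1]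
        have hξn : ‖ξ‖ ≤ ρ + 1 := by
          have := norm_sub_norm_le ξ x
          linarith
        have hξy : ‖ξ - y‖ ≤ 2 * δ := by
          have : ξ - y = (ξ - x) + (x - y) := by ring
          rw [this]
          exact (norm_add_le _ _).trans (by linarith)
        have h1 := U.unif ξ y hξn hyn hξy
        have h2 : dot (f y) (z - x) = - dot (f ξ - f y) (z - x) := by
          rw [dot_sub_left, ← e]; ring
        have h3 : |dot (f y) (z - x)| ≤ 1 / 10 * ‖z - x‖ := by
          rw [h2, abs_neg]
          exact (abs_dot_le _ _).trans (by gcongr)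
        rw [hv, mul_conj_nu_re]
        have h0 : ‖f y‖ ≠ 0 := by linarith
        have e2 : ν = ((‖f y‖⁻¹ : ℝ) : ℂ) * f y := by rw [hν, nu]; push_cast; field_simp
        rw [e2, dot_smul_left, ← e2, ← hv, abs_mul, hvn, abs_of_nonneg (by positivity)]
        have h6 : ‖f y‖⁻¹ ≤ 1 := inv_le_one_of_one_le₀ hy1
        have h7 : 0 ≤ ‖f y‖⁻¹ := by positivity
        nlinarith [abs_nonneg (dot (f y) (z - x))]
      have hga : ‖g - ‖f y‖‖ ≤ 1 / 10 := by
        have e1 : g - (‖f y‖ : ℂ) = (f z - f y) * (starRingEnd ℂ) ν := by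
          have : f y = (‖f y‖ : ℂ) * ν := by
            rw [hν, nu]
            have h0 : (‖f y‖ : ℂ) ≠ 0 := by
              have : ‖f y‖ ≠ 0 := by linarith
              exact_mod_cast this
            field_simp
          have e3 : f y * (starRingEnd ℂ) ν = (‖f y‖ : ℂ) := by
            conv_lhs => rw [this]
            rw [mul_assoc, hνc, mul_one]
          rw [sub_mul, e3]
        rw [e1, norm_mul, RCLike.norm_conj, hν1, mul_one]
        refine U.unif z y (by linarith) hyn ?_
        have : z - y = (z - x) + (x - y) := by ring
        rw [this]
        refine (norm_add_le _ _).trans ?_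
        rw [← hvn]; linarith
      have hk := kernel_near hε hy1 hga hvre
      have hA0 : 0 ≤ A := (norm_nonneg _).trans (hA z (by linarith))
      have : 0 ≤ (1 / δ ^ 2 + 4 * A / δ ^ 2) * ε := by positivity
      refine ⟨by linarith, ?_⟩
      intro h0
      rw [h0, div_zero] at hk
      have : 0 < ε / (2 * (ε ^ 2 + ‖v‖ ^ 2)) := by positivity
      simp at hk
      linarith
  rw [← hvn]
  convert main.1 using 2
  have hne := main.2
  have e1 : z - (x - ε * ν) = (v + ε) * ν := by rw [add_mul, ← hzx]; ring
  have e2 : z - (x + ε * ν) = (v - ε) * ν := by rw [sub_mul, ← hzx]; ring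
  have hf1 : (v + ε) ≠ 0 := by
    intro h0; apply hne; linear_combination -(v - ε) * h0
  have hf2 : (v - ε) ≠ 0 := by
    intro h0; apply hne; linear_combination -(v + ε) * h0
  rw [e1, e2, hfz]
  field_simp
  ring

/-- identity function on L -/
def zetaL (L : Set ℂ) : C(L, ℂ) := ⟨Subtype.val, continuous_subtype_val⟩

/-- restriction to L -/
def resL (L : Set ℂ) (f : ℂ → ℂ) (hf : Continuous f) : C(L, ℂ) :=
  ⟨fun z => f z, hf.comp continuous_subtype_val⟩

theorem separation (L : Set ℂ) [CompactSpace L] (h0 : (0:ℂ) ∉ L) (f : ℂ → ℂ) (hf : Continuous f)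
    (hno : ¬ ∃ P : Polynomial ℂ, ∀ z ∈ L, 0 < ((1 / z + P.derivative.eval z) * f z).re) :
    ∃ m : C(L, ℂ) →L[ℂ] ℂ, (∀ g : C(L, ℂ), (∀ z, 0 ≤ (g z).re) → 0 ≤ (m g).re) ∧
      0 < (m 1).re ∧ (∀ n : ℕ, m (resL L f hf * zetaL L ^ n) = 0) ∧
      ∀ g : C(L, ℂ), (∀ z : L, g z = f z / z) → (m g).re ≤ 0 := by
  have hne : ∀ z : L, (z : ℂ) ≠ 0 := fun z hz => h0 (hz ▸ z.2)
  let g0 : C(L, ℂ) := ⟨fun z => f z / z, by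
    exact (hf.comp continuous_subtype_val).div continuous_subtype_val hne⟩
  let s : Set C(L, ℂ) := {g | ∀ z, 0 < (g z).re}
  let t : Set C(L, ℂ) := {g | ∃ P : Polynomial ℂ, ∀ z : L, g z = f z / z + P.derivative.eval (z:ℂ) * f z}
  have hs1 : Convex ℝ s := by
    intro x hx y hy a b ha hb hab z
    have hx := hx z
    have hy := hy z
    simp only [ContinuousMap.add_apply, ContinuousMap.smul_apply, Complex.add_re, Complex.smul_re, smul_eq_mul]
    rcases eq_or_lt_of_le ha with h | h
    · subst h; have : b = 1 := by linarith
      subst this; linarith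
    · have := mul_pos h hx
      have := mul_nonneg hb hy.le
      linarith
  have hs2 : IsOpen s := by
    have := ContinuousMap.isOpen_setOfPred_mapsTo (X := L) (K := univ) (U := {w : ℂ | 0 < w.re})
      isCompact_univ (isOpen_lt continuous_const Complex.continuous_re)
    convert this using 1
    ext g
    constructor
    · intro h z _; exact h z
    · intro h z; exact h (mem_univ z)
  have ht : Convex ℝ t := by
    rintro x ⟨P, hP⟩ y ⟨Q, hQ⟩ a b ha hb hab
    refine ⟨Polynomial.C (a:ℂ) * P + Polynomial.C (b:ℂ) * Q, fun z => ?_⟩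
    simp only [ContinuousMap.add_apply, ContinuousMap.smul_apply, hP, hQ, Complex.real_smul]
    simp
    have : (a:ℂ) + b = 1 := by exact_mod_cast hab
    linear_combination (f z / z) * this
  have hd : Disjoint s t := by
    rw [Set.disjoint_left]
    rintro g hg ⟨P, hP⟩
    apply hno
    refine ⟨P, fun z hz => ?_⟩
    have h1 := hg ⟨z, hz⟩
    rw [hP ⟨z, hz⟩] at h1
    convert h1 using 2
    simp only
    ring
  obtain ⟨l, u, hl1, hl2⟩ := RCLike.geometric_hahn_banach_open (𝕜 := ℂ) hs1 hs2 ht hd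
  simp only [RCLike.re_to_complex] at hl1 hl2
  have h1s : (1 : C(L, ℂ)) ∈ s := fun z => by simp
  have hcone : ∀ g ∈ s, ∀ c : ℝ, 0 < c → c * (l g).re < u := by
    intro g hg c hc
    have : (c : ℂ) • g ∈ s := by
      intro z
      simp only [ContinuousMap.smul_apply, smul_eq_mul, Complex.re_ofReal_mul]
      exact mul_pos hc (hg z)
    have := hl1 _ this
    rwa [map_smul, smul_eq_mul, Complex.re_ofReal_mul] at this
  have hu : 0 ≤ u := by
    by_contra hu
    push Not at hu
    have h2 := hcone 1 h1s
    have h3 : (l 1).re < 0 := by have := h2 1 one_pos; linarith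
    have := h2 (u / (2 * (l 1).re)) (div_pos_of_neg_of_neg hu (by linarith))
    have hn := h3.ne
    rw [show u / (2 * (l 1).re) * (l 1).re = u / 2 by field_simp] at this
    linarith
  have hneg : ∀ g ∈ s, (l g).re ≤ 0 := by
    intro g hg
    by_contra h
    push Not at h
    have := hcone g hg ((u + 1) / (l g).re) (by positivity)
    rw [div_mul_cancel₀ _ h.ne'] at this
    linarith
  have hg0 : u ≤ (l g0).re := hl2 _ ⟨0, fun z => by simp [g0]⟩
  have hone : (l 1).re < 0 := by
    refine lt_of_le_of_ne (hneg 1 h1s) fun h => ?_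
    have h2 : ((‖g0‖ + 1 : ℝ) : ℂ) • (1 : C(L, ℂ)) + g0 ∈ s := by
      intro z
      have h3 := g0.norm_coe_le_norm z
      have h4 := Complex.abs_re_le_norm (g0 z)
      have h5 := neg_abs_le (g0 z).re
      simp only [ContinuousMap.add_apply, ContinuousMap.smul_apply, smul_eq_mul, Complex.add_re,
        ContinuousMap.one_apply, mul_one, Complex.ofReal_re]
      linarith
    have := hl1 _ h2
    rw [map_add, map_smul, Complex.add_re, smul_eq_mul, Complex.re_ofReal_mul, h, mul_zero, zero_add] at this
    linarith
  refine ⟨-l, ?_, ?_, ?_, ?_⟩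
  · intro g hg
    change 0 ≤ (-(l g)).re
    rw [Complex.neg_re]
    by_contra h
    push Not at h
    have h7 : 0 < (l g).re := by linarith
    have h2 : ((-(l g).re / (2 * (l 1).re) : ℝ) : ℂ) • (1 : C(L, ℂ)) + g ∈ s := by
      intro z
      simp only [ContinuousMap.add_apply, ContinuousMap.smul_apply, smul_eq_mul, Complex.add_re,
        ContinuousMap.one_apply, mul_one, Complex.ofReal_re]
      have : 0 < -(l g).re / (2 * (l 1).re) := div_pos_of_neg_of_neg (by linarith) (by linarith)
      have := hg z
      linarith
    have := hneg _ h2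
    have hn := hone.ne
    rw [map_add, map_smul, Complex.add_re, smul_eq_mul, Complex.re_ofReal_mul,
      show -(l g).re / (2 * (l 1).re) * (l 1).re = -(l g).re / 2 by field_simp] at this
    linarith
  · change 0 < (-(l 1)).re
    rw [Complex.neg_re]; linarith
  · intro n
    change -(l _) = 0
    rw [neg_eq_zero]
    set k := resL L f hf * zetaL L ^ n with hk
    have hc : ∀ c : ℂ, u ≤ (l g0).re + (c * l k).re := by
      intro c
      have : g0 + c • k ∈ t := by
        refine ⟨Polynomial.C (c / (n + 1)) * Polynomial.X ^ (n + 1), fun z => ?_⟩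
        have hn : (n : ℂ) + 1 ≠ 0 := by exact_mod_cast Nat.succ_ne_zero n
        simp [g0, hk, resL, zetaL]
        field_simp
      have := hl2 _ this
      rwa [map_add, map_smul, smul_eq_mul, Complex.add_re] at this
    by_contra hz
    have := hc ((u - (l g0).re - 1 : ℝ) / l k)
    rw [div_mul_cancel₀ _ hz, Complex.ofReal_re] at this
    linarith
  · intro g hg
    have : g = g0 := by ext z; exact hg z
    rw [this]
    change (-(l g0)).re ≤ 0
    rw [Complex.neg_re]; linarith

/-- Cauchy transform of the functional -/
def cauchyT (L : Set ℂ) [CompactSpace L] (f : ℂ → ℂ) (hf : Continuous f) (m : C(L, ℂ) →L[ℂ] ℂ) (w : ℂ) : ℂ :=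
  - m (resL L f hf * resolvent (zetaL L) w)

theorem mem_resolvent {L : Set ℂ} [CompactSpace L] {w : ℂ} (hw : w ∉ L) :
    w ∈ resolventSet ℂ (zetaL L) := by
  rw [spectrum.mem_resolventSet_iff, ContinuousMap.isUnit_iff_forall_ne_zero]
  intro z hz
  apply hw
  have : w - (z:ℂ) = 0 := by
    simpa [zetaL] using hz
  rw [sub_eq_zero] at this
  rw [this]; exact z.2

theorem resolvent_apply {L : Set ℂ} [CompactSpace L] {w : ℂ} (hw : w ∉ L) (z : L) :
    resolvent (zetaL L) w z = (w - z)⁻¹ := by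
  have h1 := mem_resolvent (L := L) hw
  rw [spectrum.mem_resolventSet_iff] at h1
  have h2 := Ring.mul_inverse_cancel _ h1
  have h3 := congrArg (fun g : C(L, ℂ) => g z) h2
  have h4 : (w - (z:ℂ)) * resolvent (zetaL L) w z = 1 := by
    simpa [zetaL, resolvent] using h3
  exact eq_inv_of_mul_eq_one_right h4

theorem cauchyT_eq {L : Set ℂ} [CompactSpace L] {f : ℂ → ℂ} {hf : Continuous f} {m : C(L, ℂ) →L[ℂ] ℂ}
    {w : ℂ} (hw : w ∉ L) (g : C(L, ℂ)) (hg : ∀ z : L, g z = f z * ((z:ℂ) - w)⁻¹) :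
    cauchyT L f hf m w = m g := by
  rw [cauchyT, ← map_neg]
  congr 1
  ext z
  rw [hg, ContinuousMap.neg_apply, ContinuousMap.mul_apply, resolvent_apply hw,
    show (w - (z:ℂ)) = -(z - w) by ring, inv_neg]
  simp [resL]

theorem cauchyT_diff {L : Set ℂ} [CompactSpace L] {f : ℂ → ℂ} {hf : Continuous f} {m : C(L, ℂ) →L[ℂ] ℂ} :
    DifferentiableOn ℂ (cauchyT L f hf m) Lᶜ := by
  intro w hw
  have h1 := (spectrum.hasDerivAt_resolvent_const_left (mem_resolvent (L := L) hw)).differentiableAt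
  have h2 : DifferentiableAt ℂ (fun w => resL L f hf * resolvent (zetaL L) w) w :=
    (differentiableAt_const _).mul h1
  have h3 : DifferentiableAt ℂ (fun w => m (resL L f hf * resolvent (zetaL L) w)) w :=
    m.differentiableAt.comp w h2
  exact h3.neg.differentiableWithinAt

theorem cauchyT_far {L : Set ℂ} [CompactSpace L] {f : ℂ → ℂ} {hf : Continuous f} {m : C(L, ℂ) →L[ℂ] ℂ}
    (hm : ∀ n : ℕ, m (resL L f hf * zetaL L ^ n) = 0) {w : ℂ} (hw : ‖zetaL L‖ < ‖w‖) :
    cauchyT L f hf m w = 0 := by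
  have hw0 : w ≠ 0 := by
    intro h; rw [h, norm_zero] at hw; linarith [norm_nonneg (zetaL L)]
  have hwp : 0 < ‖w‖ := norm_pos_iff.2 hw0
  have hwL : w ∉ L := by
    intro h
    have := (zetaL L).norm_coe_le_norm ⟨w, h⟩
    exact absurd hw (not_lt.2 this)
  set a : C(L, ℂ) := w⁻¹ • zetaL L with ha
  have ha1 : ‖a‖ < 1 := by
    rw [ha, norm_smul, norm_inv, inv_mul_lt_one₀ hwp]
    exact hw
  have hs : Summable (fun n : ℕ => a ^ n) := summable_geometric_of_norm_lt_one ha1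
  have hG := mul_neg_geom_series a ha1
  set G := ∑' n : ℕ, a ^ n with hGd
  have h1 : m (resL L f hf * G) = 0 := by
    have h2 := (hs.hasSum.mul_left (resL L f hf)).mapL m
    have h3 : (fun n : ℕ => m (resL L f hf * a ^ n)) = fun _ => 0 := by
      funext n
      rw [ha, smul_pow, mul_smul_comm, map_smul, hm, smul_zero]
    rw [h3] at h2
    exact h2.unique hasSum_zero
  rw [cauchyT_eq hwL (-(w⁻¹) • (resL L f hf * G)) ?_, map_smul, h1, smul_zero]
  intro z
  have h4 := congrArg (fun g : C(L, ℂ) => g z) hG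
  have h5 : (1 - w⁻¹ * (z:ℂ)) * G z = 1 := by simpa [ha, zetaL] using h4
  have h6 : (z:ℂ) - w ≠ 0 := by
    intro h; apply hwL
    rw [sub_eq_zero] at h
    rw [← h]; exact z.2
  have h7 : (w - z) * G z = w := by
    have : (w - (z:ℂ)) * G z = w * ((1 - w⁻¹ * (z:ℂ)) * G z) := by field_simp
    rw [this, h5, mul_one]
  have h8 : G z = - w * ((z:ℂ) - w)⁻¹ := by
    field_simp
    linear_combination -h7
  simp only [ContinuousMap.smul_apply, ContinuousMap.mul_apply, smul_eq_mul, h8]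
  simp only [resL, ContinuousMap.coe_mk]
  field_simp

theorem net_one (A : Set ℂ) (p : ℂ → ℝ) (hp : ∀ z ∈ A, |p z| ≤ 1)
    (hA : ∀ z ∈ A, ∀ z' ∈ A, ‖z - z'‖ ≤ 2 * |p z - p z'|) {ε : ℝ} (hε : 0 < ε) (hε1 : ε ≤ 1) :
    ∃ S : Finset ℂ, (∀ x ∈ S, x ∈ A) ∧ (∀ z ∈ A, ∃ x ∈ S, ‖z - x‖ ≤ ε) ∧ S.card * ε ≤ 8 := by
  classical
  let N : ℤ := ⌈2 / ε⌉
  let κ : ℂ → ℤ := fun z => ⌊p z / (ε / 2)⌋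
  let I : Finset ℤ := (Finset.Icc (-N) N).filter (fun k => k ∈ κ '' A)
  have hI : ∀ k : ℤ, ∃ x : ℂ, k ∈ I → x ∈ A ∧ κ x = k := by
    intro k
    by_cases hk : k ∈ I
    · obtain ⟨x, hx, e⟩ := (Finset.mem_filter.1 hk).2
      exact ⟨x, fun _ => ⟨hx, e⟩⟩
    · exact ⟨0, fun h => absurd h hk⟩
  choose r hr using hI
  refine ⟨I.image r, ?_, ?_, ?_⟩
  · intro x hx
    obtain ⟨k, hk, rfl⟩ := Finset.mem_image.1 hx
    exact (hr k hk).1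
  · intro z hz
    have hk : κ z ∈ I := by
      refine Finset.mem_filter.2 ⟨?_, mem_image_of_mem _ hz⟩
      rw [Finset.mem_Icc]
      obtain ⟨h1, h2⟩ := abs_le.1 (hp z hz)
      have e1 : p z / (ε / 2) = p z * (2 / ε) := by field_simp
      have hN : 2 / ε ≤ N := Int.le_ceil _
      have hpos : 0 < 2 / ε := by positivity
      constructor
      · refine Int.le_floor.2 ?_
        rw [e1]; push_cast; nlinarith
      · have : ((κ z : ℤ) : ℝ) ≤ N := (Int.floor_le _).trans (by rw [e1]; nlinarith)
        exact_mod_cast this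
    obtain ⟨h1, h2⟩ := hr _ hk
    refine ⟨r (κ z), Finset.mem_image_of_mem _ hk, ?_⟩
    refine (hA z hz _ h1).trans ?_
    have h3 : |p z / (ε / 2) - p (r (κ z)) / (ε / 2)| < 1 := Int.abs_sub_lt_one_of_floor_eq_floor h2.symm
    rw [← sub_div, abs_div, abs_of_pos (by positivity : 0 < ε / 2), div_lt_one (by positivity)] at h3
    linarith
  · have h1 : (I.image r).card ≤ (2 * N + 1).toNat := by
      refine Finset.card_image_le.trans ((Finset.card_filter_le _ _).trans ?_)
      rw [Int.card_Icc]
      apply Int.toNat_le_toNat; linarith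
    have hN0 : 0 ≤ N := Int.ceil_nonneg (by positivity)
    have h2 : ((I.image r).card : ℝ) ≤ 2 * N + 1 := by
      have : ((I.image r).card : ℤ) ≤ 2 * N + 1 := by
        have h3 : (((2 * N + 1).toNat : ℕ) : ℤ) = 2 * N + 1 := Int.toNat_of_nonneg (by linarith)
        rw [← h3]; exact_mod_cast h1
      exact_mod_cast this
    have h3 : (N : ℝ) < 2 / ε + 1 := Int.ceil_lt_add_one _
    have h4 : 2 / ε * ε = 2 := by field_simp
    nlinarith

theorem Lev.compact {φ : ℂ → ℝ} {f : ℂ → ℂ} {b η ρ : ℝ} (H : Lev φ f b η ρ) : IsCompact {z | φ z = b} := by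
  refine Metric.isCompact_of_isClosed_isBounded (isClosed_eq H.hφ.continuous continuous_const) ?_
  refine (isBounded_ball (x := (0:ℂ)) (r := ρ)).subset fun z hz => ?_
  rw [mem_ball_zero_iff]
  exact H.bdd z (le_of_eq hz)

theorem dot_sq_add (u v : ℂ) (hu : ‖u‖ = 1) : ‖v‖ ^ 2 = dot u v ^ 2 + dot (Complex.I * u) v ^ 2 := by
  have h1 : u.re * u.re + u.im * u.im = 1 := by
    rw [← Complex.normSq_apply, Complex.normSq_eq_norm_sq, hu]; norm_num
  rw [← Complex.normSq_eq_norm_sq, Complex.normSq_apply]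
  simp only [dot, Complex.mul_re, Complex.mul_im, Complex.I_re, Complex.I_im]
  linear_combination -(v.re * v.re + v.im * v.im) * h1

theorem Lev.net {φ : ℂ → ℝ} {f : ℂ → ℂ} {b η ρ δ : ℝ} (H : Lev φ f b η ρ) (U : Unif φ f b ρ δ) :
    ∃ C : ℝ, ∀ ε : ℝ, 0 < ε → ε ≤ 1 → ∃ S : Finset ℂ, (∀ x ∈ S, φ x = b) ∧
      (∀ z, φ z = b → ∃ x ∈ S, ‖z - x‖ ≤ ε) ∧ S.card * ε ≤ C := by
  classical
  obtain ⟨t, htL, htf, hcov⟩ := H.compact.finite_cover_balls U.hδ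
  lift t to Finset ℂ using htf
  refine ⟨t.card * 8, fun ε hε hε1 => ?_⟩
  have key : ∀ x ∈ t, ∃ S : Finset ℂ, (∀ y ∈ S, φ y = b ∧ ‖y - x‖ < δ) ∧
      (∀ z, φ z = b ∧ ‖z - x‖ < δ → ∃ y ∈ S, ‖z - y‖ ≤ ε) ∧ S.card * ε ≤ 8 := by
    intro x hx
    have hxL : φ x = b := htL hx
    have hx1 : 1 ≤ ‖f x‖ := H.big x (by linarith [H.hη])
    set ν := nu (f x) with hν
    have hν1 : ‖ν‖ = 1 := norm_nu hx1
    have hIν : ‖Complex.I * ν‖ = 1 := by rw [norm_mul, Complex.norm_I, hν1, one_mul]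
    have hxn := H.bdd x hxL.le
    refine net_one {z | φ z = b ∧ ‖z - x‖ < δ} (fun z => dot (Complex.I * ν) (z - x)) ?_ ?_ hε hε1
    · rintro z ⟨hz, hzx⟩
      refine (abs_dot_le _ _).trans ?_
      rw [hIν, one_mul]; linarith [U.hδ1]
    · rintro z ⟨hz, hzx⟩ z' ⟨hz', hzx'⟩
      rw [← dot_sub_right, sub_sub_sub_cancel_right]
      obtain ⟨s, hs, e⟩ := H.hφ.mvt z' z
      rw [hz, hz', sub_self] at e
      have hξ : ‖z' + s * (z - z') - x‖ < δ := by
        have hc := (convex_ball x δ).add_smul_sub_mem (x := z') (y := z)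
          (by rwa [mem_ball, dist_eq_norm]) (by rwa [mem_ball, dist_eq_norm]) (t := s)
          ⟨hs.1.le, hs.2.le⟩
        rw [mem_ball, dist_eq_norm] at hc
        simpa using hc
      set ξ := z' + s * (z - z') with hξd
      have hξn : ‖ξ‖ ≤ ρ + 1 := by
        have := norm_sub_norm_le ξ x
        linarith [U.hδ1]
      have h1 := U.unif ξ x hξn (by linarith) (by linarith [U.hδ])
      have h2 : dot (f x) (z - z') = - dot (f ξ - f x) (z - z') := by
        rw [dot_sub_left, ← e]; ring
      have h3 : |dot (f x) (z - z')| ≤ 1 / 10 * ‖z - z'‖ := by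
        rw [h2, abs_neg]
        exact (abs_dot_le _ _).trans (by gcongr)
      have e2 : ν = ((‖f x‖⁻¹ : ℝ) : ℂ) * f x := by
        have h0 : ‖f x‖ ≠ 0 := by linarith
        rw [hν, nu]; push_cast; field_simp
      have h4 : |dot ν (z - z')| ≤ 1 / 10 * ‖z - z'‖ := by
        rw [e2, dot_smul_left, abs_mul, abs_of_nonneg (by positivity)]
        have h6 : ‖f x‖⁻¹ ≤ 1 := inv_le_one_of_one_le₀ hx1
        have h7 : 0 ≤ ‖f x‖⁻¹ := by positivity
        nlinarith [abs_nonneg (dot (f x) (z - z'))]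
      have h5 := dot_sq_add ν (z - z') hν1
      have h6 : dot ν (z - z') ^ 2 ≤ (1 / 10 * ‖z - z'‖) ^ 2 := by
        rw [← sq_abs]; gcongr
      refine abs_le_of_sq_le_sq' ?_ (by positivity) |>.2
      rw [mul_pow, sq_abs]
      nlinarith [sq_nonneg ‖z - z'‖]
  choose! S hS1 hS2 hS3 using key
  refine ⟨t.biUnion S, ?_, ?_, ?_⟩
  · intro y hy
    obtain ⟨x, hx, hy⟩ := Finset.mem_biUnion.1 hy
    exact (hS1 x hx y hy).1
  · intro z hz
    have := hcov hz
    simp only [mem_iUnion, mem_ball, dist_eq_norm] at this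
    obtain ⟨x, hx, hzx⟩ := this
    obtain ⟨y, hy, hzy⟩ := hS2 x hx z ⟨hz, hzx⟩
    exact ⟨y, Finset.mem_biUnion.2 ⟨x, hx, hy⟩, hzy⟩
  · have h1 : ((t.biUnion S).card : ℝ) ≤ ∑ x ∈ t, ((S x).card : ℝ) := by
      exact_mod_cast Finset.card_biUnion_le
    calc ((t.biUnion S).card : ℝ) * ε ≤ (∑ x ∈ t, ((S x).card : ℝ)) * ε := by gcongr
      _ = ∑ x ∈ t, (S x).card * ε := Finset.sum_mul _ _ _
      _ ≤ ∑ x ∈ t, 8 := Finset.sum_le_sum fun x hx => hS3 x hx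
      _ = t.card * 8 := by rw [Finset.sum_const, nsmul_eq_mul]

/-- Poisson kernel as an element of C(L, ℂ) -/
def poisL (L : Set ℂ) (x : ℂ) (ε : ℝ) (hε : 0 < ε) : C(L, ℂ) :=
  ⟨fun z => ((1 / (ε ^ 2 + ‖(z:ℂ) - x‖ ^ 2) : ℝ) : ℂ), by
    refine Complex.continuous_ofReal.comp ?_
    refine continuous_const.div (by fun_prop) fun z => ?_
    positivity⟩

/-- Cauchy kernel -/
def cauL (L : Set ℂ) (f : ℂ → ℂ) (hf : Continuous f) (w : ℂ) (hw : w ∉ L) : C(L, ℂ) :=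
  ⟨fun z => f z * ((z:ℂ) - w)⁻¹, by
    refine (hf.comp continuous_subtype_val).mul (Continuous.inv₀ (by fun_prop) fun z h => hw ?_)
    rw [sub_eq_zero] at h
    rw [← h]; exact z.2⟩

section
variable {φ : ℂ → ℝ} {f : ℂ → ℂ} {b η ρ δ A : ℝ}

theorem Lev.cauchy_zero (H : Lev φ f b η ρ) [CompactSpace {z | φ z = b}]
    {m : C({z | φ z = b}, ℂ) →L[ℂ] ℂ}
    (hm : ∀ n : ℕ, m (resL {z | φ z = b} f H.hf * zetaL {z | φ z = b} ^ n) = 0) {w : ℂ} (hw : b < φ w) :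
    cauchyT {z | φ z = b} f H.hf m w = 0 := by
  have ho : IsOpen {x | b < φ x} := isOpen_lt continuous_const H.hφ.continuous
  have h1 : AnalyticOnNhd ℂ (cauchyT {z | φ z = b} f H.hf m) {x | b < φ x} := by
    refine DifferentiableOn.analyticOnNhd (cauchyT_diff.mono ?_) ho
    intro x hx hx2
    exact absurd (show b < φ x from hx) (by rw [show φ x = b from hx2]; exact lt_irrefl b)
  set r := max ‖zetaL {z | φ z = b}‖ ρ + 1 with hr
  have hr1 : ‖zetaL {z | φ z = b}‖ < r := by
    have := le_max_left ‖zetaL {z | φ z = b}‖ ρ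
    linarith
  have hr2 : ρ < r := by
    have := le_max_right ‖zetaL {z | φ z = b}‖ ρ
    linarith
  have hr0 : 0 ≤ r := by linarith [norm_nonneg (zetaL {z | φ z = b})]
  have hrn : ‖(r:ℂ)‖ = r := by rw [Complex.norm_real, Real.norm_of_nonneg hr0]
  have hz0 : (r:ℂ) ∈ {x | b < φ x} := by
    by_contra h
    have := H.bdd r (not_lt.1 h)
    linarith
  have hev : cauchyT {z | φ z = b} f H.hf m =ᶠ[nhds (r:ℂ)] 0 := by
    have : ∀ᶠ x in nhds (r:ℂ), ‖zetaL {z | φ z = b}‖ < ‖x‖ :=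
      (isOpen_lt continuous_const continuous_norm).mem_nhds (by
        change _ < ‖(r:ℂ)‖
        rw [hrn]; exact hr1)
    filter_upwards [this] with x hx
    exact cauchyT_far hm hx
  exact h1.eqOn_zero_of_preconnected_of_eventuallyEq_zero H.pre2 hz0 hev hw

theorem Lev.pois_re (H : Lev φ f b η ρ) (U : Unif φ f b ρ δ) (hA : ∀ x, ‖x‖ ≤ ρ + 1 → ‖f x‖ ≤ A)
    [CompactSpace {z | φ z = b}]
    {m : C({z | φ z = b}, ℂ) →L[ℂ] ℂ}
    (hpos : ∀ g : C({z | φ z = b}, ℂ), (∀ z, 0 ≤ (g z).re) → 0 ≤ (m g).re)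
    (hm : ∀ n : ℕ, m (resL {z | φ z = b} f H.hf * zetaL {z | φ z = b} ^ n) = 0)
    {x y : ℂ} {ε : ℝ} (hx : φ x = b) (hε : 0 < ε) (hεδ : ε ≤ δ / 2)
    (hxy : ‖x - y‖ ≤ ε) (hy1 : 1 ≤ ‖f y‖) (hw : φ (x - ε * nu (f y)) < b)
    (hw2 : b < φ (x + ε * nu (f y))) :
    ε / 2 * (m (poisL {z | φ z = b} x ε hε)).re - (1 / δ ^ 2 + 4 * A / δ ^ 2) * ε * (m 1).re ≤
      (cauchyT {z | φ z = b} f H.hf m (x - ε * nu (f y))).re := by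
  have h1 := H.cauchy_zero hm hw2
  have hn1 : x - ε * nu (f y) ∉ {z | φ z = b} := fun h => absurd hw (by rw [show φ _ = b from h]; exact lt_irrefl b)
  have hn2 : x + ε * nu (f y) ∉ {z | φ z = b} := fun h => absurd hw2 (by rw [show φ _ = b from h]; exact lt_irrefl b)
  rw [cauchyT_eq hn2 (cauL _ f H.hf _ hn2) (fun z => rfl)] at h1
  rw [cauchyT_eq hn1 (cauL _ f H.hf _ hn1) (fun z => rfl)]
  set c := (1 / δ ^ 2 + 4 * A / δ ^ 2) * ε with hc
  have h2 := hpos (cauL {z | φ z = b} f H.hf _ hn1 - cauL {z | φ z = b} f H.hf _ hn2 - ((ε / 2 : ℝ) : ℂ) • poisL {z | φ z = b} x ε hε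
    + (c : ℂ) • (1 : C({z | φ z = b}, ℂ))) (fun z => by
      have h3 := U.poisson H.hφ H.bdd hA hx z.2 hε hεδ hxy hy1
      rw [← hc] at h3
      simp only [ContinuousMap.add_apply, ContinuousMap.sub_apply, ContinuousMap.smul_apply, smul_eq_mul,
        ContinuousMap.one_apply, mul_one, Complex.add_re, Complex.sub_re, Complex.ofReal_re,
        Complex.re_ofReal_mul]
      rw [mul_sub, Complex.sub_re] at h3
      have e : (poisL {z | φ z = b} x ε hε z).re = 1 / (ε ^ 2 + ‖(z:ℂ) - x‖ ^ 2) := by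
        simp only [poisL, ContinuousMap.coe_mk, Complex.ofReal_re]
      rw [e]
      have e2 : ε / 2 * (1 / (ε ^ 2 + ‖(z:ℂ) - x‖ ^ 2)) = ε / (2 * (ε ^ 2 + ‖(z:ℂ) - x‖ ^ 2)) := by
        field_simp
      rw [e2]
      simp only [cauL, ContinuousMap.coe_mk]
      linarith)
  rw [map_add, map_sub, map_sub, map_smul, map_smul, h1] at h2
  simp only [smul_eq_mul, Complex.add_re, Complex.sub_re, Complex.re_ofReal_mul, Complex.zero_re] at h2
  linarith

theorem Lev.pois_bound (H : Lev φ f b η ρ) (U : Unif φ f b ρ δ) 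
    (hA : ∀ x, ‖x‖ ≤ ρ + 1 → ‖f x‖ ≤ A) (hA0 : 0 ≤ A)
    [CompactSpace {z | φ z = b}]
    {m : C({z | φ z = b}, ℂ) →L[ℂ] ℂ}
    (hpos : ∀ g : C({z | φ z = b}, ℂ), (∀ z, 0 ≤ (g z).re) → 0 ≤ (m g).re)
    (hm : ∀ n : ℕ, m (resL {z | φ z = b} f H.hf * zetaL {z | φ z = b} ^ n) = 0)
    (hneg : ∀ g : C({z | φ z = b}, ℂ), (∀ z : {z | φ z = b}, g z = f z / z) → (m g).re ≤ 0)
    {x : ℂ} {ε : ℝ} (hx : φ x = b) (hε : 0 < ε) (hεδ : ε ≤ δ / 2) :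
    (m (poisL {z | φ z = b} x ε hε)).re ≤ 2 * (1 / δ ^ 2 + 4 * A / δ ^ 2) * (m 1).re := by
  have hδ := U.hδ
  have hδ1 := U.hδ1
  set F := cauchyT {z | φ z = b} f H.hf m with hF
  set K := 1 / δ ^ 2 + 4 * A / δ ^ 2 with hK
  have hK0 : 0 ≤ K := by positivity
  set M := (m 1).re with hM
  have hM0 : 0 ≤ M := hpos 1 fun z => by simp
  have hpp : ∀ x ε (hε : 0 < ε), 0 ≤ (m (poisL {z | φ z = b} x ε hε)).re := by
    intro x ε hε
    refine hpos _ fun z => ?_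
    simp only [poisL, ContinuousMap.coe_mk, Complex.ofReal_re]
    positivity
  -- step 3
  have s3 : ∀ w, φ w < b → b - φ w ≤ η → (b - φ w) * (10 / 9) ≤ δ / 2 →
      - (K * ((b - φ w) * (10 / 9)) * M) ≤ (F w).re := by
    intro w hw hw1 hw2
    have hfw : 1 ≤ ‖f w‖ := H.big w (by linarith)
    have hwn := H.bdd w hw.le
    set t0 := (b - φ w) * (10 / 9) with ht0
    have ht0p : 0 < t0 := by rw [ht0]; linarith
    set ν := nu (f w) with hν
    have hν1 : ‖ν‖ = 1 := norm_nu hfw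
    have hnt : ∀ t : ℝ, 0 ≤ t → ‖(t:ℂ) * ν‖ = t := fun t ht => by
      rw [norm_mul, hν1, mul_one, Complex.norm_real, Real.norm_of_nonneg ht]
    have h1 : φ w + 9 / 10 * t0 ≤ φ (w + t0 * ν) := by
      refine U.slope H.hφ (r := t0) (by linarith) hfw ht0p (by linarith) ?_ ?_
      · rw [sub_self, norm_zero]; exact ht0p.le
      · rw [add_sub_cancel_left, hnt _ ht0p.le]
    have hcont : Continuous (fun t : ℝ => φ (w + t * ν)) := H.hφ.continuous.comp (by fun_prop)
    obtain ⟨ε, ⟨he0, he1⟩, he⟩ := intermediate_value_Icc ht0p.le hcont.continuousOn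
      (show b ∈ Icc (φ (w + ((0:ℝ):ℂ) * ν)) (φ (w + (t0:ℂ) * ν)) by
        constructor
        · simpa using hw.le
        · refine le_trans ?_ h1; rw [ht0]; linarith)
    simp only at he
    have hep : 0 < ε := by
      refine lt_of_le_of_ne he0 fun h => ?_
      rw [← h] at he; simp at he; linarith
    have hx2 : b < φ (w + ε * ν + ε * ν) := by
      have h2 : φ (w + ε * ν) + 9 / 10 * ε ≤ φ (w + ε * ν + ε * ν) := by
        refine U.slope H.hφ (r := 2 * ε) (by linarith) hfw hep (by linarith) ?_ ?_
        · rw [add_sub_cancel_left, hnt _ he0]; linarith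
        · rw [show w + ε * ν + ε * ν - w = ((2 * ε : ℝ) : ℂ) * ν by push_cast; ring, hnt _ (by linarith)]
      rw [he] at h2; linarith
    have h3 := H.pois_re U hA hpos hm (x := w + ε * ν) (y := w) he hep (by linarith)
      (by rw [add_sub_cancel_left, hnt _ he0]) hfw (by rw [← hν, add_sub_cancel_right]; exact hw) hx2
    rw [← hν, add_sub_cancel_right, ← hF, ← hK, ← hM] at h3
    have h4 := hpp (w + ε * ν) ε hep
    have h5 : K * ε * M ≤ K * t0 * M := by gcongr
    have h6 : 0 ≤ ε / 2 * (m (poisL {z | φ z = b} (w + ε * ν) ε hep)).re := by positivity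
    linarith
  have hOm : IsOpen {z | φ z < b} := isOpen_lt H.hφ.continuous continuous_const
  have hdiff : DifferentiableOn ℂ F {z | φ z < b} := cauchyT_diff.mono fun z hz hz2 => by
    exact absurd (show φ z < b from hz) (by rw [show φ z = b from hz2]; exact lt_irrefl b)
  -- step 5
  have s5 : ∀ w, φ w < b → 0 ≤ (F w).re := by
    intro w hw
    have hσ : ∀ σ : ℝ, 0 < σ → σ < b - φ w → σ ≤ η → σ * (10 / 9) ≤ δ / 2 →
        - (K * (σ * (10 / 9)) * M) ≤ (F w).re := by
      intro σ hσ0 hσ1 hσ2 hσ3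
      have hcl : closure {z | φ z < b - σ} ⊆ {z | φ z ≤ b - σ} :=
        closure_minimal (fun z (hz : φ z < b - σ) => (show φ z ≤ b - σ from le_of_lt hz)) (isClosed_le H.hφ.continuous continuous_const)
      have hd : DiffContOnCl ℂ (fun z => Complex.exp (-F z)) {z | φ z < b - σ} := by
        refine DifferentiableOn.diffContOnCl ?_
        refine (DifferentiableOn.cexp (hdiff.neg)).mono fun z hz => ?_
        have := hcl hz
        simp only [mem_ofPred_eq] at this ⊢
        linarith
      have hbd : Bornology.IsBounded {z | φ z < b - σ} := by
        refine (isBounded_ball (x := (0:ℂ)) (r := ρ)).subset fun z hz => ?_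
        rw [mem_ball_zero_iff]
        exact H.bdd z (by simp only [mem_ofPred_eq] at hz; linarith)
      have := Complex.norm_le_of_forall_mem_frontier_norm_le hbd hd (C := Real.exp (K * (σ * (10 / 9)) * M))
        (fun z hz => ?_) (z := w) (subset_closure (by simp only [mem_ofPred_eq]; linarith))
      · rw [Complex.norm_exp, Real.exp_le_exp, Complex.neg_re] at this
        linarith
      · have hz := frontier_lt_subset_eq H.hφ.continuous continuous_const hz
        simp only [mem_ofPred_eq] at hz
        have e : b - φ z = σ := by rw [hz]; ring
        have := s3 z (by linarith) (by linarith) (by rw [e]; exact hσ3)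
        rw [e] at this
        rw [Complex.norm_exp, Real.exp_le_exp, Complex.neg_re]
        linarith
    by_contra hlt
    push Not at hlt
    set c := K * (10 / 9) * M with hc
    have hc0 : 0 ≤ c := by positivity
    have hη := H.hη
    set σ := min (min ((b - φ w) / 2) η) (min (δ / 4) (-(F w).re / (2 * (c + 1)))) with hσd
    have a1 : σ ≤ (b - φ w) / 2 := (min_le_left _ _).trans (min_le_left _ _)
    have a2 : σ ≤ η := (min_le_left _ _).trans (min_le_right _ _)
    have a3 : σ ≤ δ / 4 := (min_le_right _ _).trans (min_le_left _ _)
    have a4 : σ ≤ -(F w).re / (2 * (c + 1)) := (min_le_right _ _).trans (min_le_right _ _)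
    have a0 : 0 < σ := by
      have p1 : 0 < (b - φ w) / 2 := by linarith
      have p2 : 0 < -(F w).re / (2 * (c + 1)) := div_pos (by linarith) (by linarith)
      exact lt_min (lt_min p1 hη) (lt_min (by linarith) p2)
    have h1 := hσ σ a0 (by linarith) a2 (by linarith)
    rw [le_div_iff₀ (by linarith)] at a4
    have h2 : K * (σ * (10 / 9)) * M = c * σ := by rw [hc]; ring
    rw [h2] at h1
    nlinarith
  -- step 6
  have s6 : (F 0).re ≤ 0 := by
    have h0 : (0:ℂ) ∉ {z | φ z = b} := fun h => absurd H.zero (by rw [show φ 0 = b from h]; exact lt_irrefl b)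
    rw [hF, cauchyT_eq h0 (cauL _ f H.hf _ h0) (fun z => rfl)]
    refine hneg _ fun z => ?_
    simp only [cauL, ContinuousMap.coe_mk, sub_zero, div_eq_mul_inv]
  have s7 : ∀ w, φ w < b → (F w).re = 0 := by
    intro w hw
    have hmax : IsMaxOn (norm ∘ fun z => Complex.exp (-F z)) {z | φ z < b} 0 := by
      intro z hz
      simp only [mem_ofPred_eq, Function.comp, Complex.norm_exp, Real.exp_le_exp, Complex.neg_re]
      have := s5 z hz
      linarith
    have := Complex.norm_eqOn_of_isPreconnected_of_isMaxOn H.pre1 hOm (DifferentiableOn.cexp hdiff.neg) H.zero hmax hw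
    simp only [Function.comp, Complex.norm_exp, Function.const, Pi.neg_apply, Complex.neg_re] at this
    have h1 := Real.exp_injective this
    have := s5 w hw
    linarith
  -- step 4
  have hx1 : 1 ≤ ‖f x‖ := H.big x (by linarith [H.hη])
  have hxn := H.bdd x hx.le
  set ν := nu (f x) with hν
  have hν1 : ‖ν‖ = 1 := norm_nu hx1
  have hnt : ‖(ε:ℂ) * ν‖ = ε := by
    rw [norm_mul, hν1, mul_one, Complex.norm_real, Real.norm_of_nonneg hε.le]
  have h1 : φ x + 9 / 10 * ε ≤ φ (x + ε * ν) := by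
    refine U.slope H.hφ (r := ε) (by linarith) hx1 hε (by linarith) ?_ ?_
    · rw [sub_self, norm_zero]; exact hε.le
    · rw [add_sub_cancel_left, hnt]
  have h2 : φ (x - ε * ν) + 9 / 10 * ε ≤ φ (x - ε * ν + ε * ν) := by
    refine U.slope H.hφ (r := ε) (by linarith) hx1 hε (by linarith) ?_ ?_
    · rw [sub_sub_cancel_left, norm_neg, hnt]
    · rw [sub_add_cancel, sub_self, norm_zero]; exact hε.le
  rw [sub_add_cancel] at h2
  have hw : φ (x - ε * ν) < b := by linarith
  have h3 := H.pois_re U hA hpos hm (x := x) (y := x) hx hε hεδ (by rw [sub_self, norm_zero]; exact hε.le) hx1 hw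
    (by linarith)
  rw [← hF, ← hν, s7 _ hw, ← hK, ← hM] at h3
  have h4 : ε * ((m (poisL {z | φ z = b} x ε hε)).re) ≤ ε * (2 * K * M) := by linarith
  exact le_of_mul_le_mul_left h4 hε

theorem Lev.poly (H : Lev φ f b η ρ) :
    ∃ P : Polynomial ℂ, ∀ z, φ z = b → 0 < ((1 / z + P.derivative.eval z) * f z).re := by
  by_contra hno
  have hcs : CompactSpace {z | φ z = b} := isCompact_iff_compactSpace.1 H.compact
  have h0 : (0:ℂ) ∉ {z | φ z = b} := fun h => absurd H.zero (by rw [show φ 0 = b from h]; exact lt_irrefl b)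
  obtain ⟨m, hpos, hM, hm, hneg⟩ := separation {z | φ z = b} h0 f H.hf hno
  obtain ⟨δ, U⟩ := Unif.exists (φ := φ) H.hf b ρ
  obtain ⟨A, hA⟩ := ((isCompact_closedBall (0:ℂ) (ρ + 1)).image H.hf).isBounded.exists_norm_le
  have hA' : ∀ x, ‖x‖ ≤ ρ + 1 → ‖f x‖ ≤ max A 0 := fun x hx =>
    (hA _ (mem_image_of_mem _ (by rwa [mem_closedBall_zero_iff]))).trans (le_max_left _ _)
  obtain ⟨C, hC⟩ := H.net U
  set M := (m 1).re with hMd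
  set K := 2 * (1 / δ ^ 2 + 4 * (max A 0) / δ ^ 2) * M with hK
  have hδ := U.hδ
  have hK0 : 0 ≤ K := by have := le_max_right A 0; positivity
  have hb : ∀ ε, 0 < ε → ε ≤ δ / 2 → M ≤ 2 * ε * (C * K) := by
    intro ε hε hε1
    obtain ⟨S, hS1, hS2, hS3⟩ := hC ε hε (by linarith [U.hδ1])
    have h1 := hpos (((2 * ε ^ 2 : ℝ) : ℂ) • (∑ x ∈ S, poisL {z | φ z = b} x ε hε) - 1) (fun z => by
      simp only [ContinuousMap.sub_apply, ContinuousMap.smul_apply, smul_eq_mul, ContinuousMap.one_apply,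
        Complex.sub_re, Complex.re_ofReal_mul, Complex.one_re, ContinuousMap.sum_apply, Complex.re_sum]
      obtain ⟨x, hx, hzx⟩ := hS2 z z.2
      have h2 : (poisL {z | φ z = b} x ε hε z).re ≤ ∑ x ∈ S, (poisL {z | φ z = b} x ε hε z).re := by
        refine Finset.single_le_sum (f := fun x => (poisL {z | φ z = b} x ε hε z).re) (fun y _ => ?_) hx
        simp only [poisL, ContinuousMap.coe_mk, Complex.ofReal_re]
        positivity
      have h3 : 1 / (2 * ε ^ 2) ≤ (poisL {z | φ z = b} x ε hε z).re := by
        simp only [poisL, ContinuousMap.coe_mk, Complex.ofReal_re]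
        apply one_div_le_one_div_of_le (by positivity)
        have : ‖(z:ℂ) - x‖ ^ 2 ≤ ε ^ 2 := by gcongr
        linarith
      have h4 : 2 * ε ^ 2 * (1 / (2 * ε ^ 2)) ≤ 2 * ε ^ 2 * ∑ x ∈ S, (poisL {z | φ z = b} x ε hε z).re := by
        gcongr; exact h3.trans h2
      rw [mul_one_div_cancel (by positivity)] at h4
      linarith)
    rw [map_sub, map_smul, map_sum, Complex.sub_re, smul_eq_mul, Complex.re_ofReal_mul, Complex.re_sum, ← hMd] at h1
    have h2 : ∑ x ∈ S, (m (poisL {z | φ z = b} x ε hε)).re ≤ ∑ x ∈ S, K :=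
      Finset.sum_le_sum fun x hx => H.pois_bound U hA' (le_max_right _ _) hpos hm hneg (hS1 x hx) hε hε1
    rw [Finset.sum_const, nsmul_eq_mul] at h2
    have h3 : 2 * ε ^ 2 * ∑ x ∈ S, (m (poisL {z | φ z = b} x ε hε)).re ≤ 2 * ε ^ 2 * (S.card * K) := by gcongr
    have h4 : 2 * ε ^ 2 * (S.card * K) = 2 * ε * ((S.card * ε) * K) := by ring
    have h5 : 2 * ε * ((S.card * ε) * K) ≤ 2 * ε * (C * K) := by gcongr
    linarith
  have hCK : 0 < C * K := by
    have := hb (δ / 2) (by linarith) le_rfl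
    by_contra h
    push Not at h
    nlinarith
  have := hb (min (δ / 2) (M / (4 * (C * K)))) (by apply lt_min <;> positivity) (min_le_left _ _)
  have h2 : 2 * min (δ / 2) (M / (4 * (C * K))) * (C * K) ≤ 2 * (M / (4 * (C * K))) * (C * K) := by
    gcongr; exact min_le_right _ _
  have h3 : 2 * (M / (4 * (C * K))) * (C * K) = M / 2 := by
    have := hCK.ne'
    generalize C * K = q at this
    field_simp
    norm_num
  linarith

end

/-- the polynomial 1 + X P' -/
def hpol (P : Polynomial ℂ) : Polynomial ℂ := 1 + Polynomial.X * P.derivative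

theorem hpol_eval (P : Polynomial ℂ) (z : ℂ) : (hpol P).eval z = 1 + z * P.derivative.eval z := by
  simp [hpol]

theorem hpol_zero (P : Polynomial ℂ) : (hpol P).eval 0 = 1 := by
  simp [hpol]

/-- the field V -/
def Vf (P : Polynomial ℂ) (z : ℂ) : ℂ := (starRingEnd ℂ) ((hpol P).eval z) * z

theorem continuous_Vf (P : Polynomial ℂ) : Continuous (Vf P) :=
  (Complex.continuous_conj.comp (hpol P).continuous).mul continuous_id

theorem dot_Vf {P : Polynomial ℂ} {z w : ℂ} (hz : z ≠ 0)
    (h : 0 < ((1 / z + P.derivative.eval z) * w).re) : 0 < dot (Vf P z) w := by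
  have e : dot (Vf P z) w = ‖z‖ ^ 2 * ((1 / z + P.derivative.eval z) * w).re := by
    have e1 : dot (Vf P z) w = (w * (starRingEnd ℂ) (Vf P z)).re := (mul_conj_nu_re _ _).symm
    rw [e1, ← Complex.re_ofReal_mul]
    congr 1
    rw [Vf, map_mul, Complex.conj_conj, hpol_eval]
    have h2 : ((‖z‖ ^ 2 : ℝ) : ℂ) = z * (starRingEnd ℂ) z := by
      rw [Complex.mul_conj, Complex.normSq_eq_norm_sq]
    rw [h2]
    field_simp
  rw [e]
  have : 0 < ‖z‖ := norm_pos_iff.2 hz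
  positivity

theorem CDeg.deg_Vf (D : CDeg) (P : Polynomial ℂ) {Ω : Set ℂ} (ho : IsOpen Ω) (hb : Bornology.IsBounded Ω)
    (h0 : (0:ℂ) ∈ Ω) (hfr : ∀ z ∈ closure Ω, z ∉ Ω → Vf P z ≠ 0) (hd : D.deg (Vf P) Ω = 1) :
    ∀ z ∈ Ω, (hpol P).eval z ≠ 0 := by
  classical
  have hp0 : hpol P ≠ 0 := by
    intro h; have := hpol_zero P; rw [h] at this; simp at this
  set T : Finset ℂ := (hpol P).roots.toFinset.filter (fun z => z ∈ Ω) with hT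
  have hTm : ∀ z, z ∈ T ↔ (hpol P).eval z = 0 ∧ z ∈ Ω := by
    intro z
    rw [hT, Finset.mem_filter, Multiset.mem_toFinset, Polynomial.mem_roots hp0, Polynomial.IsRoot.def]
  have h0T : (0:ℂ) ∉ T := by
    rw [hTm, hpol_zero]; simp
  have key := D.deg_sum (insert 0 T) (Vf P) Ω ho hb (continuous_Vf P).continuousOn
    (by
      intro z hz
      rcases Finset.mem_insert.1 (Finset.mem_coe.1 hz) with h | h
      · rw [h]; exact h0
      · exact ((hTm z).1 h).2)
    (by
      intro z hz hV
      have hzO : z ∈ Ω := by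
        by_contra h
        exact hfr z hz h hV
      rcases mul_eq_zero.1 hV with h | h
      · rw [map_eq_zero] at h
        exact Finset.mem_insert_of_mem ((hTm z).2 ⟨h, hzO⟩)
      · rw [h]; exact Finset.mem_insert_self _ _)
    (fun a => if a = 0 then 1 else -((hpol P).rootMultiplicity a : ℤ))
    (by
      intro a ha
      by_cases ha0 : a = 0
      · subst ha0
        rw [if_pos rfl]
        obtain ⟨ε₀, h1, h2⟩ := D.deg_local (k := fun z => (starRingEnd ℂ) ((hpol P).eval z))
          (G := fun z => z - 0) (a := 0) (n := 1)
          (Complex.continuous_conj.comp (hpol P).continuous).continuousAt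
          (by rw [hpol_zero]; simp) (by fun_prop) (by simp) (fun ε hε => D.deg_sub 0 hε) univ_mem
          (Complex.continuous_conj.comp (hpol P).continuous).continuousOn
        refine ⟨ε₀, h1, fun ε hε hε' => ?_⟩
        rw [← h2 ε hε hε']
        congr 1
        funext z
        simp [Vf]
      · rw [if_neg ha0]
        obtain ⟨q, hq1, hq2⟩ := Polynomial.exists_eq_pow_rootMultiplicity_mul_and_not_dvd (hpol P) hp0 a
        set n := (hpol P).rootMultiplicity a with hn
        have hqa : q.eval a ≠ 0 := by
          intro h; exact hq2 (Polynomial.dvd_iff_isRoot.2 h)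
        have hkc : Continuous (fun z => z * (starRingEnd ℂ) (q.eval z)) :=
          continuous_id.mul (Complex.continuous_conj.comp q.continuous)
        have hG0 : ∀ z : ℂ, (starRingEnd ℂ) ((z - a) ^ n) = 0 → z = a := by
          intro z hz
          rw [map_eq_zero] at hz
          exact sub_eq_zero.1 (eq_zero_of_pow_eq_zero hz)
        obtain ⟨ε₀, h1, h2⟩ := D.deg_local (k := fun z => z * (starRingEnd ℂ) (q.eval z))
          (G := fun z => (starRingEnd ℂ) ((z - a) ^ n)) (a := a) (n := -n) hkc.continuousAt
          (by
            simp only [ne_eq, mul_eq_zero, map_eq_zero, not_or]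
            exact ⟨ha0, hqa⟩) (by fun_prop) hG0 (fun ε hε => D.deg_conj_pow n a ε hε) univ_mem
          hkc.continuousOn
        refine ⟨ε₀, h1, fun ε hε hε' => ?_⟩
        rw [← h2 ε hε hε']
        congr 1
        funext z
        rw [Vf, hq1]
        simp
        ring)
  rw [hd, Finset.sum_insert h0T, if_pos rfl] at key
  have h1 : ∑ a ∈ T, (if a = 0 then (1:ℤ) else -((hpol P).rootMultiplicity a : ℤ)) =
      - ∑ a ∈ T, ((hpol P).rootMultiplicity a : ℤ) := by
    rw [← Finset.sum_neg_distrib]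
    refine Finset.sum_congr rfl fun a ha => if_neg ?_
    intro h; rw [h] at ha; exact h0T ha
  rw [h1] at key
  intro z hz hpz
  have hzT : z ∈ T := (hTm z).2 ⟨hpz, hz⟩
  have h2 : ((hpol P).rootMultiplicity z : ℤ) ≤ ∑ a ∈ T, ((hpol P).rootMultiplicity a : ℤ) :=
    Finset.single_le_sum (f := fun a => ((hpol P).rootMultiplicity a : ℤ)) (fun _ _ => by positivity) hzT
  have h3 : 0 < (hpol P).rootMultiplicity z := (Polynomial.rootMultiplicity_pos hp0).2 hpz
  omega

theorem PG.poly {D : CDeg} {φ : ℂ → ℝ} {f : ℂ → ℂ} {b η ρ : ℝ} (G : PG D φ f) (H : Lev φ f b η ρ) :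
    ∃ P : Polynomial ℂ, P.eval 0 = 0 ∧ (∀ z, φ z = b → 0 < dot (Vf P z) (f z)) ∧
      ∀ z, φ z ≤ b → (hpol P).eval z ≠ 0 := by
  obtain ⟨P₀, hP₀⟩ := H.poly
  set P := P₀ - Polynomial.C (P₀.eval 0) with hP
  have hPd : P.derivative = P₀.derivative := by simp [hP]
  have h1 : ∀ z, φ z = b → 0 < dot (Vf P z) (f z) := by
    intro z hz
    refine dot_Vf ?_ (by rw [hPd]; exact hP₀ z hz)
    intro h; rw [h] at hz; exact absurd H.zero (by rw [hz]; exact lt_irrefl b)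
  have h1' : ∀ z, φ z = b → Vf P z ≠ 0 := by
    intro z hz h
    have := h1 z hz
    rw [h] at this; simp [dot] at this
  have hφc := H.hφ.continuous
  have ho : IsOpen {z | φ z < b} := isOpen_lt hφc continuous_const
  have hbd : Bornology.IsBounded {z | φ z < b} := by
    refine (isBounded_ball (x := (0:ℂ)) (r := ρ)).subset fun z (hz : φ z < b) => ?_
    rw [mem_ball_zero_iff]
    exact H.bdd z hz.le
  have hcl : closure {z | φ z < b} ⊆ {z | φ z ≤ b} :=
    closure_minimal (fun z (hz : φ z < b) => (show φ z ≤ b from le_of_lt hz)) (isClosed_le hφc continuous_const)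
  have hρ : 0 < ρ := by simpa using H.bdd 0 H.zero.le
  have hf0 : ∀ x, b ≤ φ x → f x ≠ 0 := by
    intro x hx h
    have := H.big x (by linarith [H.hη])
    rw [h, norm_zero] at this; linarith
  have hd1 : D.deg f {z | φ z < b} = 1 := by
    rw [← G.deg ρ hρ (fun x hx => hf0 x (by
      by_contra h
      push Not at h
      exact absurd (H.bdd x h.le) (not_lt.2 hx)))]
    refine (D.excision isOpen_ball isBounded_ball ho ?_ G.hf.continuousOn ?_).symm
    · intro z (hz : φ z < b)
      rw [mem_ball_zero_iff]; exact H.bdd z hz.le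
    · intro z _ hz
      exact hf0 z (not_lt.1 hz)
  have hd2 : D.deg (Vf P) {z | φ z < b} = 1 := by
    rw [← hd1]
    refine D.of_inner_pos ho hbd (continuous_Vf P).continuousOn G.hf.continuousOn fun z hz => ?_
    exact h1 z (frontier_lt_subset_eq hφc continuous_const hz)
  have h2 := D.deg_Vf P ho hbd H.zero (fun z hz hz2 => h1' z (le_antisymm (hcl hz) (not_lt.1 hz2))) hd2
  refine ⟨P, by simp [hP], h1, fun z hz => ?_⟩
  rcases lt_or_eq_of_le hz with h | h
  · exact h2 z h
  · intro h3
    apply h1' z h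
    rw [Vf, h3, map_zero, zero_mul]

theorem hasGradientAt_of {φ : ℂ → ℝ} {w z : ℂ} {l : ℂ →L[ℝ] ℝ} (h : HasFDerivAt φ l z)
    (hl : ∀ v, l v = dot w v) : HasGradientAt φ w z := by
  rw [hasGradientAt_iff_hasFDerivAt]
  refine h.congr_fderiv ?_
  apply ContinuousLinearMap.ext
  intro v
  rw [hl, InnerProductSpace.toDual_apply_apply, inner_eq_dot]

/-- the model potential -/
def Qp (P : Polynomial ℂ) (z : ℂ) : ℝ := ‖z‖ ^ 2 * (1 / 2) * Real.exp (2 * (P.eval z).re)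

theorem hasGrad_Qp (P : Polynomial ℂ) :
    HasGrad (Qp P) (fun z => ((Real.exp (2 * (P.eval z).re) : ℝ) : ℂ) * Vf P z) := by
  intro z
  have h1 : HasFDerivAt (fun z => P.eval z) ((ContinuousLinearMap.toSpanSingleton ℂ (P.derivative.eval z)).restrictScalars ℝ) z :=
    (P.hasDerivAt z).hasFDerivAt.restrictScalars ℝ
  have h2 : HasFDerivAt (fun z => (P.eval z).re) (Complex.reCLM.comp ((ContinuousLinearMap.toSpanSingleton ℂ (P.derivative.eval z)).restrictScalars ℝ)) z :=
    Complex.reCLM.hasFDerivAt.comp z h1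
  have h3 := (h2.const_mul 2).exp
  have h4 : HasFDerivAt (fun z : ℂ => ‖z‖ ^ 2) (2 • innerSL ℝ z) z := (hasStrictFDerivAt_norm_sq z).hasFDerivAt
  have h5 := ((h4.mul_const (1 / 2)).fun_mul h3)
  refine hasGradientAt_of h5 fun v => ?_
  have hs : ‖z‖ ^ 2 = z.re ^ 2 + z.im ^ 2 := by
    rw [Complex.sq_norm, Complex.normSq_apply]; ring
  have hi : (innerSL ℝ z) v = dot z v := inner_eq_dot z v
  rw [dot_smul_left, hs]
  simp [hi, Vf, hpol_eval, dot]
  ring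

theorem exists_cutoff {a b : ℝ} (hab : a < b) : ∃ χ χ' : ℝ → ℝ, (∀ s, HasDerivAt χ (χ' s) s) ∧
    Continuous χ' ∧ (∀ s, 0 ≤ χ' s) ∧ (∀ s, 0 ≤ χ s) ∧ (∀ s, χ s ≤ 1) ∧
    (∀ s, s ≤ a → χ s = 0 ∧ χ' s = 0) ∧ (∀ s, b ≤ s → χ s = 1 ∧ χ' s = 0) := by
  set χ : ℝ → ℝ := fun s => Real.smoothTransition ((s - a) / (b - a)) with hχ
  have hba : 0 < b - a := by linarith
  have hc : ContDiff ℝ 1 χ := by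
    refine ContDiff.comp (g := Real.smoothTransition) (Real.smoothTransition.contDiff (n := 1)) ?_
    exact (contDiff_id.sub contDiff_const).div_const _
  have hd : Differentiable ℝ χ := hc.differentiable one_ne_zero
  have hmono : Monotone χ := by
    intro s t hst
    apply Real.smoothTransition.monotone
    gcongr
  have h0 : ∀ s, 0 ≤ χ s := fun s => Real.smoothTransition.nonneg _
  have h1 : ∀ s, χ s ≤ 1 := fun s => Real.smoothTransition.le_one _
  have hl : ∀ s, s ≤ a → χ s = 0 := fun s hs =>
    Real.smoothTransition.zero_of_nonpos (div_nonpos_of_nonpos_of_nonneg (by linarith) hba.le)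
  have hr : ∀ s, b ≤ s → χ s = 1 := fun s hs =>
    Real.smoothTransition.one_of_one_le (by rw [le_div_iff₀ hba]; linarith)
  refine ⟨χ, deriv χ, fun s => (hd s).hasDerivAt, hc.continuous_deriv le_rfl, fun s => ?_, h0, h1,
    fun s hs => ⟨hl s hs, ?_⟩, fun s hs => ⟨hr s hs, ?_⟩⟩
  · have := (hmono.monotoneOn univ).derivWithin_nonneg (x := s)
    rwa [derivWithin_univ] at this
  · refine IsLocalMin.deriv_eq_zero (Eventually.of_forall fun t => ?_)
    rw [hl s hs]; exact h0 t
  · refine IsLocalMax.deriv_eq_zero (Eventually.of_forall fun t => ?_)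
    rw [hr s hs]; exact h1 t

theorem glue {φ : ℂ → ℝ} {f : ℂ → ℂ} {b : ℝ} {P : Polynomial ℂ} (hφ : HasGrad φ f) (hf : Continuous f)
    (hK : IsCompact {z | φ z ≤ b}) (hzero : φ 0 < b) (hV : ∀ z, φ z = b → 0 < dot (Vf P z) (f z))
    (hh : ∀ z, φ z ≤ b → (hpol P).eval z ≠ 0) (hP0 : P.eval 0 = 0) (hf0 : ∀ z, b ≤ φ z → f z ≠ 0) :
    ∃ (φ' : ℂ → ℝ) (k : ℂ → ℂ), HasGrad φ' (fun z => z * k z) ∧ Continuous k ∧ k 0 = 1 ∧ (∀ z, k z ≠ 0) ∧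
      ∀ z, b ≤ φ z → z * k z = f z := by
  have hφc := hφ.continuous
  have hdc : Continuous (fun z => dot (Vf P z) (f z)) := by
    have := continuous_Vf P
    unfold dot
    fun_prop
  obtain ⟨δ, hδ, hcol⟩ : ∃ δ > 0, ∀ z, b - δ ≤ φ z → φ z ≤ b → 0 < dot (Vf P z) (f z) := by
    have hK0 : IsCompact ({z | φ z ≤ b} ∩ {z | dot (Vf P z) (f z) ≤ 0}) :=
      hK.inter_right (isClosed_le hdc continuous_const)
    obtain ⟨z0, ⟨hz0, hz0'⟩, hmax⟩ := hK0.exists_isMaxOn ⟨0, hzero.le, by simp [Vf, dot]⟩ hφc.continuousOn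
    have hz0 : φ z0 ≤ b := hz0
    have hz0' : dot (Vf P z0) (f z0) ≤ 0 := hz0'
    have hlt : φ z0 < b := lt_of_le_of_ne hz0 fun h => absurd (hV z0 h) (not_lt.2 hz0')
    refine ⟨(b - φ z0) / 2, by linarith, fun z h1 h2 => ?_⟩
    by_contra h3
    have : φ z ≤ φ z0 := hmax ⟨h2, not_lt.1 h3⟩
    linarith
  obtain ⟨C, hC⟩ : ∃ C, ∀ z, φ z ≤ b → Qp P z - φ z ≤ C := by
    have hc : Continuous (fun z => Qp P z - φ z) := (hasGrad_Qp P).continuous.sub hφc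
    obtain ⟨C, hC⟩ := hK.bddAbove_image hc.continuousOn
    exact ⟨C, fun z hz => hC (mem_image_of_mem _ hz)⟩
  have hz0 : φ 0 < b - δ := by
    by_contra h
    have := hcol 0 (not_lt.1 h) hzero.le
    simp [Vf, dot] at this
  obtain ⟨χ, χ', hχd, hχ'c, hχ'0, hχ0, hχ1, hχl, hχr⟩ := exists_cutoff (show b - δ < b by linarith)
  have hχc : Continuous χ := continuous_iff_continuousAt.2 fun s => (hχd s).continuousAt
  set E : ℂ → ℂ := fun z => ((Real.exp (2 * (P.eval z).re) : ℝ) : ℂ) * (starRingEnd ℂ) ((hpol P).eval z) with hE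
  have hEc : Continuous E := by
    have h1 : Continuous (fun z => P.eval z) := P.continuous
    have h2 : Continuous (fun z => (hpol P).eval z) := (hpol P).continuous
    exact (Complex.continuous_ofReal.comp (by fun_prop)).mul (Complex.continuous_conj.comp h2)
  set c : ℂ → ℝ := fun z => χ (φ z) + χ' (φ z) * (φ z + C - Qp P z) with hcd
  have hcc : Continuous c := by
    have := (hasGrad_Qp P).continuous
    fun_prop
  set k : ℂ → ℂ := fun z => ((1 - χ (φ z) : ℝ) : ℂ) * E z + ((c z : ℝ) : ℂ) * (f z / z) with hk
  have hEV : ∀ z, z * E z = ((Real.exp (2 * (P.eval z).re) : ℝ) : ℂ) * Vf P z := fun z => by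
    rw [hE, Vf]; ring
  have hlow : ∀ z, φ z ≤ b - δ → k z = E z := by
    intro z hz
    obtain ⟨h1, h2⟩ := hχl _ hz
    simp [hk, hcd, h1, h2]
  have hzk : ∀ z, z * k z = ((1 - χ (φ z) : ℝ) : ℂ) * (z * E z) + ((c z : ℝ) : ℂ) * f z := by
    intro z
    by_cases h : z = 0
    · subst h
      obtain ⟨h1, h2⟩ := hχl _ hz0.le
      simp [hcd, h1, h2]
    · rw [hk]; field_simp
  have hE0 : E 0 = 1 := by simp [hE, hP0, hpol_zero]
  have hk0 : k 0 = 1 := by rw [hlow 0 hz0.le, hE0]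
  refine ⟨fun z => (1 - χ (φ z)) * Qp P z + χ (φ z) * (φ z + C), k, ?_, ?_, hk0, ?_, ?_⟩
  · intro z
    have h1 := hasGradientAt_iff_hasFDerivAt.1 (hφ z)
    have h2 := hasGradientAt_iff_hasFDerivAt.1 (hasGrad_Qp P z)
    have h3 : HasFDerivAt (fun z => χ (φ z)) _ z := (hχd (φ z)).comp_hasFDerivAt z h1
    have h4 := ((h3.const_sub 1).fun_mul h2).fun_add (h3.fun_mul (h1.add_const C))
    refine hasGradientAt_of h4 fun v => ?_
    show _ = dot (z * k z) v
    rw [hzk, dot_add_left, dot_smul_left, dot_smul_left, hEV]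
    simp [hcd, dot]
    ring
  · rw [continuous_iff_continuousAt]
    intro z
    by_cases h : z = 0
    · subst h
      refine hEc.continuousAt.congr ?_
      filter_upwards [(isOpen_lt hφc continuous_const).mem_nhds hz0] with w hw
      exact (hlow w (le_of_lt hw)).symm
    · have h1 : ContinuousAt (fun z => f z / z) z := hf.continuousAt.div continuousAt_id h
      have h2 : Continuous (fun z => ((1 - χ (φ z) : ℝ) : ℂ) * E z) := by fun_prop
      have h3 : Continuous (fun z => ((c z : ℝ) : ℂ)) := Complex.continuous_ofReal.comp hcc
      exact h2.continuousAt.add (h3.continuousAt.mul h1)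
  · intro z hkz
    by_cases hl : φ z ≤ b - δ
    · rw [hlow z hl] at hkz
      rcases mul_eq_zero.1 hkz with h | h
      · exact (Real.exp_pos _).ne' (by exact_mod_cast h)
      · rw [map_eq_zero] at h
        exact hh z (by linarith) h
    push Not at hl
    have h1 := hzk z
    rw [hkz, mul_zero] at h1
    by_cases hb : b ≤ φ z
    · obtain ⟨h2, h3⟩ := hχr _ hb
      have h4 : c z = 1 := by simp [hcd, h2, h3]
      rw [h2, h4] at h1
      simp at h1
      exact hf0 z hb h1.symm
    push Not at hb
    have hdp := hcol z hl.le hb.le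
    have h2 : dot (((1 - χ (φ z) : ℝ) : ℂ) * (z * E z) + ((c z : ℝ) : ℂ) * f z) (f z) = 0 := by
      rw [← h1]; simp [dot]
    rw [dot_add_left, dot_smul_left, dot_smul_left, hEV, dot_smul_left, dot_self] at h2
    have hfz : 0 < ‖f z‖ := by
      rw [norm_pos_iff]
      intro h
      rw [h] at hdp; simp [dot] at hdp
    have hep := Real.exp_pos (2 * (P.eval z).re)
    have a1 := hχ0 (φ z)
    have a2 := hχ1 (φ z)
    have a3 := mul_nonneg (hχ'0 (φ z)) (by linarith [hC z hb.le] : 0 ≤ φ z + C - Qp P z)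
    have a4 : 0 < Real.exp (2 * (P.eval z).re) * dot (Vf P z) (f z) := by positivity
    have a5 : 0 < ‖f z‖ ^ 2 := by positivity
    have a6 : χ (φ z) ≤ c z := by simp only [hcd]; linarith
    rcases eq_or_lt_of_le a1 with h | h
    · rw [← h] at h2 a6
      have := mul_nonneg a6 a5.le
      linarith
    · have := mul_pos (lt_of_lt_of_le h a6) a5
      have := mul_nonneg (by linarith : 0 ≤ 1 - χ (φ z)) a4.le
      linarith
  · intro z hb
    obtain ⟨h2, h3⟩ := hχr _ hb
    have h4 : c z = 1 := by simp [hcd, h2, h3]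
    rw [hzk, h2, h4]
    simp

/-! ### Proper gradient homotopies in the complex plane -/

/-- Proper gradient homotopy in the complex plane. -/
def PH (f g : ℂ → ℂ) : Prop :=
  ∃ h : ℝ → ℂ → ℂ, Continuous (fun p : ℝ × ℂ => h p.1 p.2) ∧
    (∀ t ∈ Icc (0:ℝ) 1, ∃ φ, HasGrad φ (h t)) ∧
    (∀ C : ℝ, ∃ r : ℝ, ∀ t ∈ Icc (0:ℝ) 1, ∀ x, r ≤ ‖x‖ → C ≤ ‖h t x‖) ∧ h 0 = f ∧ h 1 = g

theorem PH.trans {f g k : ℂ → ℂ} (h1 : PH f g) (h2 : PH g k) : PH f k := by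
  obtain ⟨a, ac, ag, ap, a0, a1⟩ := h1
  obtain ⟨b, bc, bg, bp, b0, b1⟩ := h2
  refine ⟨fun t => if t ≤ 1 / 2 then a (2 * t) else b (2 * t - 1), ?_, ?_, ?_, ?_, ?_⟩
  · have e : (fun p : ℝ × ℂ => (if p.1 ≤ 1 / 2 then a (2 * p.1) else b (2 * p.1 - 1)) p.2) =
        fun p : ℝ × ℂ => if p.1 ≤ 1 / 2 then a (2 * p.1) p.2 else b (2 * p.1 - 1) p.2 := by
      funext p; split_ifs <;> rfl
    rw [e]
    refine continuous_if_le continuous_fst continuous_const ?_ ?_ ?_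
    · exact (ac.comp (by fun_prop : Continuous (fun p : ℝ × ℂ => (2 * p.1, p.2)))).continuousOn
    · exact (bc.comp (by fun_prop : Continuous (fun p : ℝ × ℂ => (2 * p.1 - 1, p.2)))).continuousOn
    · intro p hp
      rw [hp]; norm_num [a1, b0]
  · intro t ht
    dsimp only
    split_ifs with h
    · exact ag _ ⟨by linarith [ht.1], by linarith⟩
    · exact bg _ ⟨by linarith, by linarith [ht.2]⟩
  · intro C
    obtain ⟨r, hr⟩ := ap C
    obtain ⟨s, hs⟩ := bp C
    refine ⟨max r s, fun t ht x hx => ?_⟩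
    dsimp only
    split_ifs with h
    · exact hr _ ⟨by linarith [ht.1], by linarith⟩ x (le_trans (le_max_left _ _) hx)
    · exact hs _ ⟨by linarith, by linarith [ht.2]⟩ x (le_trans (le_max_right _ _) hx)
  · norm_num [a0]
  · norm_num [b1]

theorem HasGrad.neg {φ : ℂ → ℝ} {f : ℂ → ℂ} (h : HasGrad φ f) : HasGrad (fun z => - φ z) (fun z => - f z) := by
  intro z
  refine hasGradientAt_of (h z).hasFDerivAt.fun_neg fun v => ?_
  simp [dot]; ring

theorem PH.neg {f g : ℂ → ℂ} (h : PH f g) : PH (fun z => - f z) (fun z => - g z) := by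
  obtain ⟨a, ac, ag, ap, a0, a1⟩ := h
  refine ⟨fun t z => - a t z, ac.neg, fun t ht => ?_, ?_, by simp [a0], by simp [a1]⟩
  · obtain ⟨φ, hφ⟩ := ag t ht
    exact ⟨_, hφ.neg⟩
  · simpa using ap

theorem hasGrad_lin {φ ψ : ℂ → ℝ} {f g : ℂ → ℂ} (h : HasGrad φ f) (h' : HasGrad ψ g) (a b : ℝ) :
    HasGrad (fun z => a * φ z + b * ψ z) (fun z => (a : ℂ) * f z + (b : ℂ) * g z) := by
  intro z
  refine hasGradientAt_of (((h z).hasFDerivAt.const_mul a).fun_add ((h' z).hasFDerivAt.const_mul b)) fun v => ?_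
  simp [dot]; ring

theorem hasGrad_id : HasGrad (fun z => ‖z‖ ^ 2 / 2) (fun z : ℂ => z) := by
  intro z
  have h1 := (hasStrictFDerivAt_norm_sq z).hasFDerivAt
  have h2 := h1.const_mul (1 / 2 : ℝ)
  have e : (fun z : ℂ => ‖z‖ ^ 2 / 2) = fun z => (1 / 2 : ℝ) * ‖z‖ ^ 2 := by funext z; ring
  rw [e]
  refine hasGradientAt_of h2 fun v => ?_
  simp [dot]; ring

theorem hasGrad_scale {φ : ℂ → ℝ} {f : ℂ → ℂ} (h : HasGrad φ f) {u : ℝ} (hu : u ≠ 0) :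
    HasGrad (fun z => φ (u * z) / u ^ 2) (fun z => f (u * z) / u) := by
  intro z
  have h1 : HasFDerivAt (fun z : ℂ => (u : ℂ) * z) (u • ContinuousLinearMap.id ℝ ℂ) z := by
    have := (hasFDerivAt_id (𝕜 := ℝ) z).const_smul u
    have e : (fun z : ℂ => (u : ℂ) * z) = u • (id : ℂ → ℂ) := by
      funext z; simp
    rw [e]; exact this
  have h2 := ((h (u * z)).hasFDerivAt.comp z h1).const_mul (1 / u ^ 2)
  have e : (fun z => φ (u * z) / u ^ 2) = fun z => (1 / u ^ 2) * (φ ∘ fun z : ℂ => (u : ℂ) * z) z := by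
    funext z; simp; ring
  rw [e]
  refine hasGradientAt_of h2 fun v => ?_
  have : f (u * z) / u = ((1 / u : ℝ) : ℂ) * f (u * z) := by push_cast; ring
  dsimp only
  rw [this, dot_smul_left]
  simp [dot]
  field_simp
  

theorem ph_of_eq {φ ψ : ℂ → ℝ} {f g : ℂ → ℂ} (h : HasGrad φ f) (h' : HasGrad ψ g) (hf : Continuous f)
    (hg : Continuous g) (hbig : ∀ C : ℝ, ∃ r > 0, ∀ x, r ≤ ‖x‖ → C ≤ ‖f x‖) {ρ : ℝ}
    (he : ∀ x, ρ ≤ ‖x‖ → g x = f x) : PH f g := by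
  refine ⟨fun t z => ((1 - t : ℝ) : ℂ) * f z + (t : ℂ) * g z, ?_, ?_, ?_, ?_, ?_⟩
  · fun_prop
  · intro t _
    exact ⟨_, hasGrad_lin h h' (1 - t) t⟩
  · intro C
    obtain ⟨r, -, hr⟩ := hbig C
    refine ⟨max r ρ, fun t ht x hx => ?_⟩
    dsimp only
    rw [he x (le_trans (le_max_right _ _) hx), ← add_mul]
    have : (((1 - t : ℝ) : ℂ) + t) = 1 := by push_cast; ring
    rw [this, one_mul]
    exact hr x (le_trans (le_max_left _ _) hx)
  · simp
  · simp

theorem ph_contract {φ : ℂ → ℝ} {k : ℂ → ℂ} (h : HasGrad φ (fun z => z * k z)) (hk : Continuous k)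
    (hk0 : k 0 = 1) (hkn : ∀ z, k z ≠ 0)
    (hbig : ∀ C : ℝ, ∃ r > 0, ∀ x, r ≤ ‖x‖ → C ≤ ‖x * k x‖) : PH (fun z => z * k z) (fun z => z) := by
  refine ⟨fun t z => z * k (((1 - t : ℝ) : ℂ) * z), ?_, ?_, ?_, ?_, ?_⟩
  · fun_prop
  · intro t _
    by_cases ht : 1 - t = 0
    · refine ⟨_, (?_ : HasGrad (fun z => ‖z‖ ^ 2 / 2) _)⟩
      simp only [ht, Complex.ofReal_zero, zero_mul, hk0, mul_one]
      exact hasGrad_id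
    · have h1 := hasGrad_scale h ht
      refine ⟨fun z => φ (((1 - t : ℝ) : ℂ) * z) / (1 - t) ^ 2, ?_⟩
      convert h1 using 2 with z
      have : ((1 - t : ℝ) : ℂ) ≠ 0 := by exact_mod_cast ht
      field_simp
  · intro C
    obtain ⟨r, hr0, hr⟩ := hbig C
    obtain ⟨w, hw, hmin⟩ := (isCompact_closedBall (0:ℂ) r).exists_isMinOn ⟨0, by simp [hr0.le]⟩ hk.norm.continuousOn
    have hc : 0 < ‖k w‖ := norm_pos_iff.2 (hkn w)
    refine ⟨|C| / ‖k w‖, fun t ht x hx => ?_⟩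
    dsimp only
    by_cases hn : ‖((1 - t : ℝ) : ℂ) * x‖ ≤ r
    · have h1 : ‖k w‖ ≤ ‖k (((1 - t : ℝ) : ℂ) * x)‖ := hmin (by simpa using hn)
      rw [norm_mul]
      rw [div_le_iff₀ hc] at hx
      calc C ≤ |C| := le_abs_self C
        _ ≤ ‖x‖ * ‖k w‖ := hx
        _ ≤ _ := by gcongr
    · push Not at hn
      have h1 := hr _ hn.le
      refine h1.trans ?_
      rw [norm_mul, norm_mul, norm_mul]
      have h2 : ‖((1 - t : ℝ) : ℂ)‖ ≤ 1 := by
        rw [Complex.norm_real, Real.norm_eq_abs, abs_le]; constructor <;> linarith [ht.1, ht.2]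
      have h3 : ‖((1 - t : ℝ) : ℂ)‖ * ‖x‖ ≤ ‖x‖ := by nlinarith [norm_nonneg x]
      gcongr
  · simp
  · simp [hk0]

theorem PG.ph_id {D : CDeg} {φ : ℂ → ℝ} {f : ℂ → ℂ} (G : PG D φ f) (hb : BddBelow (range φ)) :
    PH f (fun z => z) := by
  obtain ⟨R, hR, hR1⟩ := G.big 1
  obtain ⟨b, ρ, H⟩ := Lev.exists G.hφ G.hf hR hR1 hb
  obtain ⟨P, hP0, hV, hh⟩ := G.poly H
  have hK : IsCompact {z | φ z ≤ b} := by
    refine Metric.isCompact_of_isClosed_isBounded (isClosed_le G.hφ.continuous continuous_const) ?_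
    refine isBounded_ball.subset (s := {z | φ z ≤ b}) (t := ball 0 ρ) fun z hz => ?_
    simpa using H.bdd z hz
  have hf0 : ∀ z, b ≤ φ z → f z ≠ 0 := by
    intro z hz h0
    have := H.big z (by linarith)
    rw [h0] at this; simp at this; linarith
  obtain ⟨φ', k, hφ', hk, hk0, hkn, he⟩ := glue G.hφ G.hf hK H.zero hV hh hP0 hf0
  have he' : ∀ z, ρ ≤ ‖z‖ → z * k z = f z := by
    intro z hz
    refine he z ?_
    by_contra h
    have := H.bdd z (not_le.1 h).le
    linarith
  refine (ph_of_eq G.hφ hφ' G.hf (by fun_prop) G.big he').trans (ph_contract hφ' hk hk0 hkn ?_)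
  intro C
  obtain ⟨r, hr, hr1⟩ := G.big C
  refine ⟨max r ρ, lt_of_lt_of_le hr (le_max_left _ _), fun x hx => ?_⟩
  rw [he' x (le_trans (le_max_right _ _) hx)]
  exact hr1 x (le_trans (le_max_left _ _) hx)

theorem PG.neg {D : CDeg} {φ : ℂ → ℝ} {f : ℂ → ℂ} (G : PG D φ f) : PG D (fun z => - φ z) (fun z => - f z) where
  hφ := G.hφ.neg
  hf := G.hf.neg
  big := by simpa using G.big
  deg := by
    intro R hR hz
    have hz' : ∀ x, R ≤ ‖x‖ → f x ≠ 0 := fun x hx h => hz x hx (by simp [h])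
    rw [D.deg_neg isOpen_ball isBounded_ball G.hf.continuousOn]
    · exact G.deg R hR hz'
    · intro x hx
      have := frontier_ball_subset_sphere hx
      exact hz' x (by simp at this; exact this.ge)

theorem PG.ph {D : CDeg} {φ : ℂ → ℝ} {f : ℂ → ℂ} (G : PG D φ f) :
    PH f (fun z => z) ∨ PH f (fun z => - z) := by
  rcases G.dichotomy with h | h
  · exact Or.inl (G.ph_id h)
  · right
    have h' : BddBelow (range fun z => - φ z) := by
      obtain ⟨B, hB⟩ := h
      refine ⟨-B, ?_⟩
      rintro _ ⟨z, rfl⟩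
      have := hB ⟨z, rfl⟩
      dsimp only; linarith
    have := (G.neg.ph_id h').neg
    simpa using this

/-- The identity and its negative are not connected by a proper gradient homotopy. -/
theorem not_ph (D : CDeg) (h : ℝ → ℂ → ℂ) (hc : Continuous (fun p : ℝ × ℂ => h p.1 p.2))
    (hg : ∀ t ∈ Icc (0:ℝ) 1, ∃ φ, HasGrad φ (h t))
    (hbig : ∀ C : ℝ, ∃ r > 0, ∀ t ∈ Icc (0:ℝ) 1, ∀ x, r ≤ ‖x‖ → C ≤ ‖h t x‖)
    (h0 : h 0 = fun z => z) (h1 : h 1 = fun z => - z) : False := by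
  have hct : ∀ t, Continuous (h t) := fun t => hc.comp (by fun_prop : Continuous (fun x : ℂ => (t, x)))
  have hPG : ∀ t ∈ Icc (0:ℝ) 1, ∀ φ, HasGrad φ (h t) → PG D φ (h t) := by
    intro t ht φ hφ
    refine ⟨hφ, hct t, fun C => ?_, ?_⟩
    · obtain ⟨r, hr, hr'⟩ := hbig C
      exact ⟨r, hr, hr' t ht⟩
    · intro R hR hz
      obtain ⟨r, hr, hr'⟩ := hbig 1
      set S := max R r
      have hn : ∀ s ∈ Icc (0:ℝ) 1, ∀ x, S ≤ ‖x‖ → h s x ≠ 0 := by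
        intro s hs x hx e
        have := hr' s hs x (le_trans (le_max_right _ _) hx)
        rw [e] at this; simp at this; linarith
      have e1 : D.deg (h t) (ball 0 S) = D.deg (h t) (ball 0 R) := by
        refine D.excision isOpen_ball isBounded_ball isOpen_ball (ball_subset_ball (le_max_left _ _))
          (hct t).continuousOn ?_
        intro x _ hx
        exact hz x (by simpa using hx)
      rw [← e1]
      have e2 := D.homotopyInv (fun s => h (s * t)) (ball 0 S) isOpen_ball isBounded_ball
        (hc.comp (by fun_prop : Continuous (fun p : ℝ × ℂ => (p.1 * t, p.2)))).continuousOn ?_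
      · simp only [zero_mul, one_mul] at e2
        rw [← e2, h0]
        exact D.normalized _ isOpen_ball isBounded_ball (mem_ball_self (lt_of_lt_of_le hR (le_max_left _ _)))
      · intro s hs x hx
        have := frontier_ball_subset_sphere hx
        refine hn _ ⟨mul_nonneg hs.1 ht.1, ?_⟩ x (by simp at this; exact this.ge)
        nlinarith [hs.1, hs.2, ht.1, ht.2]
  obtain ⟨r, hr, hr'⟩ := hbig 1
  obtain ⟨M, hM⟩ : ∃ M, ∀ t ∈ Icc (0:ℝ) 1, ∀ x, ‖x‖ ≤ r → ‖h t x‖ ≤ M := by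
    obtain ⟨M, hM⟩ := ((isCompact_Icc (a := (0:ℝ)) (b := 1)).prod (isCompact_closedBall (0:ℂ) r)).bddAbove_image
      hc.norm.continuousOn
    exact ⟨M, fun t ht x hx => hM ⟨(t, x), ⟨ht, by simpa using hx⟩, rfl⟩⟩
  have hM0 : 0 ≤ M := (norm_nonneg _).trans (hM 0 (by simp) 0 (by simp [hr.le]))
  have hsmall : ∀ t ∈ Icc (0:ℝ) 1, ∀ φ, HasGrad φ (h t) → ∀ x, ‖x‖ ≤ r → |φ x - φ 0| ≤ M * r := by
    intro t ht φ hφ x hx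
    obtain ⟨s, hs, e⟩ := hφ.mvt 0 x
    rw [e]
    refine (abs_dot_le _ _).trans ?_
    have : ‖(0:ℂ) + s * (x - 0)‖ ≤ r := by
      simp only [zero_add, sub_zero, norm_mul, Complex.norm_real, Real.norm_eq_abs, abs_of_pos hs.1]
      nlinarith [hs.1, hs.2, norm_nonneg x]
    have h2 := hM t ht _ this
    have h3 : ‖x - 0‖ ≤ r := by simpa using hx
    gcongr
  set L : ℝ := r + 2 * (M * r + 1) with hL
  have hLr : 0 < L := by positivity
  set x0 : ℂ := (L : ℂ) with hx0
  have hnx : ‖x0‖ = L := by rw [hx0, Complex.norm_real, Real.norm_eq_abs, abs_of_pos hLr]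
  have key : ∀ t ∈ Icc (0:ℝ) 1, ∀ φ, HasGrad φ (h t) → 1 ≤ |φ x0 - φ 0| := by
    have low : ∀ φ f, HasGrad φ f → (∀ x, r ≤ ‖x‖ → 1 ≤ ‖f x‖) → BddBelow (range φ) →
        (∀ x, ‖x‖ ≤ r → |φ x - φ 0| ≤ M * r) → 1 ≤ φ x0 - φ 0 := by
      intro φ f hφ hf1 hb hs
      have := hφ.growth hf1 hb (m := φ 0 - M * r) (fun x hx => by linarith [(abs_le.1 (hs x hx)).1]) x0
      rw [hnx, hL] at this
      linarith
    intro t ht φ hφ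
    rcases (hPG t ht φ hφ).dichotomy with hb | hb
    · exact (low φ _ hφ (hr' t ht) hb (hsmall t ht φ hφ)).trans (le_abs_self _)
    · have h' : BddBelow (range fun z => - φ z) := by
        obtain ⟨B, hB⟩ := hb
        refine ⟨-B, ?_⟩
        rintro _ ⟨z, rfl⟩
        have := hB ⟨z, rfl⟩
        dsimp only; linarith
      have := low _ _ hφ.neg (by simpa using hr' t ht) h' (fun x hx => by
        have := hsmall t ht φ hφ x hx
        rwa [← abs_neg, show -(φ x - φ 0) = -φ x - -φ 0 by ring] at this)
      have h2 := neg_abs_le (φ x0 - φ 0)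
      linarith
  set F : ℝ → ℝ := fun t => ∫ s in (0:ℝ)..1, dot (h t (s * x0)) x0 with hF
  have hcs : Continuous (fun p : ℝ × ℝ => dot (h p.1 (p.2 * x0)) x0) := by
    have := hc.comp (by fun_prop : Continuous (fun p : ℝ × ℝ => (p.1, (p.2 : ℂ) * x0)))
    unfold dot
    simp only [Function.comp_def] at this
    fun_prop
  have hFc : Continuous F :=
    intervalIntegral.continuous_parametric_intervalIntegral_of_continuous' hcs 0 1
  have hFe : ∀ t ∈ Icc (0:ℝ) 1, 1 ≤ |F t| := by
    intro t ht
    obtain ⟨φ, hφ⟩ := hg t ht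
    have e : F t = φ x0 - φ 0 := by
      have := intervalIntegral.integral_eq_sub_of_hasDerivAt (a := 0) (b := 1)
        (f := fun s : ℝ => φ (s * x0)) (f' := fun s : ℝ => dot (h t (s * x0)) x0)
        (fun s _ => hφ.comp (by simpa using (Complex.ofRealCLM.hasDerivAt (x := s)).mul_const x0)) 
        ((hcs.comp (by fun_prop : Continuous (fun s : ℝ => (t, s)))).intervalIntegrable 0 1)
      simpa using this
    rw [e]; exact key t ht φ hφ
  have hF0 : F 0 = L ^ 2 / 2 := by
    simp only [hF, h0, dot_smul_left, dot_self, hnx]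
    rw [intervalIntegral.integral_mul_const, integral_id]; ring
  have hF1 : F 1 = - (L ^ 2 / 2) := by
    have : ∀ s : ℝ, -((s : ℂ) * x0) = ((-s : ℝ) : ℂ) * x0 := fun s => by push_cast; ring
    simp only [hF, h1, this, dot_smul_left, dot_self, hnx]
    rw [intervalIntegral.integral_mul_const, intervalIntegral.integral_neg, integral_id]; ring
  have hpos : 0 < L ^ 2 / 2 := by positivity
  obtain ⟨t, ht, h2⟩ := intermediate_value_Icc' (zero_le_one (α := ℝ)) hFc.continuousOn
    (show (0:ℝ) ∈ Icc (F 1) (F 0) by rw [hF0, hF1]; constructor <;> linarith)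
  have := hFe t ht
  rw [h2] at this
  simp at this
  linarith

/-! ### Transport to the Euclidean plane -/

/-- transport of maps back to the complex plane -/
def fromE (g : Euc 2 → Euc 2) : ℂ → ℂ := fun z => iotaC.symm (g (iotaC z))

theorem toE_fromE (g : Euc 2 → Euc 2) : toE (fromE g) = g := by
  funext x; simp [toE, fromE]

theorem hasGradientAt_comp_isom {E F : Type*} [NormedAddCommGroup E] [InnerProductSpace ℝ E] [CompleteSpace E]
    [NormedAddCommGroup F] [InnerProductSpace ℝ F] [CompleteSpace F] (i : E ≃ₗᵢ[ℝ] F) {φ : F → ℝ} {w : F} {z : E}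
    (h : HasGradientAt φ w (i z)) : HasGradientAt (fun z => φ (i z)) (i.symm w) z := by
  rw [hasGradientAt_iff_hasFDerivAt] at h ⊢
  have h1 : HasFDerivAt (fun z => i z) (i.toContinuousLinearEquiv : E →L[ℝ] F) z :=
    i.toContinuousLinearEquiv.hasFDerivAt
  refine (h.comp z h1).congr_fderiv ?_
  apply ContinuousLinearMap.ext
  intro v
  have : inner ℝ w (i v) = inner ℝ (i.symm w) v := by
    rw [← i.inner_map_map (i.symm w) v]; simp
  simpa using this

theorem HasGrad.isGradient {φ : ℂ → ℝ} {f : ℂ → ℂ} (h : HasGrad φ f) (hf : Continuous f) :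
    IsGradient (toE f) := by
  refine ⟨fun x => φ (iotaC.symm x), (h.contDiff hf).comp iotaC.symm.contDiff, fun x => ?_⟩
  have := hasGradientAt_comp_isom iotaC.symm (h (iotaC.symm x))
  rw [this.gradient]
  simp [toE]

theorem IsGradient.hasGrad {g : Euc 2 → Euc 2} (h : IsGradient g) :
    Continuous (fromE g) ∧ ∃ φ, HasGrad φ (fromE g) := by
  obtain ⟨φ, hφ, hg⟩ := h
  have hc : Continuous g := by
    have e : g = fun x => (InnerProductSpace.toDual ℝ (Euc 2)).symm (fderiv ℝ φ x) := by
      funext x; rw [← hg x]; rfl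
    rw [e]
    exact (InnerProductSpace.toDual ℝ (Euc 2)).symm.continuous.comp (hφ.continuous_fderiv one_ne_zero)
  refine ⟨iotaC.symm.continuous.comp (hc.comp iotaC.continuous), fun z => φ (iotaC z), fun z => ?_⟩
  refine hasGradientAt_comp_isom iotaC ?_
  rw [← hg]
  exact (hφ.differentiable one_ne_zero _).hasGradientAt

theorem preimage_iotaC_ball (R : ℝ) : iotaC.symm ⁻¹' (ball 0 R) = ball 0 R := by
  ext x; simp

theorem pg_of {D : DegreeTheory 2} {g : Euc 2 → Euc 2} (hg : IsGradient g) (hp : IsProper g) (hd : HasDeg D g 1) :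
    ∃ φ, PG (CDeg.ofD D) φ (fromE g) := by
  obtain ⟨hc, φ, hφ⟩ := hg.hasGrad
  refine ⟨φ, hφ, hc, fun C => ?_, fun R hR hz => ?_⟩
  · obtain ⟨r, hr, hr'⟩ := (hp _ (isCompact_closedBall 0 C)).isBounded.subset_ball_lt 0 0
    refine ⟨r, hr, fun x hx => ?_⟩
    by_contra h
    have : iotaC x ∈ g ⁻¹' closedBall 0 C := by
      simp [fromE] at h
      simpa using h.le
    have := hr' this
    simp at this
    linarith
  · show D.deg (toE (fromE g)) (iotaC.symm ⁻¹' (ball 0 R)) = 1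
    rw [toE_fromE, preimage_iotaC_ball]
    refine hd R hR fun x hx => ?_
    by_contra h
    refine hz (iotaC.symm x) (by simpa using h) ?_
    have hx' : g x = 0 := hx
    simp [fromE, hx']

theorem PH.toE {f g : ℂ → ℂ} (h : PH f g) : ProperGradientHomotopic (_root_.toE f) (_root_.toE g) := by
  obtain ⟨a, ac, ag, ap, a0, a1⟩ := h
  have hc : Continuous (fun p : ℝ × Euc 2 => _root_.toE (a p.1) p.2) := by
    have h1 : Continuous (fun p : ℝ × Euc 2 => (p.1, iotaC.symm p.2)) := by
      have := iotaC.symm.continuous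
      fun_prop
    exact iotaC.continuous.comp (ac.comp h1)
  refine ⟨fun t => _root_.toE (a t), ⟨hc.continuousOn, fun t ht => ?_, fun K hK => ?_⟩, by simp [a0], by simp [a1]⟩
  · obtain ⟨φ, hφ⟩ := ag t ht
    exact hφ.isGradient (ac.comp (by fun_prop : Continuous (fun x : ℂ => (t, x))))
  · obtain ⟨C, hC⟩ := hK.isBounded.exists_norm_le
    obtain ⟨r, hr⟩ := ap (C + 1)
    refine ((isCompact_Icc (a := (0:ℝ)) (b := 1)).prod (isCompact_closedBall (0 : Euc 2) r)).of_isClosed_subset ?_ ?_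
    · exact (isClosed_Icc.preimage continuous_fst).inter (hK.isClosed.preimage hc)
    · rintro ⟨t, x⟩ ⟨ht, hx⟩
      refine ⟨ht, ?_⟩
      by_contra h
      simp at h
      have h1 := hr t ht (iotaC.symm x) (by simpa using h.le)
      have h2 := hC _ hx
      simp [_root_.toE] at h2
      linarith

theorem toE_id : toE (fun z => z) = id := by funext x; simp [toE]

theorem toE_neg : toE (fun z => -z) = fun x => -x := by funext x; simp [toE]

theorem fromE_id : fromE id = fun z => z := by funext x; simp [fromE]

theorem fromE_neg : fromE (fun x => -x) = fun z => -z := by funext x; simp [fromE]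

theorem not_homotopic (D : DegreeTheory 2) :
    ¬ ProperGradientHomotopic (id : Euc 2 → Euc 2) (fun x => -x) := by
  rintro ⟨h, ⟨hc, hg, hp⟩, h0, h1⟩
  set p : ℝ → ℝ := fun t => (projIcc 0 1 zero_le_one t : ℝ) with hpd
  have hpc : Continuous p := continuous_subtype_val.comp continuous_projIcc
  have hpm : ∀ t, p t ∈ Icc (0:ℝ) 1 := fun t => (projIcc 0 1 zero_le_one t).2
  refine not_ph (CDeg.ofD D) (fun t => fromE (h (p t))) ?_ ?_ ?_ ?_ ?_
  · have h1 : Continuous (fun q : ℝ × ℂ => (p q.1, iotaC q.2)) := by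
      have := iotaC.continuous
      fun_prop
    exact iotaC.symm.continuous.comp (hc.comp_continuous h1 fun q => ⟨hpm _, mem_univ _⟩)
  · intro t _
    exact (hg _ (hpm t)).hasGrad.2
  · intro C
    obtain ⟨r, hr, hr'⟩ := (hp _ (isCompact_closedBall 0 C)).isBounded.subset_ball_lt 0 0
    refine ⟨r, hr, fun t _ x hx => ?_⟩
    by_contra hcon
    have h2 : (p t, iotaC x) ∈ {p : ℝ × Euc 2 | p.1 ∈ Icc (0:ℝ) 1 ∧ h p.1 p.2 ∈ closedBall 0 C} := by
      refine ⟨hpm t, ?_⟩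
      simp [fromE] at hcon
      simpa using hcon.le
    have h3 := hr' h2
    rw [mem_ball_zero_iff] at h3
    have h4 := (norm_snd_le (p t, iotaC x)).trans_lt h3
    simp at h4
    linarith
  · have : p 0 = 0 := by simp [hpd]
    simp only [this, h0, fromE_id]
  · have : p 1 = 1 := by simp [hpd]
    simp only [this, h1, fromE_neg]

theorem hasDeg_id (D : DegreeTheory 2) : HasDeg D (id : Euc 2 → Euc 2) 1 := fun _ hR _ =>
  D.normalized _ isOpen_ball isBounded_ball (mem_ball_self hR)

theorem hasDeg_neg (D : DegreeTheory 2) : HasDeg D (fun x : Euc 2 => -x) 1 := by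
  intro R hR _
  have h1 := (CDeg.ofD D).deg_neg (F := id) (Ω := ball 0 R) isOpen_ball isBounded_ball continuous_id.continuousOn ?_
  · rw [(CDeg.ofD D).normalized _ isOpen_ball isBounded_ball (mem_ball_self hR)] at h1
    have h2 : D.deg (toE (fun z => -z)) (iotaC.symm ⁻¹' (ball 0 R)) = 1 := h1
    rwa [toE_neg, preimage_iotaC_ball] at h2
  · intro x hx h0
    have := frontier_ball_subset_sphere hx
    simp at this h0
    rw [h0] at this
    simp at this
    linarith

/-- the set of proper gradient homotopy classes of proper gradient maps of
Brouwer degree `1` on `ℝ²` has exactly two elements, the class of `id` and the class of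
`-id`: both are proper gradient maps of degree `1`, every proper gradient map of degree `1`
is proper gradient homotopic to one of them, and they are not proper gradient homotopic
to each other. -/
theorem proper_gradient_deg_one_exactly_two_classes (D : DegreeTheory 2) :
    IsGradient (id : Euc 2 → Euc 2) ∧ IsProper (id : Euc 2 → Euc 2) ∧
      HasDeg D (id : Euc 2 → Euc 2) 1 ∧
    IsGradient (fun x : Euc 2 => -x) ∧ IsProper (fun x : Euc 2 => -x) ∧
      HasDeg D (fun x : Euc 2 => -x) 1 ∧
    (∀ f : Euc 2 → Euc 2, IsGradient f → IsProper f → HasDeg D f 1 →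
      ProperGradientHomotopic f (id : Euc 2 → Euc 2) ∨
        ProperGradientHomotopic f (fun x : Euc 2 => -x)) ∧
    ¬ ProperGradientHomotopic (id : Euc 2 → Euc 2) (fun x : Euc 2 => -x) := by
  have a1 : IsGradient (id : Euc 2 → Euc 2) := by
    rw [← toE_id]; exact hasGrad_id.isGradient continuous_id
  have a2 : IsProper (id : Euc 2 → Euc 2) := fun K hK => hK
  have b1 : IsGradient (fun x : Euc 2 => -x) := by
    rw [← toE_neg]; exact hasGrad_id.neg.isGradient continuous_neg
  have b2 : IsProper (fun x : Euc 2 => -x) := fun K hK =>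
    (Homeomorph.neg (Euc 2)).isCompact_preimage.2 hK
  refine ⟨a1, a2, hasDeg_id D, b1, b2, hasDeg_neg D, ?_, not_homotopic D⟩
  intro f h1 h2 h3
  obtain ⟨φ, G⟩ := pg_of h1 h2 h3
  rcases G.ph with h | h
  · left; have := h.toE; rwa [toE_fromE, toE_id] at this
  · right; have := h.toE; rwa [toE_fromE, toE_neg] at this
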